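/- Let n ≥ 1, α > 0, and let k₀ be the smallest integer bigger than nα. Let f ∈ L^∞(H^n) and let F be a bounded smooth function on S with L_α F = 0 whose boundary value is f. Assume that for every Schwartz function φ on H^n ≅ ℝ^{2n+1} and every 0 ≤ p ≤ k₀+1, sup_{0 < a ≤ 1} |∫_{H^n} ∂_a^p F(w,a) φ(w) dw| < ∞. Then for every integer κ ≥ 1, every ω ∈ H^n and every ψ ∈ C_c^∞(ℝ \ {0}), one has ∫_{H^n} f(ω·w) e_κ^ψ(w) dw = 0. -/

import Mathlib

noncomputable section
open MeasureTheory Filter Set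
open scoped Topology BigOperators

/-- The Heisenberg group `H^n = ℂ^n × ℝ` as a set. -/
abbrev Hn (n : ℕ) : Type := (Fin n → ℂ) × ℝ

/-- The extension `S = H^n × (0,∞)`; we use `H^n × ℝ` and restrict to `a > 0`. -/
abbrev Sg (n : ℕ) : Type := Hn n × ℝ

/-- Directional derivative of a complex valued function in direction `v`. -/
def dirD {E : Type} [NormedAddCommGroup E] [NormedSpace ℝ E]
    (v : E) (f : E → ℂ) (p : E) : ℂ := fderiv ℝ f p v

def eX (n : ℕ) (j : Fin n) : Hn n := (fun i => if i = j then (1 : ℂ) else 0, 0)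
def eY (n : ℕ) (j : Fin n) : Hn n := (fun i => if i = j then Complex.I else 0, 0)
def eT (n : ℕ) : Hn n := (0, 1)

/-- `X_j = ∂_{x_j} + 2 y_j ∂_t` on `H^n`. -/
def XH (n : ℕ) (j : Fin n) (f : Hn n → ℂ) (p : Hn n) : ℂ :=
  dirD (eX n j) f p + 2 * ((p.1 j).im : ℂ) * dirD (eT n) f p

/-- `Y_j = ∂_{y_j} - 2 x_j ∂_t` on `H^n`. -/
def YH (n : ℕ) (j : Fin n) (f : Hn n → ℂ) (p : Hn n) : ℂ :=
  dirD (eY n j) f p - 2 * ((p.1 j).re : ℂ) * dirD (eT n) f p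

/-- `T = ∂_t` on `H^n`. -/
def TH (n : ℕ) (f : Hn n → ℂ) (p : Hn n) : ℂ := dirD (eT n) f p

/-- `ℒ_α = -(1/4) Σ (X_j² + Y_j²) + i α T` on `H^n`. -/
def LH (n : ℕ) (α : ℝ) (f : Hn n → ℂ) (p : Hn n) : ℂ :=
  -(1/4) * ∑ j, (XH n j (XH n j f) p + YH n j (YH n j f) p) + Complex.I * (α : ℂ) * TH n f p

/-- `Z̄_j = (1/2)(X_j + i Y_j)` on `H^n`. -/
def ZbarH (n : ℕ) (j : Fin n) (f : Hn n → ℂ) (p : Hn n) : ℂ :=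
  (1/2) * (XH n j f p + Complex.I * YH n j f p)

/-- A function is bounded. -/
def BddFun {X : Type} (f : X → ℂ) : Prop := ∃ C, ∀ p, ‖f p‖ ≤ C

def eXS (n : ℕ) (j : Fin n) : Sg n := (eX n j, 0)
def eYS (n : ℕ) (j : Fin n) : Sg n := (eY n j, 0)
def eTS (n : ℕ) : Sg n := (eT n, 0)
def eA (n : ℕ) : Sg n := (0, 1)

/-- `X_j` on `S`. -/
def XS (n : ℕ) (j : Fin n) (F : Sg n → ℂ) (p : Sg n) : ℂ :=
  dirD (eXS n j) F p + 2 * ((p.1.1 j).im : ℂ) * dirD (eTS n) F p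

/-- `Y_j` on `S`. -/
def YS (n : ℕ) (j : Fin n) (F : Sg n → ℂ) (p : Sg n) : ℂ :=
  dirD (eYS n j) F p - 2 * ((p.1.1 j).re : ℂ) * dirD (eTS n) F p

/-- `T = ∂_t` on `S`. -/
def TS (n : ℕ) (F : Sg n → ℂ) (p : Sg n) : ℂ := dirD (eTS n) F p

/-- `∂_a` on `S`. -/
def DA (n : ℕ) (F : Sg n → ℂ) : Sg n → ℂ := fun p => dirD (eA n) F p

/-- `ℒ = -(1/4) Σ (X_j² + Y_j²)` acting in the `H^n`-variables on `S`. -/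
def LS0 (n : ℕ) (F : Sg n → ℂ) (p : Sg n) : ℂ :=
  -(1/4) * ∑ j, (XS n j (XS n j F) p + YS n j (YS n j F) p)

/-- `L_α = -α a (ℒ + n ∂_a) + a² (∂_a² + T²)` on `S`. -/
def Lalpha (n : ℕ) (α : ℝ) (F : Sg n → ℂ) (p : Sg n) : ℂ :=
  -(α : ℂ) * (p.2 : ℂ) * (LS0 n F p + (n : ℂ) * DA n F p)
    + (p.2 : ℂ) ^ 2 * (DA n (DA n F) p + TS n (TS n F) p)

/-- The complex space `ℂ^{n+1}` in which the Siegel upper half-plane lives. -/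
abbrev Vn (n : ℕ) : Type := (Fin n → ℂ) × ℂ

/-- The Siegel upper half-plane `U^n`. -/
def Un (n : ℕ) : Set (Vn n) := {z | ∑ j, ‖z.1 j‖ ^ 2 < z.2.im}

/-- The function `F_u` on the Siegel upper half-plane corresponding to a function `F` on `S`,
via `F[ζ,t,a] = F_u(ζ, t + i|ζ|² + ia)`, i.e.
`F_u(z', z_{n+1}) = F(z', Re z_{n+1}, Im z_{n+1} - |z'|²)`. -/
def Fu (n : ℕ) (F : Sg n → ℂ) : Vn n → ℂ :=
  fun z => F ((z.1, z.2.re), z.2.im - ∑ j, ‖z.1 j‖ ^ 2)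

/-- `F` is holomorphic if `F_u` is holomorphic on `U^n`. -/
def IsHolo (n : ℕ) (F : Sg n → ℂ) : Prop := DifferentiableOn ℂ (Fu n F) (Un n)

/-- `F` is anti-holomorphic if the conjugate of `F_u` is holomorphic on `U^n`. -/
def IsAntiHolo (n : ℕ) (F : Sg n → ℂ) : Prop :=
  DifferentiableOn ℂ (fun z => (starRingEnd ℂ) (Fu n F z)) (Un n)

/-- Wirtinger derivative `∂_z` in complex direction `v`. -/
def dzV (n : ℕ) (v : Vn n) (f : Vn n → ℂ) (p : Vn n) : ℂ :=
  (1/2) * (fderiv ℝ f p v - Complex.I * fderiv ℝ f p (Complex.I • v))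

/-- Wirtinger derivative `∂_{z̄}` in complex direction `v`. -/
def dzbarV (n : ℕ) (v : Vn n) (f : Vn n → ℂ) (p : Vn n) : ℂ :=
  (1/2) * (fderiv ℝ f p v + Complex.I * fderiv ℝ f p (Complex.I • v))

/-- The standard complex basis vectors of `ℂ^{n+1} = ℂ^n × ℂ`. -/
def basisV (n : ℕ) (k : Fin (n + 1)) : Vn n :=
  if _h : (k : ℕ) < n then (fun i => if (i : ℕ) = (k : ℕ) then (1 : ℂ) else 0, 0) else (0, 1)

/-- `F` is pluriharmonic if `∂_{z_k} ∂_{z̄_j} F_u = 0` on `U^n` for all `1 ≤ j,k ≤ n+1`. -/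
def IsPluriharmonic (n : ℕ) (F : Sg n → ℂ) : Prop :=
  ∀ p ∈ Un n, ∀ j k : Fin (n + 1),
    dzV n (basisV n k) (dzbarV n (basisV n j) (Fu n F)) p = 0

/-- `f` is the boundary value of `F` : for every `φ ∈ L¹(H^n)`,
`∫ F(w,a) φ(w) dw → ∫ f(w) φ(w) dw` as `a → 0⁺`. -/
def IsBoundaryValue (n : ℕ) (F : Sg n → ℂ) (f : Hn n → ℂ) : Prop :=
  ∀ φ : Hn n → ℂ, Integrable φ →
    Tendsto (fun a : ℝ => ∫ w : Hn n, F (w, a) * φ w) (𝓝[>] (0 : ℝ))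
      (𝓝 (∫ w : Hn n, f w * φ w))

/-- The normalized Hermite function `h_k(x) = (√π 2^k k!)^{-1/2} (-1)^k e^{x²/2} (d/dx)^k e^{-x²}`. -/
def hermiteFun (k : ℕ) (x : ℝ) : ℝ :=
  (Real.sqrt Real.pi * 2 ^ k * (Nat.factorial k : ℝ)) ^ (-(1/2 : ℝ)) * (-1 : ℝ) ^ k *
    Real.exp (x ^ 2 / 2) * (deriv^[k] (fun y : ℝ => Real.exp (-y ^ 2)) x)

/-- For a multi-index `k`, `h_k = h_{k_1} ⊗ ⋯ ⊗ h_{k_n}`. -/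
def hermiteMulti (n : ℕ) (k : Fin n → ℕ) (x : Fin n → ℝ) : ℝ := ∏ j, hermiteFun (k j) (x j)

/-- The rescaled Hermite function `h_k^λ(x) = (2π|λ|)^{n/4} h_k((2π|λ|)^{1/2} x)`. -/
def hermiteLam (n : ℕ) (lam : ℝ) (k : Fin n → ℕ) (x : Fin n → ℝ) : ℝ :=
  (2 * Real.pi * |lam|) ^ ((n : ℝ) / 4) *
    hermiteMulti n k (fun j => (2 * Real.pi * |lam|) ^ ((1 : ℝ) / 2) * x j)

/-- The representation `R^λ[u+iv,t] Φ(x) = e^{2πiλ(u·x + u·v/2 + t/4)} Φ(x+v)` of `H^n`. -/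
def Rrep (n : ℕ) (lam : ℝ) (w : Hn n) (Φ : (Fin n → ℝ) → ℂ) (x : Fin n → ℝ) : ℂ :=
  Complex.exp (2 * Real.pi * Complex.I * (lam : ℂ) *
      (((∑ j, (w.1 j).re * x j) + (∑ j, (w.1 j).re * (w.1 j).im) / 2 + w.2 / 4 : ℝ) : ℂ)) *
    Φ (fun j => x j + (w.1 j).im)

/-- `e_κ^λ(w) = Σ_{|k|=κ} ⟨R^λ(w) h_k^λ, h_k^λ⟩_{L²(ℝ^n)}`. -/
def eKappaLam (n : ℕ) (κ : ℕ) (lam : ℝ) (w : Hn n) : ℂ :=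
  ∑ k ∈ Finset.Nat.antidiagonalTuple n κ,
    ∫ x : Fin n → ℝ,
      Rrep n lam w (fun x' => ((hermiteLam n lam k x' : ℝ) : ℂ)) x *
        (starRingEnd ℂ) ((hermiteLam n lam k x : ℝ) : ℂ)

/-- `e_κ^ψ(w) = ∫_ℝ e_κ^λ(w) ψ(λ) dλ`. -/
def eKappaPsi (n : ℕ) (κ : ℕ) (ψ : ℝ → ℝ) (w : Hn n) : ℂ :=
  ∫ lam : ℝ, eKappaLam n κ lam w * ((ψ lam : ℝ) : ℂ)

/-- The Heisenberg group product `[ζ,t]·[η,s] = [ζ+η, t+s+2 Im(ζ·conj η)]`. -/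
def HeisMul (n : ℕ) (ω w : Hn n) : Hn n :=
  (ω.1 + w.1, ω.2 + w.2 + 2 * (∑ j, ω.1 j * (starRingEnd ℂ) (w.1 j)).im)

section

structure CoreHyp {V : Type*} [AddCommGroup V] [Module ℂ V] [TopologicalSpace V]
    (L T : V →ₗ[ℂ] V) (g : ℝ → V →ₗ[ℂ] ℂ) (f : V →ₗ[ℂ] ℂ) (gd : ℕ → ℝ → V → ℂ)
    (D : Set V) (ν α : ℝ) (m : ℕ) : Prop where
  hν : 0 < ν
  hα : 0 < α
  hm : m = ⌊ν⌋₊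
  cL : Continuous L
  cT : Continuous T
  bdd : ∃ q : Seminorm ℂ V, Continuous q ∧ ∀ a, 0 < a → ∀ φ, ‖g a φ‖ ≤ q φ
  cont : ∀ φ, ContinuousOn (fun a => g a φ) (Ioi 0)
  lim : ∀ φ, Tendsto (fun a => g a φ) (𝓝[>] 0) (𝓝 (f φ))
  dense : Dense D
  DL : ∀ φ ∈ D, L φ ∈ D
  DT : ∀ φ ∈ D, T φ ∈ D
  gd0 : ∀ a φ, gd 0 a φ = g a φ
  gdd : ∀ φ ∈ D, ∀ p a, 0 < a → HasDerivAt (fun x => gd p x φ) (gd (p+1) a φ) a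
  ode : ∀ φ ∈ D, ∀ a : ℝ, 0 < a →
    (a:ℂ) * gd 2 a φ - (ν:ℂ) * gd 1 a φ = (α:ℂ) * g a (L φ) - (a:ℂ) * g a (T φ)
  reg : ∀ φ ∈ D, ∀ p, p ≤ m + 2 → ∃ C, ∀ a, 0 < a → a ≤ 1 → ‖gd p a φ‖ ≤ C

/-- bounded by a continuous seminorm -/
def SBd {V : Type*} [AddCommGroup V] [Module ℂ V] [TopologicalSpace V] (F : V → ℝ) : Prop :=
  ∃ q : Seminorm ℂ V, Continuous q ∧ ∀ φ, F φ ≤ q φ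

section
variable {V : Type*} [AddCommGroup V] [Module ℂ V] [TopologicalSpace V]

theorem SBd.mono {F G : V → ℝ} (h : SBd G) (hFG : ∀ φ, F φ ≤ G φ) : SBd F := by
  obtain ⟨q, hq, h⟩ := h
  exact ⟨q, hq, fun φ => (hFG φ).trans (h φ)⟩

theorem SBd.add {F G : V → ℝ} (hF : SBd F) (hG : SBd G) : SBd (fun φ => F φ + G φ) := by
  obtain ⟨q, hq, h⟩ := hF
  obtain ⟨q', hq', h'⟩ := hG
  refine ⟨q + q', ?_, fun φ => ?_⟩
  · exact hq.add hq'
  · exact add_le_add (h φ) (h' φ)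

theorem SBd.zero : SBd (fun _ : V => (0:ℝ)) := ⟨0, continuous_const, fun _ => le_rfl⟩

theorem SBd.smul {F : V → ℝ} (hF : SBd F) (c : ℝ) (hc : 0 ≤ c) : SBd (fun φ => c * F φ) := by
  obtain ⟨q, hq, h⟩ := hF
  refine ⟨c.toNNReal • q, ?_, fun φ => ?_⟩
  · exact continuous_const.mul hq
  · have : (c.toNNReal • q) φ = c * q φ := by
      rw [smul_apply, NNReal.smul_def, Real.coe_toNNReal c hc, smul_eq_mul]
    rw [this]
    exact mul_le_mul_of_nonneg_left (h φ) hc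

theorem SBd.self {q : Seminorm ℂ V} (hq : Continuous q) : SBd (fun φ => q φ) :=
  ⟨q, hq, fun _ => le_rfl⟩

theorem SBd.comp {F : V → ℝ} (hF : SBd F) (L : V →ₗ[ℂ] V) (hL : Continuous L) :
    SBd (fun φ => F (L φ)) := by
  obtain ⟨q, hq, h⟩ := hF
  exact ⟨q.comp L, hq.comp hL, fun φ => h (L φ)⟩

theorem SBd.tendsto {F : V → ℝ} (hF : SBd F) [ContinuousSub V] (φ : V) {ε : ℝ} (hε : 0 < ε) :
    ∀ᶠ φ' in 𝓝 φ, F (φ - φ') < ε := by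
  obtain ⟨q, hq, h⟩ := hF
  have : Tendsto (fun φ' => q (φ - φ')) (𝓝 φ) (𝓝 (q (φ - φ))) :=
    (hq.comp (continuous_const.sub continuous_id)).tendsto φ
  rw [sub_self, map_zero] at this
  filter_upwards [this.eventually (gt_mem_nhds hε)] with φ' h'
  exact (h _).trans_lt h'

variable {L T : V →ₗ[ℂ] V} {g : ℝ → V →ₗ[ℂ] ℂ} {f : V →ₗ[ℂ] ℂ} {gd : ℕ → ℝ → V → ℂ}
    {D : Set V} {ν α : ℝ} {m : ℕ}

/-- right-hand side of the ODE -/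
def coreE (L T : V →ₗ[ℂ] V) (g : ℝ → V →ₗ[ℂ] ℂ) (α : ℝ) (x : ℝ) (φ : V) : ℂ :=
  (α:ℂ) * g x (L φ) - (x:ℂ) * g x (T φ)

theorem CoreHyp.fbd (h : CoreHyp L T g f gd D ν α m) : SBd (fun φ => ‖f φ‖) := by
  obtain ⟨q, hq, hb⟩ := h.bdd
  refine ⟨q, hq, fun φ => ?_⟩
  refine le_of_tendsto (h.lim φ).norm ?_
  filter_upwards [self_mem_nhdsWithin] with a ha
  exact hb a ha φ

theorem CoreHyp.contE (h : CoreHyp L T g f gd D ν α m) (φ : V) :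
    ContinuousOn (fun x => coreE L T g α x φ) (Ioi 0) := by
  unfold coreE
  have h1 := h.cont (L φ)
  have h2 := h.cont (T φ)
  have h3 : ContinuousOn (fun x : ℝ => (x:ℂ)) (Ioi 0) := Complex.continuous_ofReal.continuousOn
  exact (continuousOn_const.mul h1).sub (h3.mul h2)

theorem CoreHyp.Ebd (h : CoreHyp L T g f gd D ν α m) (M : ℝ) (hM : 0 ≤ M) :
    ∃ q : Seminorm ℂ V, Continuous q ∧ ∀ a, 0 < a → a ≤ M → ∀ φ, ‖coreE L T g α a φ‖ ≤ q φ := by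
  obtain ⟨q, hq, hb⟩ := h.bdd
  obtain ⟨q', hq', hb'⟩ := (((SBd.self hq).comp L h.cL).smul
    α h.hα.le).add (((SBd.self hq).comp T h.cT).smul M hM)
  refine ⟨q', hq', fun a ha haM φ => ?_⟩
  refine le_trans ?_ (hb' φ)
  unfold coreE
  refine (norm_sub_le _ _).trans ?_
  rw [norm_mul, norm_mul, Complex.norm_real, Complex.norm_real, Real.norm_of_nonneg h.hα.le,
    Real.norm_of_nonneg ha.le]
  refine add_le_add (mul_le_mul_of_nonneg_left (hb a ha _) h.hα.le) ?_
  exact mul_le_mul haM (hb a ha _) (norm_nonneg _) hM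

theorem CoreHyp.intE (h : CoreHyp L T g f gd D ν α m) (φ : V) (a : ℝ) (ha : 0 ≤ a) :
    IntervalIntegrable (fun x => coreE L T g α x φ) volume 0 a := by
  obtain ⟨q, hq, hb⟩ := h.Ebd a ha
  rw [intervalIntegrable_iff_integrableOn_Ioc_of_le ha]
  refine IntegrableOn.of_bound (C := q φ) (by simp) ?_ ?_
  · exact ((h.contE φ).mono Ioc_subset_Ioi_self).aestronglyMeasurable measurableSet_Ioc
  · filter_upwards [ae_restrict_mem measurableSet_Ioc] with x hx
    exact hb x hx.1 hx.2 φ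

def coreI (L T : V →ₗ[ℂ] V) (g : ℝ → V →ₗ[ℂ] ℂ) (α : ℝ) (a : ℝ) (φ : V) : ℂ :=
  ∫ x in (0:ℝ)..a, coreE L T g α x φ

theorem CoreHyp.derivI (h : CoreHyp L T g f gd D ν α m) (φ : V) (a : ℝ) (ha : 0 < a) :
    HasDerivAt (fun x => coreI L T g α x φ) (coreE L T g α a φ) a := by
  unfold coreI
  refine intervalIntegral.integral_hasDerivAt_right (h.intE φ a ha.le) ?_ ?_
  · exact (h.contE φ).stronglyMeasurableAtFilter isOpen_Ioi a ha
  · exact (h.contE φ).continuousAt (Ioi_mem_nhds ha)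

theorem CoreHyp.normI (h : CoreHyp L T g f gd D ν α m) (M : ℝ) (hM : 0 ≤ M) :
    ∃ q : Seminorm ℂ V, Continuous q ∧ ∀ a, 0 < a → a ≤ M → ∀ φ, ‖coreI L T g α a φ‖ ≤ a * q φ := by
  obtain ⟨q, hq, hb⟩ := h.Ebd M hM
  refine ⟨q, hq, fun a ha haM φ => ?_⟩
  unfold coreI
  have := intervalIntegral.norm_integral_le_of_norm_le_const (a := (0:ℝ)) (b := a)
    (f := fun x => coreE L T g α x φ) (C := q φ) ?_
  · rw [sub_zero, abs_of_pos ha] at this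
    linarith
  · intro x hx
    rw [uIoc_of_le ha.le] at hx
    exact hb x hx.1 (hx.2.trans haM) φ

theorem CoreHyp.limI (h : CoreHyp L T g f gd D ν α m) (φ : V) :
    Tendsto (fun x => coreI L T g α x φ) (𝓝[>] 0) (𝓝 0) := by
  obtain ⟨q, hq, hb⟩ := h.normI 1 zero_le_one
  have h0 : Tendsto (fun a : ℝ => a * q φ) (𝓝[>] 0) (𝓝 0) := by
    have : Tendsto (fun a : ℝ => a * q φ) (𝓝 0) (𝓝 (0 * q φ)) :=
      (continuous_id.mul continuous_const).tendsto 0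
    rw [zero_mul] at this
    exact this.mono_left nhdsWithin_le_nhds
  refine squeeze_zero_norm' ?_ h0
  filter_upwards [Ioc_mem_nhdsGT (zero_lt_one' ℝ)] with a ha
  exact hb a ha.1 ha.2 φ

theorem core_const_of_deriv_zero {P : ℝ → ℂ} {l : ℂ} (hP : ∀ a, 0 < a → HasDerivAt P 0 a)
    (hl : Tendsto P (𝓝[>] 0) (𝓝 l)) (a : ℝ) (ha : 0 < a) : P a = l := by
  have hc : ∀ b, 0 < b → P b = P a := by
    intro b hb
    refine (convex_Ioi (0:ℝ)).is_const_of_fderivWithin_eq_zero (𝕜 := ℝ) (f := P) ?_ ?_ hb ha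
    · intro x hx
      exact (hP x hx).differentiableAt.differentiableWithinAt
    · intro x hx
      have := (hP x hx).hasFDerivAt.hasFDerivWithinAt (s := Ioi 0)
      rw [this.fderivWithin (isOpen_Ioi.uniqueDiffWithinAt hx)]
      ext; simp
  refine tendsto_nhds_unique (f := fun _ : ℝ => P a) (l := 𝓝[>] (0:ℝ)) tendsto_const_nhds ?_
  refine hl.congr' ?_
  filter_upwards [self_mem_nhdsWithin] with b hb
  exact hc b hb

theorem CoreHyp.first (h : CoreHyp L T g f gd D ν α m) (φ : V) (hφ : φ ∈ D) (a : ℝ) (ha : 0 < a) :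
    (a:ℂ) * gd 1 a φ = (1 + ν) * (g a φ - f φ) + coreI L T g α a φ := by
  have key := core_const_of_deriv_zero
    (P := fun x => (x:ℂ) * gd 1 x φ - (1+ν) * gd 0 x φ - coreI L T g α x φ)
    (l := 0 - (1+ν) * f φ - 0) ?_ ?_ a ha
  · simp only [h.gd0] at key
    linear_combination key
  · intro x hx
    have h1 := h.gdd φ hφ 1 x hx
    have h0 := h.gdd φ hφ 0 x hx
    have hx1 : HasDerivAt (fun x : ℝ => (x:ℂ)) 1 x := Complex.ofRealCLM.hasDerivAt
    have hI := h.derivI φ x hx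
    have := ((hx1.mul h1).sub (h0.const_mul (1+(ν:ℂ)))).sub hI
    refine this.congr_deriv ?_
    have ode := h.ode φ hφ x hx
    unfold coreE
    linear_combination ode
  · refine Tendsto.sub (Tendsto.sub ?_ ?_) (h.limI φ)
    · obtain ⟨C, hC⟩ := h.reg φ hφ 1 (by omega)
      have h0 : Tendsto (fun a : ℝ => a * C) (𝓝[>] 0) (𝓝 0) := by
        have : Tendsto (fun a : ℝ => a * C) (𝓝 0) (𝓝 (0 * C)) :=
          (continuous_id.mul continuous_const).tendsto 0
        rw [zero_mul] at this
        exact this.mono_left nhdsWithin_le_nhds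
      refine squeeze_zero_norm' ?_ h0
      filter_upwards [Ioc_mem_nhdsGT (zero_lt_one' ℝ)] with a ha
      rw [norm_mul, Complex.norm_real, Real.norm_of_nonneg ha.1.le]
      exact mul_le_mul_of_nonneg_left (hC a ha.1 ha.2) ha.1.le
    · simp only [h.gd0]
      exact (h.lim φ).const_mul _

/-- derivative of `g` on all of `V` -/
def coreG1 (L T : V →ₗ[ℂ] V) (g : ℝ → V →ₗ[ℂ] ℂ) (f : V →ₗ[ℂ] ℂ) (ν α : ℝ) (a : ℝ) (φ : V) : ℂ :=
  ((1 + ν) * (g a φ - f φ) + coreI L T g α a φ) / a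

theorem coreE_sub (x : ℝ) (φ ψ : V) :
    coreE L T g α x (φ - ψ) = coreE L T g α x φ - coreE L T g α x ψ := by
  simp only [coreE, map_sub]; ring

theorem CoreHyp.I_sub (h : CoreHyp L T g f gd D ν α m) (a : ℝ) (ha : 0 < a) (φ ψ : V) :
    coreI L T g α a (φ - ψ) = coreI L T g α a φ - coreI L T g α a ψ := by
  unfold coreI
  rw [← intervalIntegral.integral_sub (h.intE φ a ha.le) (h.intE ψ a ha.le)]
  simp only [coreE_sub]

theorem CoreHyp.G1_sub (h : CoreHyp L T g f gd D ν α m) (a : ℝ) (ha : 0 < a) (φ ψ : V) :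
    coreG1 L T g f ν α a (φ - ψ) = coreG1 L T g f ν α a φ - coreG1 L T g f ν α a ψ := by
  unfold coreG1
  rw [h.I_sub a ha, map_sub, map_sub]
  ring

theorem CoreHyp.G1bd (h : CoreHyp L T g f gd D ν α m) (M : ℝ) (hM : 0 ≤ M) :
    ∃ q : Seminorm ℂ V, Continuous q ∧ ∀ a, 0 < a → a ≤ M → ∀ φ,
      a * ‖coreG1 L T g f ν α a φ‖ ≤ q φ := by
  obtain ⟨q, hq, hb⟩ := h.bdd
  obtain ⟨q1, hq1, hb1⟩ := h.fbd
  obtain ⟨q2, hq2, hb2⟩ := h.normI M hM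
  have hν := h.hν
  obtain ⟨q', hq', hb'⟩ := (((SBd.self hq).add
    (SBd.self hq1)).smul (1+ν) (by linarith)).add
    ((SBd.self hq2).smul M hM)
  refine ⟨q', hq', fun a ha haM φ => le_trans ?_ (hb' φ)⟩
  unfold coreG1
  rw [norm_div, Complex.norm_real, Real.norm_of_nonneg ha.le, mul_div_cancel₀ _ ha.ne']
  refine (norm_add_le _ _).trans ?_
  rw [norm_mul]
  have : ‖(1 + (ν:ℂ))‖ = 1 + ν := by
    rw [← Complex.ofReal_one, ← Complex.ofReal_add, Complex.norm_real,
      Real.norm_of_nonneg (by linarith)]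
  rw [this]
  refine add_le_add (mul_le_mul_of_nonneg_left ?_ (by linarith)) ?_
  · exact (norm_sub_le _ _).trans (add_le_add (hb a ha φ) (hb1 φ))
  · exact (hb2 a ha haM φ).trans (mul_le_mul_of_nonneg_right haM (apply_nonneg q2 φ))

theorem CoreHyp.deriv_g [ContinuousSub V] (h : CoreHyp L T g f gd D ν α m) (φ : V) (a : ℝ)
    (ha : 0 < a) : HasDerivAt (fun x => g x φ) (coreG1 L T g f ν α a φ) a := by
  have : (𝓝[D] φ).NeBot := mem_closure_iff_nhdsWithin_neBot.1 (h.dense φ)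
  refine hasDerivAt_of_tendstoUniformlyOn (l := 𝓝[D] φ) (s := Ioo (a/2) (a+1))
    (f := fun φ' x => g x φ')
    (f' := fun φ' x => coreG1 L T g f ν α x φ') (g := fun x => g x φ)
    (g' := fun x => coreG1 L T g f ν α x φ) (x := a) isOpen_Ioo ?_ ?_ ?_ ?_
  · obtain ⟨q, hq, hb⟩ := h.G1bd (a+1) (by linarith)
    rw [Metric.tendstoUniformlyOn_iff]
    intro ε hε
    have := (SBd.self hq).tendsto φ
      (show 0 < ε * (a/2) by positivity)
    filter_upwards [this.filter_mono nhdsWithin_le_nhds, self_mem_nhdsWithin] with φ' h1 h2 x hx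
    rw [dist_eq_norm, ← h.G1_sub x (by linarith [hx.1])]
    have hx0 : 0 < x := by linarith [hx.1]
    have h3 := hb x hx0 hx.2.le (φ - φ')
    by_contra hcon
    push Not at hcon
    have : ε * (a/2) ≤ ‖coreG1 L T g f ν α x (φ - φ')‖ * x := by
      have := hx.1.le
      gcongr
    linarith
  · filter_upwards [self_mem_nhdsWithin] with φ' h2 x hx
    have hx0 : 0 < x := by linarith [hx.1]
    have h0 := h.gdd φ' h2 0 x hx0
    simp only [h.gd0] at h0
    refine h0.congr_deriv ?_
    unfold coreG1
    rw [← h.first φ' h2 x hx0]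
    have : (x:ℂ) ≠ 0 := by exact_mod_cast hx0.ne'
    field_simp
  · intro x hx
    have hx0 : 0 < x := by linarith [hx.1]
    obtain ⟨q, hq, hb⟩ := h.bdd
    rw [Metric.tendsto_nhds]
    intro ε hε
    have := (SBd.self hq).tendsto φ hε
    filter_upwards [this.filter_mono nhdsWithin_le_nhds, self_mem_nhdsWithin] with φ' h1 h2
    rw [dist_eq_norm, norm_sub_rev, ← map_sub]
    exact (hb x hx0 _).trans_lt h1
  · exact ⟨by linarith, by linarith⟩

end

end

section

theorem core_mvt {u u' : ℝ → ℂ} {B B' : ℝ → ℝ} {a b : ℝ} (hab : a ≤ b)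
    (hu : ∀ x ∈ Icc a b, HasDerivAt u (u' x) x) (hB : ∀ x ∈ Icc a b, HasDerivAt B (B' x) x)
    (hle : ∀ x ∈ Icc a b, ‖u' x‖ ≤ B' x) : ‖u b - u a‖ ≤ B b - B a := by
  have := image_norm_le_of_norm_deriv_right_le_deriv_boundary' (f := fun x => u x - u a)
    (f' := u') (B := fun x => B x - B a) (B' := B') (a := a) (b := b) ?_ ?_ ?_ ?_ ?_ ?_
    (right_mem_Icc.2 hab)
  · exact this
  · intro x hx
    exact ((hu x hx).continuousAt.sub continuousAt_const).continuousWithinAt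
  · intro x hx
    exact ((hu x (Ico_subset_Icc_self hx)).sub_const _).hasDerivWithinAt
  · simp
  · intro x hx
    exact ((hB x hx).continuousAt.sub continuousAt_const).continuousWithinAt
  · intro x hx
    exact ((hB x (Ico_subset_Icc_self hx)).sub_const _).hasDerivWithinAt
  · intro x hx
    exact hle x (Ico_subset_Icc_self hx)

theorem core_int_bound {r r1 : ℝ → ℂ} {C : ℝ} {s : ℕ} (hC : 0 ≤ C)
    (hr : ∀ a, 0 < a → HasDerivAt r (r1 a) a)
    (hr0 : Tendsto r (𝓝[>] 0) (𝓝 0))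
    (hb : ∀ a, 0 < a → a ≤ 1 → ‖r1 a‖ ≤ C * a ^ s) (a : ℝ) (ha : 0 < a) (ha1 : a ≤ 1) :
    ‖r a‖ ≤ C * a ^ (s+1) := by
  have h1 : ∀ ε, 0 < ε → ε ≤ a → ‖r a - r ε‖ ≤ C * a ^ (s+1) := by
    intro ε hε hεa
    have := core_mvt (u := r) (u' := r1) (B := fun x => C * (x ^ (s+1) / (s+1)))
      (B' := fun x => C * x ^ s) hεa (fun x hx => hr x (hε.trans_le hx.1)) ?_ ?_
    · refine this.trans ?_
      have h3 : a ^ (s+1) / ((s:ℝ)+1) ≤ a ^ (s+1) :=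
        div_le_self (by positivity) (by linarith [(Nat.cast_nonneg s : (0:ℝ) ≤ s)])
      have h4 : 0 ≤ C * (ε ^ (s+1) / ((s:ℝ)+1)) := by positivity
      nlinarith [mul_le_mul_of_nonneg_left h3 hC]
    · intro x hx
      have := ((hasDerivAt_pow (s+1) x).div_const ((s:ℝ)+1)).const_mul C
      refine this.congr_deriv ?_
      have : (s:ℝ)+1 ≠ 0 := by positivity
      push_cast
      field_simp
    · intro x hx
      exact hb x (hε.trans_le hx.1) (hx.2.trans ha1)
  have h2 : Tendsto (fun ε => ‖r a - r ε‖) (𝓝[>] 0) (𝓝 ‖r a - 0‖) :=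
    (tendsto_const_nhds.sub hr0).norm
  rw [sub_zero] at h2
  refine le_of_tendsto h2 ?_
  filter_upwards [Ioc_mem_nhdsGT ha] with ε hε
  exact h1 ε hε.1 hε.2

theorem core_u_deriv {r1 r2 : ℝ → ℂ} {ν : ℝ} (a : ℝ) (ha : 0 < a)
    (hr : HasDerivAt r1 (r2 a) a) :
    HasDerivAt (fun x => ((x ^ (-ν) : ℝ) : ℂ) * r1 x)
      (((a ^ (-ν-1) : ℝ) : ℂ) * ((a:ℂ) * r2 a - ν * r1 a)) a := by
  have h1 : HasDerivAt (fun x : ℝ => ((x ^ (-ν) : ℝ) : ℂ)) (((-ν) * a ^ (-ν-1) : ℝ) : ℂ) a :=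
    (Real.hasDerivAt_rpow_const (Or.inl ha.ne')).ofReal_comp
  refine (h1.mul hr).congr_deriv ?_
  have h2 : a ^ (-ν) = a ^ (-ν-1) * a := by
    rw [Real.rpow_sub_one ha.ne']; field_simp
  rw [h2]
  push_cast
  ring

theorem core_u_bound {r1 r2 : ℝ → ℂ} {ν C : ℝ} {s : ℕ} (hs : (s:ℝ) ≠ ν)
    (hr : ∀ a, 0 < a → HasDerivAt r1 (r2 a) a)
    (hE : ∀ a : ℝ, 0 < a → a ≤ 1 → ‖(a:ℂ) * r2 a - ν * r1 a‖ ≤ C * a ^ s)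
    (a b : ℝ) (ha : 0 < a) (hab : a ≤ b) (hb : b ≤ 1) :
    ‖((b ^ (-ν) : ℝ) : ℂ) * r1 b - ((a ^ (-ν) : ℝ) : ℂ) * r1 a‖ ≤
      C / (s - ν) * b ^ ((s:ℝ)-ν) - C / (s - ν) * a ^ ((s:ℝ)-ν) := by
  refine core_mvt (u := fun x => ((x ^ (-ν) : ℝ) : ℂ) * r1 x)
    (u' := fun a => ((a ^ (-ν-1) : ℝ) : ℂ) * ((a:ℂ) * r2 a - ν * r1 a))
    (B := fun x => C / (s - ν) * x ^ ((s:ℝ)-ν)) (B' := fun x => C * x ^ ((s:ℝ)-ν-1))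
    hab ?_ ?_ ?_
  · intro x hx
    have hx0 := ha.trans_le hx.1
    exact core_u_deriv x hx0 (hr x hx0)
  · intro x hx
    have hx0 := ha.trans_le hx.1
    have := (Real.hasDerivAt_rpow_const (p := (s:ℝ)-ν) (Or.inl hx0.ne')).const_mul (C/(s-ν))
    refine this.congr_deriv ?_
    have : (s:ℝ) - ν ≠ 0 := sub_ne_zero.2 hs
    field_simp
  · intro x hx
    have hx0 := ha.trans_le hx.1
    rw [norm_mul, Complex.norm_real, Real.norm_of_nonneg (Real.rpow_nonneg hx0.le _)]
    refine (mul_le_mul_of_nonneg_left (hE x hx0 (hx.2.trans hb)) (Real.rpow_nonneg hx0.le _)).trans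
      (le_of_eq ?_)
    rw [show (s:ℝ) - ν - 1 = (-ν-1) + s by ring, Real.rpow_add hx0, Real.rpow_natCast]
    ring

theorem core_odeA {r r1 r2 : ℝ → ℂ} {ν C C1 : ℝ} {s : ℕ} (hs : (s:ℝ) < ν) (hC : 0 ≤ C)
    (hC1 : 0 ≤ C1)
    (hr : ∀ a, 0 < a → HasDerivAt r (r1 a) a)
    (hr1 : ∀ a, 0 < a → HasDerivAt r1 (r2 a) a)
    (hr0 : Tendsto r (𝓝[>] 0) (𝓝 0))
    (hE : ∀ a : ℝ, 0 < a → a ≤ 1 → ‖(a:ℂ) * r2 a - ν * r1 a‖ ≤ C * a ^ s)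
    (h1 : ‖r1 1‖ ≤ C1) (a : ℝ) (ha : 0 < a) (ha1 : a ≤ 1) :
    ‖r a‖ ≤ (C1 + C / (ν - s)) * a ^ (s+1) := by
  have hpos : 0 < ν - s := by linarith
  refine core_int_bound (by positivity) hr hr0 ?_ a ha ha1
  intro x hx hx1
  have hu := core_u_bound hs.ne hr1 hE x 1 hx hx1 le_rfl
  rw [Real.one_rpow, Real.one_rpow, Complex.ofReal_one, one_mul] at hu
  have h3 : ‖((x ^ (-ν) : ℝ) : ℂ) * r1 x‖ ≤ C1 + C / (ν - s) * x ^ ((s:ℝ)-ν) := by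
    have h4 := norm_sub_norm_le (((x ^ (-ν) : ℝ) : ℂ) * r1 x) (r1 1)
    rw [norm_sub_rev] at h4
    have h5 : C / (s - ν) = - (C / (ν - s)) := by rw [← neg_sub ν s, div_neg]
    rw [h5] at hu
    have h6 : 0 ≤ C / (ν - s) := by positivity
    linarith
  rw [norm_mul, Complex.norm_real, Real.norm_of_nonneg (Real.rpow_nonneg hx.le _)] at h3
  have h7 := mul_le_mul_of_nonneg_left h3 (Real.rpow_nonneg hx.le ν)
  rw [← mul_assoc, ← Real.rpow_add hx, add_neg_cancel, Real.rpow_zero, one_mul] at h7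
  refine h7.trans ?_
  have h8 : x ^ ν ≤ x ^ s := by
    rw [← Real.rpow_natCast]
    exact Real.rpow_le_rpow_of_exponent_ge hx hx1 hs.le
  have h9 : x ^ ν * x ^ ((s:ℝ)-ν) = x ^ s := by
    rw [← Real.rpow_add hx, add_sub_cancel, Real.rpow_natCast]
  calc x ^ ν * (C1 + C / (ν - s) * x ^ ((s:ℝ)-ν))
      = C1 * x ^ ν + C / (ν - s) * (x ^ ν * x ^ ((s:ℝ)-ν)) := by ring
    _ ≤ C1 * x ^ s + C / (ν - s) * x ^ s := by rw [h9]; gcongr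
    _ = _ := by ring

theorem core_odeB {r r1 r2 : ℝ → ℂ} {ν C C1 : ℝ} {s : ℕ} (hs : ν < (s:ℝ)) (hC : 0 ≤ C)
    (hr : ∀ a, 0 < a → HasDerivAt r (r1 a) a)
    (hr1 : ∀ a, 0 < a → HasDerivAt r1 (r2 a) a)
    (hr0 : Tendsto r (𝓝[>] 0) (𝓝 0))
    (hE : ∀ a : ℝ, 0 < a → a ≤ 1 → ‖(a:ℂ) * r2 a - ν * r1 a‖ ≤ C * a ^ s)
    (h1 : ∀ a, 0 < a → a ≤ 1 → ‖r1 a‖ ≤ C1 * a ^ s) (a : ℝ) (ha : 0 < a) (ha1 : a ≤ 1) :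
    ‖r a‖ ≤ (C / (s - ν)) * a ^ (s+1) := by
  have hpos : 0 < s - ν := by linarith
  refine core_int_bound (by positivity) hr hr0 ?_ a ha ha1
  intro x hx hx1
  have hu0 : Tendsto (fun y => ((y ^ (-ν) : ℝ) : ℂ) * r1 y) (𝓝[>] 0) (𝓝 0) := by
    have h0 : Tendsto (fun y : ℝ => C1 * y ^ ((s:ℝ)-ν)) (𝓝[>] 0) (𝓝 0) := by
      have : Tendsto (fun y : ℝ => C1 * y ^ ((s:ℝ)-ν)) (𝓝 0) (𝓝 (C1 * 0 ^ ((s:ℝ)-ν))) :=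
        ((Real.continuousAt_rpow_const 0 _ (Or.inr hpos.le)).tendsto).const_mul C1
      rw [Real.zero_rpow hpos.ne', mul_zero] at this
      exact this.mono_left nhdsWithin_le_nhds
    refine squeeze_zero_norm' ?_ h0
    filter_upwards [Ioc_mem_nhdsGT (zero_lt_one' ℝ)] with y hy
    rw [norm_mul, Complex.norm_real, Real.norm_of_nonneg (Real.rpow_nonneg hy.1.le _)]
    refine (mul_le_mul_of_nonneg_left (h1 y hy.1 hy.2) (Real.rpow_nonneg hy.1.le _)).trans
      (le_of_eq ?_)
    rw [show (s:ℝ) - ν = (-ν) + s by ring, Real.rpow_add hy.1, Real.rpow_natCast]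
    ring
  have h3 : ‖((x ^ (-ν) : ℝ) : ℂ) * r1 x‖ ≤ C / (s - ν) * x ^ ((s:ℝ)-ν) := by
    have h2 : Tendsto (fun ε => ‖((x ^ (-ν) : ℝ) : ℂ) * r1 x - ((ε ^ (-ν) : ℝ) : ℂ) * r1 ε‖)
      (𝓝[>] 0) (𝓝 ‖((x ^ (-ν) : ℝ) : ℂ) * r1 x - 0‖) := (tendsto_const_nhds.sub hu0).norm
    rw [sub_zero] at h2
    refine le_of_tendsto h2 ?_
    filter_upwards [Ioc_mem_nhdsGT hx] with ε hε
    have hu := core_u_bound hs.ne' hr1 hE ε x hε.1 hε.2 hx1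
    have : 0 ≤ C / (s - ν) * ε ^ ((s:ℝ)-ν) := by
      have := Real.rpow_nonneg hε.1.le ((s:ℝ)-ν)
      positivity
    linarith
  rw [norm_mul, Complex.norm_real, Real.norm_of_nonneg (Real.rpow_nonneg hx.le _)] at h3
  have h7 := mul_le_mul_of_nonneg_left h3 (Real.rpow_nonneg hx.le ν)
  rw [← mul_assoc, ← Real.rpow_add hx, add_neg_cancel, Real.rpow_zero, one_mul] at h7
  refine h7.trans (le_of_eq ?_)
  have h9 : x ^ ν * x ^ ((s:ℝ)-ν) = x ^ s := by
    rw [← Real.rpow_add hx, add_sub_cancel, Real.rpow_natCast]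
  rw [← h9]; ring

section
variable {V : Type*} [AddCommGroup V] [Module ℂ V] [TopologicalSpace V]
variable {L T : V →ₗ[ℂ] V} {g : ℝ → V →ₗ[ℂ] ℂ} {f : V →ₗ[ℂ] ℂ} {gd : ℕ → ℝ → V → ℂ}
    {D : Set V} {ν α : ℝ} {m : ℕ}

/-- boundary derivative functionals (current, previous) -/
def coreFF (L T : V →ₗ[ℂ] V) (f : V →ₗ[ℂ] ℂ) (ν α : ℝ) : ℕ → (V →ₗ[ℂ] ℂ) × (V →ₗ[ℂ] ℂ)
  | 0 => (f, 0)
  | p+1 => (((p:ℂ) - ν)⁻¹ • ((α:ℂ) • (coreFF L T f ν α p).1 ∘ₗ L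
      - (p:ℂ) • (coreFF L T f ν α p).2 ∘ₗ T), (coreFF L T f ν α p).1)

def coreF (L T : V →ₗ[ℂ] V) (f : V →ₗ[ℂ] ℂ) (ν α : ℝ) (p : ℕ) : V →ₗ[ℂ] ℂ :=
  (coreFF L T f ν α p).1

theorem coreF_zero : coreF L T f ν α 0 = f := rfl

theorem coreF_succ (p : ℕ) (φ : V) : coreF L T f ν α (p+1) φ =
    ((p:ℂ) - ν)⁻¹ * (α * coreF L T f ν α p (L φ) - p * coreF L T f ν α (p-1) (T φ)) := by
  cases p with
  | zero => simp [coreF, coreFF]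
  | succ p => simp [coreF, coreFF]

theorem CoreHyp.Fbd (h : CoreHyp L T g f gd D ν α m) (p : ℕ) :
    SBd (fun φ => ‖coreF L T f ν α p φ‖) := by
  induction p using Nat.strong_induction_on with
  | _ p ih =>
    cases p with
    | zero => exact h.fbd
    | succ p =>
      have h1 := ((ih p (by omega)).comp L h.cL).smul (‖((p:ℂ) - ν)⁻¹‖ * ‖(α:ℂ)‖) (by positivity)
      have h2 := ((ih (p-1) (by omega)).comp T h.cT).smul (‖((p:ℂ) - ν)⁻¹‖ * ‖(p:ℂ)‖)
        (by positivity)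
      refine (h1.add h2).mono fun φ => ?_
      rw [coreF_succ, norm_mul, mul_assoc, mul_assoc, ← mul_add]
      refine mul_le_mul_of_nonneg_left ((norm_sub_le _ _).trans ?_) (norm_nonneg _)
      rw [norm_mul, norm_mul]

theorem CoreHyp.diffode (h : CoreHyp L T g f gd D ν α m) (p : ℕ) (φ : V) (hφ : φ ∈ D) (a : ℝ)
    (ha : 0 < a) :
    (a:ℂ) * gd (p+2) a φ + (p - ν) * gd (p+1) a φ =
      α * gd p a (L φ) - a * gd p a (T φ) - p * gd (p-1) a (T φ) := by
  induction p generalizing a with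
  | zero =>
    have := h.ode φ hφ a ha
    simp only [h.gd0]
    push_cast
    linear_combination this
  | succ p ih =>
    have hx1 : HasDerivAt (fun x : ℝ => (x:ℂ)) 1 a := Complex.ofRealCLM.hasDerivAt
    have hL := h.DL φ hφ
    have hT := h.DT φ hφ
    have hl := (hx1.mul (h.gdd φ hφ (p+2) a ha)).add
      ((h.gdd φ hφ (p+1) a ha).const_mul ((p:ℂ) - ν))
    have hr := (((h.gdd _ hL p a ha).const_mul (α:ℂ)).sub (hx1.mul (h.gdd _ hT p a ha))).sub
      ((h.gdd _ hT (p-1) a ha).const_mul (p:ℂ))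
    have hr' := hr.congr_of_eventuallyEq (f₁ := (fun x : ℝ => (x:ℂ) * gd (p+2) x φ + (p - ν) * gd (p+1) x φ)) (by
      filter_upwards [Ioi_mem_nhds ha] with x hx
      exact ih x hx)
    have := hl.unique hr'
    have hpp : (p:ℂ) * gd (p - 1 + 1) a (T φ) = p * gd p a (T φ) := by
      cases p with
      | zero => simp
      | succ p => simp
    rw [hpp] at this
    push_cast
    linear_combination this

theorem CoreHyp.mul_gd_lim (h : CoreHyp L T g f gd D ν α m) (p : ℕ) (hp : p ≤ m + 2) (φ : V)
    (hφ : φ ∈ D) : Tendsto (fun a : ℝ => (a:ℂ) * gd p a φ) (𝓝[>] 0) (𝓝 0) := by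
  obtain ⟨C, hC⟩ := h.reg φ hφ p hp
  have h0 : Tendsto (fun a : ℝ => a * C) (𝓝[>] 0) (𝓝 0) := by
    have : Tendsto (fun a : ℝ => a * C) (𝓝 0) (𝓝 (0 * C)) :=
      (continuous_id.mul continuous_const).tendsto 0
    rw [zero_mul] at this
    exact this.mono_left nhdsWithin_le_nhds
  refine squeeze_zero_norm' ?_ h0
  filter_upwards [Ioc_mem_nhdsGT (zero_lt_one' ℝ)] with a ha
  rw [norm_mul, Complex.norm_real, Real.norm_of_nonneg ha.1.le]
  exact mul_le_mul_of_nonneg_left (hC a ha.1 ha.2) ha.1.le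

theorem CoreHyp.limstep (h : CoreHyp L T g f gd D ν α m) (p : ℕ) (hp : p ≤ m)
    (ih : ∀ q ≤ p, ∀ φ ∈ D, Tendsto (fun a => gd q a φ) (𝓝[>] 0) (𝓝 (coreF L T f ν α q φ)))
    (φ : V) (hφ : φ ∈ D) :
    Tendsto (fun a => ((p:ℂ) - ν) * gd (p+1) a φ) (𝓝[>] 0)
      (𝓝 (α * coreF L T f ν α p (L φ) - p * coreF L T f ν α (p-1) (T φ))) := by
  have h1 := (ih p le_rfl _ (h.DL φ hφ)).const_mul (α:ℂ)
  have h2 := (ih (p-1) (by omega) _ (h.DT φ hφ)).const_mul (p:ℂ)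
  have h3 := h.mul_gd_lim (p+2) (by omega) φ hφ
  have h4 := h.mul_gd_lim p (by omega) _ (h.DT φ hφ)
  have := ((h1.sub h2).sub h4).sub h3
  rw [sub_zero, sub_zero] at this
  refine this.congr' ?_
  filter_upwards [self_mem_nhdsWithin] with a ha
  have := h.diffode p φ hφ a ha
  linear_combination -this

theorem CoreHyp.gdlim (h : CoreHyp L T g f gd D ν α m) (p : ℕ) (hp : p ≤ m + 1)
    (hne : ∀ q < p, (q:ℝ) ≠ ν) (φ : V) (hφ : φ ∈ D) :
    Tendsto (fun a => gd p a φ) (𝓝[>] 0) (𝓝 (coreF L T f ν α p φ)) := by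
  induction p using Nat.strong_induction_on generalizing φ with
  | _ p ih =>
    cases p with
    | zero =>
      simp only [h.gd0]
      exact h.lim φ
    | succ p =>
      have := h.limstep p (by omega) (fun q hq φ hφ => ih q (by omega) (by omega)
        (fun r hr => hne r (by omega)) φ hφ) φ hφ
      have hne' : (p:ℂ) - ν ≠ 0 := by
        have := sub_ne_zero.2 (hne p (by omega))
        exact_mod_cast this
      have := this.const_mul ((p:ℂ) - ν)⁻¹
      rw [coreF_succ]
      refine this.congr fun a => ?_
      field_simp

end

end

section

section
variable {V : Type*} [AddCommGroup V] [Module ℂ V] [TopologicalSpace V]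

theorem SBd.cont_lin [IsTopologicalAddGroup V] {ℓ : V →ₗ[ℂ] ℂ} (h : SBd (fun φ => ‖ℓ φ‖)) :
    Continuous ℓ := by
  refine continuous_of_continuousAt_zero ℓ ?_
  obtain ⟨q, hq, hb⟩ := h
  have h0 : Tendsto q (𝓝 0) (𝓝 0) := by
    have := hq.tendsto 0
    rwa [map_zero] at this
  rw [ContinuousAt, map_zero]
  exact squeeze_zero_norm hb h0

variable {L T : V →ₗ[ℂ] V} {g : ℝ → V →ₗ[ℂ] ℂ} {f : V →ₗ[ℂ] ℂ} {gd : ℕ → ℝ → V → ℂ}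
    {D : Set V} {ν α : ℝ} {m : ℕ}

def coreP (L T : V →ₗ[ℂ] V) (f : V →ₗ[ℂ] ℂ) (ν α : ℝ) (s i : ℕ) (a : ℝ) (φ : V) : ℂ :=
  ∑ p ∈ Finset.range s, coreF L T f ν α p φ * (p.descFactorial i * (a:ℂ) ^ (p - i) / p.factorial)

theorem coreP_deriv (s i : ℕ) (a : ℝ) (φ : V) :
    HasDerivAt (fun x => coreP L T f ν α s i x φ) (coreP L T f ν α s (i+1) a φ) a := by
  unfold coreP
  refine HasDerivAt.fun_sum fun p _ => ?_
  refine HasDerivAt.const_mul _ ?_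
  refine HasDerivAt.div_const ?_ _
  have hx1 : HasDerivAt (fun x : ℝ => (x:ℂ)) 1 a := Complex.ofRealCLM.hasDerivAt
  have := (hx1.pow (p - i)).const_mul ((p.descFactorial i : ℕ):ℂ)
  refine this.congr_deriv ?_
  rw [Nat.descFactorial_succ, Nat.sub_sub]
  push_cast
  ring

theorem coreP_lim (s i : ℕ) (hi : i < s) (φ : V) :
    Tendsto (fun x => coreP L T f ν α s i x φ) (𝓝[>] 0) (𝓝 (coreF L T f ν α i φ)) := by
  have h1 : Tendsto (fun x => coreP L T f ν α s i x φ) (𝓝 0) (𝓝 (coreP L T f ν α s i 0 φ)) :=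
    (coreP_deriv s i 0 φ).continuousAt
  have h2 : coreP L T f ν α s i 0 φ = coreF L T f ν α i φ := by
    unfold coreP
    rw [Finset.sum_eq_single i]
    · have : (i.factorial : ℂ) ≠ 0 := by exact_mod_cast i.factorial_ne_zero
      rw [Nat.descFactorial_self, Nat.sub_self, pow_zero, mul_one, div_self this, mul_one]
    · intro p _ hp
      rcases lt_or_gt_of_ne hp with h | h
      · rw [Nat.descFactorial_of_lt h]; simp
      · have : p - i ≠ 0 := by omega
        simp [this]
    · intro h
      exact absurd (Finset.mem_range.2 hi) h
  rw [h2] at h1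
  exact h1.mono_left nhdsWithin_le_nhds

theorem coreP_ode (hne : ∀ q : ℕ, (q:ℝ) ≠ ν) (s : ℕ) (a : ℝ) (φ : V) :
    (a:ℂ) * coreP L T f ν α (s+1) 2 a φ - ν * coreP L T f ν α (s+1) 1 a φ =
      α * coreP L T f ν α s 0 a (L φ) - a * coreP L T f ν α s 0 a (T φ)
        + s * coreF L T f ν α (s-1) (T φ) * (a:ℂ) ^ s / s.factorial := by
  induction s with
  | zero => simp [coreP]
  | succ s ih =>
    have e1 : ∀ i φ, coreP L T f ν α (s+1+1) i a φ = coreP L T f ν α (s+1) i a φ +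
      coreF L T f ν α (s+1) φ * ((s+1).descFactorial i * (a:ℂ) ^ (s+1 - i) / (s+1).factorial) :=
      fun i φ => Finset.sum_range_succ _ _
    have e2 : ∀ φ, coreP L T f ν α (s+1) 0 a φ = coreP L T f ν α s 0 a φ +
      coreF L T f ν α s φ * (s.descFactorial 0 * (a:ℂ) ^ (s - 0) / s.factorial) :=
      fun φ => Finset.sum_range_succ _ _
    rw [e1, e1, e2, e2, coreF_succ]
    have hne' : (s:ℂ) - ν ≠ 0 := by
      have := sub_ne_zero.2 (hne s)
      exact_mod_cast this
    have hf : (s.factorial : ℂ) ≠ 0 := by exact_mod_cast s.factorial_ne_zero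
    have hs1 : (s:ℂ) + 1 ≠ 0 := by exact_mod_cast s.succ_ne_zero
    have e3 : (a:ℂ) * (((s+1).descFactorial 2 : ℕ) * (a:ℂ) ^ (s+1-2) / (s+1).factorial)
        = s * (a:ℂ) ^ s / s.factorial := by
      have : ((s+1).descFactorial 2 : ℕ) = (s+1) * s := by
        simp [Nat.descFactorial_succ, mul_comm]
      rw [this, Nat.factorial_succ]
      cases s with
      | zero => simp
      | succ s =>
        have : s + 1 + 1 - 2 = s := by omega
        rw [this]
        push_cast at hs1 ⊢
        field_simp
        ring
    have e4 : (((s+1).descFactorial 1 : ℕ):ℂ) * (a:ℂ) ^ (s+1-1) / (s+1).factorial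
        = (a:ℂ) ^ s / s.factorial := by
      rw [Nat.factorial_succ, Nat.descFactorial_one, Nat.add_sub_cancel]
      push_cast
      field_simp
    rw [e4]
    have e5 : ((s+1:ℕ):ℂ) * coreF L T f ν α (s+1-1) (T φ) * (a:ℂ)^(s+1) / (s+1).factorial =
        coreF L T f ν α s (T φ) * (a:ℂ)^(s+1) / s.factorial := by
      rw [Nat.factorial_succ, Nat.add_sub_cancel]
      push_cast
      field_simp
    rw [e5, Nat.descFactorial_zero, Nat.sub_zero]
    have : ((s:ℂ) - ν)⁻¹ * ((s:ℂ) - ν) = 1 := inv_mul_cancel₀ hne'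
    rw [pow_succ]
    generalize (((s+1).descFactorial 2 : ℕ):ℂ) * (a:ℂ) ^ (s+1-2) / (s+1).factorial = Q at e3 ⊢
    push_cast
    linear_combination ih + ((s:ℂ) - ν)⁻¹ * (α * coreF L T f ν α s (L φ) - s * coreF L T f ν α (s-1) (T φ)) * e3
      + (α * coreF L T f ν α s (L φ) - s * coreF L T f ν α (s-1) (T φ)) * ((a:ℂ) ^ s / s.factorial) * this

def coreR (L T : V →ₗ[ℂ] V) (f : V →ₗ[ℂ] ℂ) (gd : ℕ → ℝ → V → ℂ)
    (ν α : ℝ) (s i : ℕ) (a : ℝ) (φ : V) : ℂ :=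
  gd i a φ - coreP L T f ν α s i a φ

theorem CoreHyp.R_deriv (h : CoreHyp L T g f gd D ν α m) (s i : ℕ) (a : ℝ) (ha : 0 < a) (φ : V)
    (hφ : φ ∈ D) : HasDerivAt (fun x => coreR L T f gd ν α s i x φ)
      (coreR L T f gd ν α s (i+1) a φ) a :=
  (h.gdd φ hφ i a ha).sub (coreP_deriv s i a φ)

theorem CoreHyp.R_ode (h : CoreHyp L T g f gd D ν α m) (hne : ∀ q : ℕ, (q:ℝ) ≠ ν)
    (s : ℕ) (a : ℝ) (ha : 0 < a) (φ : V)
    (hφ : φ ∈ D) :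
    (a:ℂ) * coreR L T f gd ν α (s+1) 2 a φ - ν * coreR L T f gd ν α (s+1) 1 a φ =
      α * coreR L T f gd ν α s 0 a (L φ) - a * coreR L T f gd ν α s 0 a (T φ)
        - s * coreF L T f ν α (s-1) (T φ) * (a:ℂ) ^ s / s.factorial := by
  have h1 := h.ode φ hφ a ha
  have h2 := coreP_ode (L := L) (T := T) (f := f) (α := α) hne s a φ
  unfold coreR
  rw [h.gd0, h.gd0]
  linear_combination h1 - h2

theorem CoreHyp.E_bd (h : CoreHyp L T g f gd D ν α m) (hne : ∀ q : ℕ, (q:ℝ) ≠ ν) (s : ℕ)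
    {q : Seminorm ℂ V} (hq : Continuous q) (hb : ∀ φ ∈ D, ∀ a, 0 < a → a ≤ 1 →
      ‖coreR L T f gd ν α s 0 a φ‖ ≤ q φ * a ^ s) :
    ∃ q' : Seminorm ℂ V, Continuous q' ∧ ∀ φ ∈ D, ∀ a : ℝ, 0 < a → a ≤ 1 →
      ‖(a:ℂ) * coreR L T f gd ν α (s+1) 2 a φ - ν * coreR L T f gd ν α (s+1) 1 a φ‖
        ≤ q' φ * a ^ s := by
  obtain ⟨q', hq', hb'⟩ := ((((SBd.self hq).comp L h.cL).smul α h.hα.le).add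
    ((SBd.self hq).comp T h.cT)).add (((h.Fbd (s-1)).comp T h.cT).smul (s / s.factorial)
      (by positivity))
  refine ⟨q', hq', fun φ hφ a ha ha1 => ?_⟩
  rw [h.R_ode hne s a ha φ hφ]
  refine le_trans ?_ (mul_le_mul_of_nonneg_right (hb' φ) (by positivity))
  refine (norm_sub_le _ _).trans ?_
  rw [add_mul]
  refine add_le_add ((norm_sub_le _ _).trans ?_) (le_of_eq ?_)
  · rw [add_mul]
    refine add_le_add ?_ ?_
    · rw [norm_mul, Complex.norm_real, Real.norm_of_nonneg h.hα.le, mul_assoc]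
      exact mul_le_mul_of_nonneg_left (hb _ (h.DL φ hφ) a ha ha1) h.hα.le
    · rw [norm_mul, Complex.norm_real, Real.norm_of_nonneg ha.le]
      have h3 := hb _ (h.DT φ hφ) a ha ha1
      have := norm_nonneg (coreR L T f gd ν α s 0 a (T φ))
      nlinarith
  · simp only [norm_div, norm_mul, norm_pow, Complex.norm_real, Complex.norm_natCast,
      Real.norm_of_nonneg ha.le]
    ring

theorem CoreHyp.R_lim0 (h : CoreHyp L T g f gd D ν α m) (s : ℕ) (φ : V) :
    Tendsto (fun x => coreR L T f gd ν α (s+1) 0 x φ) (𝓝[>] 0) (𝓝 0) := by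
  have h1 := h.lim φ
  have h2 := coreP_lim (L := L) (T := T) (f := f) (α := α) (ν := ν) (s+1) 0 (by omega) φ
  have := h1.sub h2
  rw [coreF_zero, sub_self] at this
  refine this.congr fun x => ?_
  unfold coreR
  rw [h.gd0]

theorem CoreHyp.P_bd (h : CoreHyp L T g f gd D ν α m) (s i : ℕ) (a : ℝ) :
    SBd (fun φ => ‖coreP L T f ν α s i a φ‖) := by
  unfold coreP
  induction s with
  | zero => simpa using SBd.zero
  | succ s ih =>
    refine (ih.add ((h.Fbd s).smul ‖(s.descFactorial i * (a:ℂ) ^ (s - i) / s.factorial)‖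
      (norm_nonneg _))).mono fun φ => ?_
    rw [Finset.sum_range_succ]
    refine (norm_add_le _ _).trans (le_of_eq ?_)
    rw [norm_mul (coreF L T f ν α s φ), mul_comm ‖coreF L T f ν α s φ‖]

theorem CoreHyp.boot (h : CoreHyp L T g f gd D ν α m) (hne : ∀ q : ℕ, (q:ℝ) ≠ ν) (s : ℕ)
    (hs : s ≤ m + 1) :
    ∃ q : Seminorm ℂ V, Continuous q ∧ ∀ φ ∈ D, ∀ a, 0 < a → a ≤ 1 →
      ‖coreR L T f gd ν α s 0 a φ‖ ≤ q φ * a ^ s := by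
  induction s with
  | zero =>
    obtain ⟨q, hq, hb⟩ := h.bdd
    refine ⟨q, hq, fun φ _ a ha _ => ?_⟩
    simpa [coreR, coreP, h.gd0] using hb a ha φ
  | succ s ih =>
    obtain ⟨q, hq, hb⟩ := ih (by omega)
    obtain ⟨q1, hq1, hb1⟩ := h.E_bd hne s hq hb
    obtain ⟨q2, hq2, hb2⟩ := h.G1bd 1 zero_le_one
    have hsν : (s:ℝ) < ν := by
      have h1 : (m:ℝ) ≤ ν := by rw [h.hm]; exact Nat.floor_le h.hν.le
      have h2 : (s:ℝ) ≤ m := by exact_mod_cast (by omega : s ≤ m)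
      exact lt_of_le_of_ne (h2.trans h1) (hne s)
    obtain ⟨q3, hq3, hb3⟩ := h.P_bd (s+1) 1 1
    obtain ⟨q', hq', hb'⟩ := ((SBd.self hq2).add (SBd.self hq3)).add
      ((SBd.self hq1).smul (ν - s)⁻¹ (inv_nonneg.2 (by linarith)))
    refine ⟨q', hq', fun φ hφ a ha ha1 => ?_⟩
    have := core_odeA (r := fun x => coreR L T f gd ν α (s+1) 0 x φ)
      (r1 := fun x => coreR L T f gd ν α (s+1) 1 x φ)
      (r2 := fun x => coreR L T f gd ν α (s+1) 2 x φ) hsν (apply_nonneg q1 φ)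
      (add_nonneg (apply_nonneg q2 φ) (apply_nonneg q3 φ))
      (fun a ha => h.R_deriv (s+1) 0 a ha φ hφ) (fun a ha => h.R_deriv (s+1) 1 a ha φ hφ)
      (h.R_lim0 s φ) (hb1 φ hφ) ?_ a ha ha1
    · refine this.trans (mul_le_mul_of_nonneg_right (le_trans (le_of_eq ?_) (hb' φ)) (by positivity))
      rw [div_eq_inv_mul]
    · refine (norm_sub_le _ _).trans (add_le_add ?_ (hb3 φ))
      have h4 := hb2 1 one_pos le_rfl φ
      rw [one_mul] at h4
      refine le_trans (le_of_eq ?_) h4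
      unfold coreG1
      rw [← h.first φ hφ 1 one_pos]
      simp

theorem CoreHyp.R_reg (h : CoreHyp L T g f gd D ν α m) (hne : ∀ q : ℕ, (q:ℝ) ≠ ν) (φ : V)
    (hφ : φ ∈ D) (k : ℕ) (hk : k ≤ m + 2) :
    ∃ C, 0 ≤ C ∧ ∀ a, 0 < a → a ≤ 1 → ‖coreR L T f gd ν α (m+2) (m+2-k) a φ‖ ≤ C * a ^ k := by
  induction k with
  | zero =>
    obtain ⟨C, hC⟩ := h.reg φ hφ (m+2) le_rfl
    refine ⟨C, (norm_nonneg _).trans (hC 1 one_pos le_rfl), fun a ha ha1 => ?_⟩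
    have : coreP L T f ν α (m+2) (m+2) a φ = 0 := by
      unfold coreP
      refine Finset.sum_eq_zero fun p hp => ?_
      rw [Nat.descFactorial_of_lt (Finset.mem_range.1 hp)]
      simp
    rw [pow_zero, mul_one, Nat.sub_zero, coreR, this, sub_zero]
    exact hC a ha ha1
  | succ k ih =>
    obtain ⟨C, hC0, hC⟩ := ih (by omega)
    refine ⟨C, hC0, ?_⟩
    have e : m + 2 - k = (m + 2 - (k+1)) + 1 := by omega
    rw [e] at hC
    refine core_int_bound hC0 (fun a ha => h.R_deriv (m+2) _ a ha φ hφ) ?_ hC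
    have := (h.gdlim (m+2-(k+1)) (by omega) (fun q _ => hne q) φ hφ).sub
      (coreP_lim (L := L) (T := T) (f := f) (α := α) (ν := ν) (m+2) (m+2-(k+1)) (by omega) φ)
    rwa [sub_self] at this

theorem CoreHyp.boot_last (h : CoreHyp L T g f gd D ν α m) (hne : ∀ q : ℕ, (q:ℝ) ≠ ν) :
    ∃ q : Seminorm ℂ V, Continuous q ∧ ∀ φ ∈ D, ∀ a, 0 < a → a ≤ 1 →
      ‖coreR L T f gd ν α (m+2) 0 a φ‖ ≤ q φ * a ^ (m+2) := by
  obtain ⟨q, hq, hb⟩ := h.boot hne (m+1) le_rfl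
  obtain ⟨q1, hq1, hb1⟩ := h.E_bd hne (m+1) hq hb
  have hsν : ν < ((m+1:ℕ):ℝ) := by
    rw [h.hm]; push_cast; exact Nat.lt_floor_add_one ν
  obtain ⟨q', hq', hb'⟩ := ((SBd.self hq1).smul (((m+1:ℕ):ℝ) - ν)⁻¹ (inv_nonneg.2 (by linarith)))
  refine ⟨q', hq', fun φ hφ a ha ha1 => ?_⟩
  obtain ⟨C, hC0, hC⟩ := h.R_reg hne φ hφ (m+1) (by omega)
  have e : m + 2 - (m+1) = 1 := by omega
  rw [e] at hC
  have := core_odeB (r := fun x => coreR L T f gd ν α (m+2) 0 x φ)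
      (r1 := fun x => coreR L T f gd ν α (m+2) 1 x φ)
      (r2 := fun x => coreR L T f gd ν α (m+2) 2 x φ) hsν (apply_nonneg q1 φ)
      (fun a ha => h.R_deriv (m+2) 0 a ha φ hφ) (fun a ha => h.R_deriv (m+2) 1 a ha φ hφ)
      (h.R_lim0 (m+1) φ) (hb1 φ hφ) hC a ha ha1
  refine this.trans (mul_le_mul_of_nonneg_right (le_trans (le_of_eq ?_) (hb' φ)) (by positivity))
  rw [div_eq_inv_mul]

theorem CoreHyp.remainder [IsTopologicalAddGroup V] (h : CoreHyp L T g f gd D ν α m)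
    (hne : ∀ q : ℕ, (q:ℝ) ≠ ν) :
    ∃ q : Seminorm ℂ V, Continuous q ∧ ∀ φ, ∀ a : ℝ, 0 < a →
      ‖g a φ - ∑ p ∈ Finset.range (m+2), coreF L T f ν α p φ * ((a:ℂ)^p / p.factorial)‖
        ≤ q φ * a ^ (m+2) := by
  obtain ⟨q, hq, hb⟩ := h.boot_last hne
  obtain ⟨q0, hq0, hb0⟩ := h.bdd
  have hs : SBd (fun φ : V => ∑ p ∈ Finset.range (m+2), ‖coreF L T f ν α p φ‖) := by
    generalize m+2 = s
    induction s with
    | zero => simpa using SBd.zero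
    | succ s ih =>
      refine (ih.add (h.Fbd s)).mono fun φ => ?_
      rw [Finset.sum_range_succ]
  obtain ⟨q', hq', hb'⟩ := ((SBd.self hq).add (SBd.self hq0)).add hs
  refine ⟨q', hq', fun φ a ha => ?_⟩
  refine le_trans ?_ (mul_le_mul_of_nonneg_right (hb' φ) (by positivity))
  have hs0 : 0 ≤ ∑ p ∈ Finset.range (m+2), ‖coreF L T f ν α p φ‖ :=
    Finset.sum_nonneg fun _ _ => norm_nonneg _
  rcases le_total a 1 with ha1 | ha1
  · have key : ‖g a φ - ∑ p ∈ Finset.range (m+2), coreF L T f ν α p φ * ((a:ℂ)^p / p.factorial)‖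
        ≤ q φ * a ^ (m+2) := by
      have hgc : Continuous (g a) := SBd.cont_lin ⟨q0, hq0, hb0 a ha⟩
      have hFc : ∀ p, Continuous (coreF L T f ν α p) := fun p => (h.Fbd p).cont_lin
      have hcl : IsClosed {φ : V | ‖g a φ - ∑ p ∈ Finset.range (m+2),
          coreF L T f ν α p φ * ((a:ℂ)^p / p.factorial)‖ ≤ q φ * a ^ (m+2)} := by
        refine isClosed_le ?_ (hq.mul continuous_const)
        refine (hgc.sub (continuous_finsetSum _ fun p _ => (hFc p).mul continuous_const)).norm
      refine hcl.closure_subset_iff.2 ?_ (h.dense φ)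
      intro φ hφ
      have := hb φ hφ a ha ha1
      simpa [coreR, coreP, h.gd0] using this
    refine key.trans (mul_le_mul_of_nonneg_right ?_ (by positivity))
    have := apply_nonneg q0 φ
    linarith
  · refine (norm_sub_le _ _).trans ?_
    have h1 : ‖g a φ‖ ≤ q0 φ * a ^ (m+2) := by
      refine (hb0 a ha φ).trans ?_
      exact le_mul_of_one_le_right (apply_nonneg q0 φ) (one_le_pow₀ ha1)
    have h2 : ‖∑ p ∈ Finset.range (m+2), coreF L T f ν α p φ * ((a:ℂ)^p / p.factorial)‖ ≤
        (∑ p ∈ Finset.range (m+2), ‖coreF L T f ν α p φ‖) * a ^ (m+2) := by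
      rw [Finset.sum_mul]
      refine norm_sum_le_of_le _ fun p hp => ?_
      rw [norm_mul]
      refine mul_le_mul_of_nonneg_left ?_ (norm_nonneg _)
      rw [norm_div, norm_pow, Complex.norm_real, Real.norm_of_nonneg ha.le, Complex.norm_natCast]
      refine (div_le_self (by positivity) (by exact_mod_cast p.factorial_pos)).trans ?_
      exact pow_le_pow_right₀ ha1 (Finset.mem_range.1 hp).le
    have h3 : 0 ≤ q φ * a ^ (m+2) := mul_nonneg (apply_nonneg q φ) (by positivity)
    rw [add_mul, add_mul]
    linarith

theorem CoreHyp.integer_case [IsTopologicalAddGroup V] (h : CoreHyp L T g f gd D ν α m)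
    (hm : (m:ℝ) = ν) (φ : V) :
    α * coreF L T f ν α m (L φ) - m * coreF L T f ν α (m-1) (T φ) = 0 := by
  have hFc : ∀ p, Continuous (coreF L T f ν α p) := fun p => (h.Fbd p).cont_lin
  have hcl : IsClosed {φ : V | α * coreF L T f ν α m (L φ) - m * coreF L T f ν α (m-1) (T φ) = 0} := by
    refine isClosed_eq ?_ continuous_const
    exact (continuous_const.mul ((hFc m).comp h.cL)).sub
      (continuous_const.mul ((hFc _).comp h.cT))
  refine hcl.closure_subset_iff.2 ?_ (h.dense φ)
  intro φ hφ
  have := h.limstep m le_rfl (fun q hq φ hφ => h.gdlim q (by omega) (fun r hr => by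
    rw [← hm]; exact_mod_cast (by omega : r ≠ m)) φ hφ) φ hφ
  have h0 : (m:ℂ) - ν = 0 := by rw [← hm]; simp
  simp only [h0, zero_mul] at this
  exact tendsto_nhds_unique this tendsto_const_nhds

end

end

section

/-- coefficient recursion (current, previous) -/
def coreDD (β ν : ℝ) : ℕ → ℝ × ℝ
  | 0 => (1, 0)
  | p+1 => (((p:ℝ) - ν)⁻¹ * (β * (coreDD β ν p).1 + p * (coreDD β ν p).2), (coreDD β ν p).1)

def coreD (β ν : ℝ) (p : ℕ) : ℝ := (coreDD β ν p).1

theorem coreD_zero (β ν : ℝ) : coreD β ν 0 = 1 := rfl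

theorem coreD_succ (β ν : ℝ) (p : ℕ) :
    coreD β ν (p+1) = ((p:ℝ) - ν)⁻¹ * (β * coreD β ν p + p * coreD β ν (p-1)) := by
  cases p with
  | zero => simp [coreD, coreDD]
  | succ p => simp [coreD, coreDD]

theorem coreD_sign (β ν : ℝ) (hβ : ν < β) (p : ℕ) (hp : (p:ℝ) ≤ ν) :
    0 < (-1) ^ p * coreD β ν p ∧ (-1) ^ (p+1) * coreD β ν (p-1) ≤ (-1) ^ p * coreD β ν p := by
  induction p with
  | zero => simp [coreD_zero]
  | succ p ih =>
    have hp' : (p:ℝ) + 1 ≤ ν := by exact_mod_cast hp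
    obtain ⟨h1, h2⟩ := ih (by linarith)
    have hpos : 0 < ν - p := by linarith
    have key : (ν - p) * ((-1) ^ (p+1) * coreD β ν (p+1)) =
        β * ((-1) ^ p * coreD β ν p) - p * ((-1) ^ (p+1) * coreD β ν (p-1)) := by
      rw [coreD_succ]
      have : (p:ℝ) - ν ≠ 0 := by linarith
      field_simp
      ring
    have h3 : (ν - p) * ((-1) ^ p * coreD β ν p) ≤ (ν - p) * ((-1) ^ (p+1) * coreD β ν (p+1)) := by
      rw [key]
      have hp0 : (0:ℝ) ≤ p := Nat.cast_nonneg p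
      nlinarith [mul_le_mul_of_nonneg_left h2 hp0, mul_pos (sub_pos.2 hβ) h1]
    have h4 := le_of_mul_le_mul_left h3 hpos
    refine ⟨h1.trans_le h4, ?_⟩
    rw [Nat.add_sub_cancel]
    calc (-1:ℝ) ^ (p+1+1) * coreD β ν p = (-1) ^ p * coreD β ν p := by ring
      _ ≤ _ := h4

theorem coreD_int_ne (β : ℝ) (m : ℕ) (hβ : (m:ℝ) < β) :
    β * coreD β m m + m * coreD β m (m-1) ≠ 0 := by
  obtain ⟨h1, h2⟩ := coreD_sign β m hβ m le_rfl
  have hp0 : (0:ℝ) ≤ m := Nat.cast_nonneg m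
  have : 0 < (-1) ^ m * (β * coreD β m m + m * coreD β m (m-1)) := by
    have e : (-1) ^ m * (β * coreD β m m + m * coreD β m (m-1)) =
      β * ((-1) ^ m * coreD β m m) - m * ((-1) ^ (m+1) * coreD β m (m-1)) := by ring
    rw [e]
    nlinarith [mul_le_mul_of_nonneg_left h2 hp0, mul_pos (sub_pos.2 hβ) h1]
  intro h0
  rw [h0, mul_zero] at this
  exact lt_irrefl _ this

def coreEta (A ν : ℝ) : ℕ → ℝ
  | 0 => 1
  | p+1 => 2 * (p + A) / (p - ν) * coreEta A ν p

theorem coreEta_ne (A ν : ℝ) (hA : 0 < A) (hne : ∀ q : ℕ, (q:ℝ) ≠ ν) (p : ℕ) :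
    coreEta A ν p ≠ 0 := by
  induction p with
  | zero => simp [coreEta]
  | succ p ih =>
    rw [coreEta]
    have h1 : (p:ℝ) + A ≠ 0 := by positivity
    have h2 : (p:ℝ) - ν ≠ 0 := sub_ne_zero.2 (hne p)
    positivity

theorem coreEta_rec (A ν : ℝ) (hne : ∀ q : ℕ, (q:ℝ) ≠ ν) (p : ℕ) :
    (p - ν) * coreEta A ν (p+1) = 2 * (p + A) * coreEta A ν p := by
  rw [coreEta]
  have h2 : (p:ℝ) - ν ≠ 0 := sub_ne_zero.2 (hne p)
  field_simp

def coreTab (A ν : ℝ) : ℕ → ℕ → ℝ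
  | 0, i => coreEta A ν i
  | p+1, i => coreTab A ν p (i+1) - coreTab A ν p i

theorem coreTab_rec (A ν : ℝ) (hne : ∀ q : ℕ, (q:ℝ) ≠ ν) (p i : ℕ) :
    p * coreTab A ν (p-1) (i+2) + (i - ν) * coreTab A ν p (i+1)
      - 2 * p * coreTab A ν (p-1) (i+1) - 2 * (i + A) * coreTab A ν p i = 0 := by
  induction p generalizing i with
  | zero =>
    have := coreEta_rec A ν hne i
    simp only [coreTab, Nat.cast_zero]
    linear_combination this
  | succ p ih =>
    have h1 := ih (i+1)
    have h2 := ih i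
    cases p with
    | zero =>
      simp only [coreTab, Nat.cast_zero, Nat.zero_add, Nat.sub_self] at h1 h2 ⊢
      push_cast at h1 h2 ⊢
      linear_combination h1 - h2
    | succ p =>
      simp only [Nat.add_sub_cancel] at h1 h2 ⊢
      have e0 : ∀ i, coreTab A ν (p+1+1) i = coreTab A ν (p+1) (i+1) - coreTab A ν (p+1) i :=
        fun i => rfl
      have e1 : ∀ i, coreTab A ν (p+1) i = coreTab A ν p (i+1) - coreTab A ν p i :=
        fun i => rfl
      simp only [e0, e1] at h1 h2 ⊢
      push_cast at h1 h2 ⊢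
      simp only [add_assoc] at h1 h2 ⊢
      norm_num at h1 h2 ⊢
      linear_combination h1 - h2

theorem coreTab_eq (A ν : ℝ) (hne : ∀ q : ℕ, (q:ℝ) ≠ ν) (p : ℕ) :
    coreD (2 * A + ν) ν p = coreTab A ν p 0 := by
  induction p using Nat.strong_induction_on with
  | _ p ih =>
    cases p with
    | zero => rfl
    | succ p =>
      have h1 := coreTab_rec A ν hne p 0
      rw [coreD_succ, ih p (by omega), ih (p-1) (by omega)]
      have h2 : (p:ℝ) - ν ≠ 0 := sub_ne_zero.2 (hne p)
      rw [inv_mul_eq_iff_eq_mul₀ h2]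
      have e0 : ∀ i, coreTab A ν (p+1) i = coreTab A ν p (i+1) - coreTab A ν p i :=
        fun i => rfl
      cases p with
      | zero =>
        simp only [coreTab, Nat.cast_zero, Nat.zero_add] at h1 ⊢
        linear_combination -h1
      | succ p =>
        have e1 : ∀ i, coreTab A ν (p+1) i = coreTab A ν p (i+1) - coreTab A ν p i :=
          fun i => rfl
        simp only [Nat.add_sub_cancel] at h1 ⊢
        simp only [e0, e1] at h1 ⊢
        push_cast at h1 ⊢
        norm_num at h1 ⊢
        linear_combination -h1

theorem coreTab_asymp (A ν : ℝ) (Q i : ℕ) : ∃ C, 0 ≤ C ∧ ∀ τ : ℝ, 1 ≤ τ →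
    |∑ p ∈ Finset.range Q, coreTab A ν p i * (τ⁻¹) ^ (p+1)
      - ∑ p ∈ Finset.range Q, coreEta A ν (i+p) * ((τ+1)⁻¹) ^ (p+1)| ≤ C * (τ⁻¹) ^ (Q+1) := by
  induction Q generalizing i with
  | zero => exact ⟨0, le_rfl, fun τ _ => by simp⟩
  | succ Q ih =>
    obtain ⟨C, hC, h⟩ := ih (i+1)
    refine ⟨C + |coreTab A ν Q i|, by positivity, fun τ hτ => ?_⟩
    have hτ0 : 0 < τ := by linarith
    have e1 : (τ + 1) * ∑ p ∈ Finset.range (Q+1), coreTab A ν p i * (τ⁻¹) ^ (p+1) =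
        coreEta A ν i + ∑ p ∈ Finset.range Q, coreTab A ν p (i+1) * (τ⁻¹) ^ (p+1)
          + coreTab A ν Q i * (τ⁻¹)^(Q+1) := by
      clear h ih
      induction Q with
      | zero => simp [coreTab]; field_simp
      | succ Q ih =>
        rw [Finset.sum_range_succ, mul_add, ih, Finset.sum_range_succ _ Q, coreTab]
        have : τ * (τ⁻¹)^(Q+1+1) = (τ⁻¹)^(Q+1) := by
          rw [pow_succ]; field_simp
        linear_combination (coreTab A ν Q (i+1) - coreTab A ν Q i) * this
    have e2 : (τ + 1) * ∑ p ∈ Finset.range (Q+1), coreEta A ν (i+p) * ((τ+1)⁻¹) ^ (p+1) =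
        coreEta A ν i + ∑ p ∈ Finset.range Q, coreEta A ν (i+1+p) * ((τ+1)⁻¹) ^ (p+1) := by
      rw [Finset.sum_range_succ', mul_add, Finset.mul_sum, add_comm]
      congr 1
      · simp; field_simp
      · refine Finset.sum_congr rfl fun p _ => ?_
        rw [show i + (p+1) = i+1+p by ring, pow_succ _ (p+1)]
        field_simp
    have h3 := h τ hτ
    have h4 : (τ+1) * |∑ p ∈ Finset.range (Q+1), coreTab A ν p i * (τ⁻¹) ^ (p+1)
      - ∑ p ∈ Finset.range (Q+1), coreEta A ν (i+p) * ((τ+1)⁻¹) ^ (p+1)| ≤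
        (C + |coreTab A ν Q i|) * (τ⁻¹)^(Q+1) := by
      rw [← abs_of_pos (show 0 < τ+1 by linarith), ← abs_mul, mul_sub,
        abs_of_pos (show 0 < τ+1 by linarith), e1, e2]
      have : ∀ x y z w : ℝ, x + y + z - (x + w) = (y - w) + z := by intros; ring
      rw [this]
      refine (abs_add_le _ _).trans ?_
      rw [add_mul]
      refine add_le_add h3 (le_of_eq ?_)
      rw [abs_mul, abs_of_pos (by positivity : 0 < (τ⁻¹)^(Q+1))]
    have h5 : τ * |∑ p ∈ Finset.range (Q+1), coreTab A ν p i * (τ⁻¹) ^ (p+1)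
      - ∑ p ∈ Finset.range (Q+1), coreEta A ν (i+p) * ((τ+1)⁻¹) ^ (p+1)| ≤
        (C + |coreTab A ν Q i|) * (τ⁻¹)^(Q+1) :=
      (mul_le_mul_of_nonneg_right (by linarith) (abs_nonneg _)).trans h4
    rw [pow_succ, ← mul_assoc, ← div_eq_mul_inv, le_div_iff₀ hτ0, mul_comm]
    exact h5

/-- the truncated series in `(τ+1)⁻¹` -/
def coreS (A ν : ℝ) (P : ℕ) (τ : ℝ) : ℝ :=
  ∑ p ∈ Finset.range P, coreEta A ν p * ((τ+1)⁻¹) ^ (p+1)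

def coreS' (A ν : ℝ) (P : ℕ) (τ : ℝ) : ℝ :=
  ∑ p ∈ Finset.range P, coreEta A ν p * (-(p+1) * ((τ+1)⁻¹) ^ (p+2))

theorem coreS_deriv (A ν : ℝ) (P : ℕ) (τ : ℝ) (hτ : 0 < τ) :
    HasDerivAt (coreS A ν P) (coreS' A ν P τ) τ := by
  unfold coreS coreS'
  refine HasDerivAt.fun_sum fun p _ => ?_
  refine HasDerivAt.const_mul _ ?_
  have h1 : HasDerivAt (fun τ : ℝ => (τ+1)⁻¹) (-1 / (τ+1)^2) τ :=
    ((hasDerivAt_id τ).add_const 1).fun_inv (by simp; linarith)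
  refine (h1.pow (p+1)).congr_deriv ?_
  have : τ + 1 ≠ 0 := by linarith
  rw [Nat.add_sub_cancel]
  push_cast
  rw [pow_add _ p 2]
  field_simp

theorem coreS_ode (A ν : ℝ) (hne : ∀ q : ℕ, (q:ℝ) ≠ ν) (P : ℕ) (τ : ℝ) (hτ : 0 < τ) :
    (τ^2 - 1) * coreS' A ν (P+1) τ + ((ν + 2) * τ + (2 * A + ν)) * coreS A ν (P+1) τ =
      (1 + ν) + 2 * (P + A) * coreEta A ν P * ((τ+1)⁻¹) ^ (P+1) := by
  have h0 : τ + 1 ≠ 0 := by linarith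
  induction P with
  | zero =>
    simp [coreS, coreS', coreEta]
    field_simp
    ring
  | succ P ih =>
    have e1 : coreS A ν (P+1+1) τ = coreS A ν (P+1) τ + coreEta A ν (P+1) * ((τ+1)⁻¹) ^ (P+1+1) :=
      Finset.sum_range_succ _ _
    have e2 : coreS' A ν (P+1+1) τ = coreS' A ν (P+1) τ +
      coreEta A ν (P+1) * (-((P+1:ℕ)+1) * ((τ+1)⁻¹) ^ (P+1+2)) :=
      Finset.sum_range_succ _ _
    rw [e1, e2]
    have h1 := coreEta_rec A ν hne P
    have e3 : (τ+1)⁻¹ ^ (P+1) = (τ+1)^2 * (τ+1)⁻¹ ^ (P+3) := by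
      rw [pow_add _ (P+1) 2]; field_simp
    have e4 : (τ+1)⁻¹ ^ (P+2) = (τ+1) * (τ+1)⁻¹ ^ (P+3) := by
      rw [pow_add _ (P+2) 1]; field_simp
    rw [e3] at ih
    rw [show P + 1 + 1 = P + 2 from rfl, show P + 1 + 2 = P + 3 from rfl, e4]
    push_cast
    linear_combination ih - h1 * (τ+1)^2 * (τ+1)⁻¹ ^ (P+3)

end

section

structure ScalHyp (h : ℕ → ℝ → ℝ → ℂ) (f : ℕ → ℝ → ℂ) (ν A : ℝ) (m : ℕ) : Prop where
  hν : 0 < ν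
  hA : 0 < A
  hm : ν < m + 1
  hne : ∀ q : ℕ, (q:ℝ) ≠ ν
  hb : ∀ j N : ℕ, ∃ C, 0 ≤ C ∧ ∀ a s : ℝ, 0 < a → 0 ≤ s → (1 + s) ^ N * ‖h j a s‖ ≤ C
  fb : ∀ j N : ℕ, ∃ C, 0 ≤ C ∧ ∀ s : ℝ, 0 ≤ s → (1 + s) ^ N * ‖f j s‖ ≤ C
  ht : ∀ j : ℕ, ∃ C, 0 ≤ C ∧ ∀ a s s' : ℝ, 0 < a → 0 ≤ s → 0 ≤ s' →
    ‖h j a s' - h j a s + ((s' - s : ℝ) : ℂ) * h (j+1) a s‖ ≤ C * (s' - s) ^ 2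
  ft : ∀ j : ℕ, ∃ C, 0 ≤ C ∧ ∀ s s' : ℝ, 0 ≤ s → 0 ≤ s' →
    ‖f j s' - f j s + ((s' - s : ℝ) : ℂ) * f (j+1) s‖ ≤ C * (s' - s) ^ 2
  hd : ∀ (j : ℕ) (a s : ℝ), 0 < a → 0 ≤ s → HasDerivAt (fun x => h j x s)
    (((1 + ν) * (h j a s - f j s) +
      ∫ x in (0:ℝ)..a, (((2 * A + ν : ℝ) : ℂ) * h (j+1) x s + (x:ℂ) * h (j+2) x s)) / a) a
  rem : ∀ j N : ℕ, ∃ C, 0 ≤ C ∧ ∀ a s : ℝ, 0 < a → 0 ≤ s → (1 + s) ^ N *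
    ‖h j a s - ∑ p ∈ Finset.range (m + 2), (coreD (2 * A + ν) ν p : ℂ) * f (j + p) s *
      ((a:ℂ) ^ p / (p.factorial : ℂ))‖ ≤ C * a ^ (m + 2)

/-- The path lemma. -/
theorem core_path {G0 G1 : ℝ → ℝ → ℂ} {D : ℂ} {a τ C : ℝ} (ha : 0 < a) (hτ : 0 < τ)
    (h0 : HasDerivAt (fun x => G0 x (τ * a)) D a)
    (h1 : ContinuousAt (fun x => G1 x (τ * a)) a)
    (ht : ∀ᶠ x in 𝓝 a, ∀ s, 0 ≤ s →
      ‖G0 x s - G0 x (τ * a) + ((s - τ * a : ℝ) : ℂ) * G1 x (τ * a)‖ ≤ C * (s - τ * a) ^ 2) :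
    HasDerivAt (fun x => G0 x (τ * x)) (D - τ * G1 a (τ * a)) a := by
  rw [hasDerivAt_iff_isLittleO] at h0 ⊢
  have e : (fun x => G0 x (τ * x) - G0 a (τ * a) - (x - a) • (D - τ * G1 a (τ * a))) =
    fun x => (G0 x (τ * x) - G0 x (τ * a) + ((τ * x - τ * a : ℝ) : ℂ) * G1 x (τ * a)) +
      (G0 x (τ * a) - G0 a (τ * a) - (x - a) • D) -
      ((τ * (x - a) : ℝ) : ℂ) * (G1 x (τ * a) - G1 a (τ * a)) := by
    funext x
    simp only [Complex.real_smul]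
    push_cast
    ring
  rw [e]
  refine Asymptotics.IsLittleO.sub (Asymptotics.IsLittleO.add ?_ h0) ?_
  · have : (fun x => G0 x (τ * x) - G0 x (τ * a) + ((τ * x - τ * a : ℝ) : ℂ) * G1 x (τ * a))
      =O[𝓝 a] fun x => (x - a) ^ 2 := by
      refine Asymptotics.IsBigO.of_bound (C * τ ^ 2) ?_
      filter_upwards [ht, lt_mem_nhds ha] with x hx hx0
      refine (hx (τ * x) (by positivity)).trans (le_of_eq ?_)
      rw [Real.norm_of_nonneg (sq_nonneg _)]
      ring
    refine this.trans_isLittleO ?_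
    simpa [Function.comp_def] using (Asymptotics.isLittleO_pow_id (𝕜 := ℝ) (n := 2) (by norm_num)).comp_tendsto
      (show Tendsto (fun x => x - a) (𝓝 a) (𝓝 0) by
        have := (by fun_prop : Continuous fun x : ℝ => x - a).tendsto a
        rwa [sub_self] at this)
  · have h2 : (fun x => G1 x (τ * a) - G1 a (τ * a)) =o[𝓝 a] (fun _ => (1:ℝ)) := by
      rw [Asymptotics.isLittleO_one_iff]
      have := h1.tendsto.sub_const (G1 a (τ * a))
      simpa using this
    have h3 : (fun x : ℝ => ((τ * (x - a) : ℝ) : ℂ)) =O[𝓝 a] (fun x => x - a) := by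
      refine Asymptotics.IsBigO.of_bound τ (Eventually.of_forall fun x => ?_)
      rw [Complex.norm_real, norm_mul, Real.norm_of_nonneg hτ.le]
    simpa using h3.mul_isLittleO h2

theorem core_deriv_of_taylor {u : ℝ → ℂ} {u1 : ℂ} {s C : ℝ} (hs : 0 < s)
    (ht : ∀ s', 0 ≤ s' → ‖u s' - u s + ((s' - s : ℝ) : ℂ) * u1‖ ≤ C * (s' - s) ^ 2) :
    HasDerivAt u (-u1) s := by
  have := core_path (G0 := fun _ x => u x) (G1 := fun _ _ => u1) (D := 0) (a := s) (τ := 1) (C := C)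
    hs one_pos (hasDerivAt_const _ _) continuousAt_const (Eventually.of_forall fun x s' hs' => by
      simpa using ht s' hs')
  simpa using this

theorem core_cont_of_taylor {u u1 : ℝ → ℂ} {C : ℝ}
    (ht : ∀ s s', 0 ≤ s → 0 ≤ s' → ‖u s' - u s + ((s' - s : ℝ) : ℂ) * u1 s‖ ≤ C * (s' - s) ^ 2) :
    ContinuousOn u (Ici 0) := by
  intro s hs
  have h1 : Tendsto (fun s' => u s' - u s + ((s' - s : ℝ) : ℂ) * u1 s) (𝓝[Ici 0] s) (𝓝 0) := by
    refine squeeze_zero_norm' (a := fun s' => C * (s' - s) ^ 2) ?_ ?_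
    · filter_upwards [self_mem_nhdsWithin] with s' hs' using ht s s' hs hs'
    · have : Tendsto (fun s' => C * (s' - s) ^ 2) (𝓝[Ici 0] s) (𝓝 (C * (s - s) ^ 2)) :=
        ((by fun_prop : Continuous fun s' : ℝ => C * (s' - s) ^ 2).tendsto s).mono_left nhdsWithin_le_nhds
      simpa using this
  have h2 : Tendsto (fun s' : ℝ => u s - ((s' - s : ℝ) : ℂ) * u1 s) (𝓝[Ici 0] s) (𝓝 (u s - ((s - s : ℝ):ℂ) * u1 s)) :=
    ((by fun_prop : Continuous fun s' : ℝ => u s - ((s' - s : ℝ) : ℂ) * u1 s).tendsto s).mono_left nhdsWithin_le_nhds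
  have h3 := h1.add h2
  simp only [sub_self, Complex.ofReal_zero, zero_mul, sub_zero, zero_add] at h3
  refine h3.congr fun x => by ring

theorem core_decay_int (τ : ℝ) (hτ : 0 < τ) : IntegrableOn (fun a : ℝ => ((1 + τ * a) ^ 2)⁻¹) (Ioi 0) := by
  have h1 : IntegrableOn (fun a : ℝ => ((1 + a) ^ 2)⁻¹) (Ioi (τ * 0)) := by
    have := integrableOn_add_rpow_Ioi_of_lt (a := -2) (c := 0) (m := 1) (by norm_num) (by norm_num)
    rw [mul_zero]
    refine this.congr_fun ?_ measurableSet_Ioi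
    intro x hx
    simp only
    rw [add_comm, Real.rpow_neg (by have : (0:ℝ) < x := hx; positivity)]
    norm_num
  have := (integrableOn_Ioi_comp_mul_left_iff (fun a : ℝ => ((1 + a) ^ 2)⁻¹) 0 hτ).2 h1
  exact this

theorem core_decay_intval (τ : ℝ) (hτ : 0 < τ) :
    ∫ a in Ioi (0:ℝ), ((1 + τ * a) ^ 2)⁻¹ = τ⁻¹ * ∫ a in Ioi (0:ℝ), ((1 + a) ^ 2)⁻¹ := by
  have := integral_comp_mul_left_Ioi (fun a : ℝ => ((1 + a) ^ 2)⁻¹) 0 hτ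
  simpa using this

section
variable {h : ℕ → ℝ → ℝ → ℂ} {f : ℕ → ℝ → ℂ} {ν A : ℝ} {m : ℕ}

theorem ScalHyp.fd (H : ScalHyp h f ν A m) (j : ℕ) (s : ℝ) (hs : 0 < s) :
    HasDerivAt (f j) (-f (j+1) s) s := by
  obtain ⟨C, _, hC⟩ := H.ft j
  exact core_deriv_of_taylor hs fun s' hs' => hC s s' hs.le hs'

theorem ScalHyp.fc (H : ScalHyp h f ν A m) (j : ℕ) : ContinuousOn (f j) (Ici 0) := by
  obtain ⟨C, _, hC⟩ := H.ft j
  exact core_cont_of_taylor hC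

theorem ScalHyp.hsd (H : ScalHyp h f ν A m) (j : ℕ) (a s : ℝ) (ha : 0 < a) (hs : 0 < s) :
    HasDerivAt (h j a) (-h (j+1) a s) s := by
  obtain ⟨C, _, hC⟩ := H.ht j
  exact core_deriv_of_taylor hs fun s' hs' => hC a s s' ha hs.le hs'

theorem ScalHyp.hc (H : ScalHyp h f ν A m) (j : ℕ) (s : ℝ) (hs : 0 ≤ s) :
    ContinuousOn (fun a => h j a s) (Ioi 0) :=
  fun a ha => (H.hd j a s ha hs).continuousAt.continuousWithinAt

/-- the integrand -/
def scalE (h : ℕ → ℝ → ℝ → ℂ) (ν A : ℝ) (j : ℕ) (x s : ℝ) : ℂ :=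
  ((2 * A + ν : ℝ) : ℂ) * h (j+1) x s + (x:ℂ) * h (j+2) x s

def scalJ (h : ℕ → ℝ → ℝ → ℂ) (ν A : ℝ) (j : ℕ) (a s : ℝ) : ℂ :=
  ∫ x in (0:ℝ)..a, scalE h ν A j x s

theorem ScalHyp.Ec (H : ScalHyp h f ν A m) (j : ℕ) (s : ℝ) (hs : 0 ≤ s) :
    ContinuousOn (fun x => scalE h ν A j x s) (Ioi 0) :=
  (continuousOn_const.mul (H.hc _ s hs)).add
    (Complex.continuous_ofReal.continuousOn.mul (H.hc _ s hs))

theorem ScalHyp.Eb (H : ScalHyp h f ν A m) (j N : ℕ) : ∃ C, 0 ≤ C ∧ ∀ a s : ℝ, 0 < a → 0 ≤ s →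
    (1 + s) ^ N * ‖scalE h ν A j a s‖ ≤ C * (1 + a) := by
  obtain ⟨C1, h1, hC1⟩ := H.hb (j+1) N
  obtain ⟨C2, h2, hC2⟩ := H.hb (j+2) N
  have hβ : 0 ≤ 2 * A + ν := by have := H.hA; have := H.hν; positivity
  refine ⟨(2 * A + ν) * C1 + C2, by positivity, fun a s ha hs => ?_⟩
  have e : ‖scalE h ν A j a s‖ ≤ (2 * A + ν) * ‖h (j+1) a s‖ + a * ‖h (j+2) a s‖ := by
    refine (norm_add_le _ _).trans ?_
    rw [norm_mul, norm_mul, Complex.norm_real, Complex.norm_real, Real.norm_of_nonneg hβ,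
      Real.norm_of_nonneg ha.le]
  calc (1 + s) ^ N * ‖scalE h ν A j a s‖
      ≤ (1 + s) ^ N * ((2 * A + ν) * ‖h (j+1) a s‖ + a * ‖h (j+2) a s‖) := by gcongr
    _ = (2 * A + ν) * ((1 + s) ^ N * ‖h (j+1) a s‖) + a * ((1 + s) ^ N * ‖h (j+2) a s‖) := by ring
    _ ≤ (2 * A + ν) * C1 + a * C2 := by gcongr <;> [exact hC1 a s ha hs; exact hC2 a s ha hs]
    _ ≤ _ := by nlinarith [mul_nonneg (mul_nonneg hβ h1) ha.le]

theorem ScalHyp.Eint (H : ScalHyp h f ν A m) (j : ℕ) (a s : ℝ) (ha : 0 ≤ a) (hs : 0 ≤ s) :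
    IntervalIntegrable (fun x => scalE h ν A j x s) volume 0 a := by
  obtain ⟨C, h0, hC⟩ := H.Eb j 0
  rw [intervalIntegrable_iff_integrableOn_Ioc_of_le ha]
  refine IntegrableOn.of_bound (by simp) (((H.Ec j s hs).mono Ioc_subset_Ioi_self).aestronglyMeasurable
    measurableSet_Ioc) (C * (1 + a)) ?_
  refine (ae_restrict_iff' measurableSet_Ioc).2 (Eventually.of_forall fun x hx => ?_)
  have := hC x s hx.1 hs
  rw [pow_zero, one_mul] at this
  refine this.trans ?_
  have := hx.2
  gcongr

theorem ScalHyp.Jd (H : ScalHyp h f ν A m) (j : ℕ) (a s : ℝ) (ha : 0 < a) (hs : 0 ≤ s) :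
    HasDerivAt (fun x => scalJ h ν A j x s) (scalE h ν A j a s) a := by
  refine intervalIntegral.integral_hasDerivAt_right (H.Eint j a s ha.le hs) ?_
    ((H.Ec j s hs).continuousAt (Ioi_mem_nhds ha))
  exact (H.Ec j s hs).stronglyMeasurableAtFilter isOpen_Ioi a ha

theorem ScalHyp.Jb (H : ScalHyp h f ν A m) (j N : ℕ) : ∃ C, 0 ≤ C ∧ ∀ a s : ℝ, 0 < a → 0 ≤ s →
    (1 + s) ^ N * ‖scalJ h ν A j a s‖ ≤ C * (1 + a) * a := by
  obtain ⟨C, h0, hC⟩ := H.Eb j N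
  refine ⟨C, h0, fun a s ha hs => ?_⟩
  have hp : 0 < (1 + s) ^ N := by positivity
  have : ‖scalJ h ν A j a s‖ ≤ C * (1 + a) / (1 + s) ^ N * |a - 0| := by
    refine intervalIntegral.norm_integral_le_of_norm_le_const fun x hx => ?_
    rw [uIoc_of_le ha.le] at hx
    rw [le_div_iff₀ hp, mul_comm]
    refine (hC x s hx.1 hs).trans ?_
    have := hx.2
    gcongr
  rw [sub_zero, abs_of_pos ha] at this
  calc _ ≤ (1 + s) ^ N * (C * (1 + a) / (1 + s) ^ N * a) := by gcongr
    _ = _ := by field_simp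

theorem ScalHyp.Jt (H : ScalHyp h f ν A m) (j : ℕ) : ∃ C, 0 ≤ C ∧ ∀ a s s' : ℝ, 0 < a → 0 ≤ s → 0 ≤ s' →
    ‖scalJ h ν A j a s' - scalJ h ν A j a s + ((s' - s : ℝ) : ℂ) * scalJ h ν A (j+1) a s‖
      ≤ C * (1 + a) * a * (s' - s) ^ 2 := by
  obtain ⟨C1, h1, hC1⟩ := H.ht (j+1)
  obtain ⟨C2, h2, hC2⟩ := H.ht (j+2)
  have hβ : 0 ≤ 2 * A + ν := by have := H.hA; have := H.hν; positivity
  refine ⟨(2 * A + ν) * C1 + C2, by positivity, fun a s s' ha hs hs' => ?_⟩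
  unfold scalJ
  rw [← intervalIntegral.integral_sub (H.Eint j a s' ha.le hs') (H.Eint j a s ha.le hs),
    ← intervalIntegral.integral_const_mul, ← intervalIntegral.integral_add
    ((H.Eint j a s' ha.le hs').sub (H.Eint j a s ha.le hs)) ((H.Eint (j+1) a s ha.le hs).const_mul _)]
  have : ‖∫ x in (0:ℝ)..a, (scalE h ν A j x s' - scalE h ν A j x s +
      ((s' - s : ℝ) : ℂ) * scalE h ν A (j+1) x s)‖ ≤
      (((2 * A + ν) * C1 + C2) * (1 + a) * (s' - s) ^ 2) * |a - 0| := by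
    refine intervalIntegral.norm_integral_le_of_norm_le_const fun x hx => ?_
    rw [uIoc_of_le ha.le] at hx
    have e : scalE h ν A j x s' - scalE h ν A j x s + ((s' - s : ℝ) : ℂ) * scalE h ν A (j+1) x s
      = ((2 * A + ν : ℝ) : ℂ) * (h (j+1) x s' - h (j+1) x s + ((s' - s : ℝ) : ℂ) * h (j+1+1) x s) +
        (x : ℂ) * (h (j+2) x s' - h (j+2) x s + ((s' - s : ℝ) : ℂ) * h (j+2+1) x s) := by
      unfold scalE
      ring
    rw [e]
    refine (norm_add_le _ _).trans ?_
    rw [norm_mul, norm_mul, Complex.norm_real, Complex.norm_real, Real.norm_of_nonneg hβ,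
      Real.norm_of_nonneg hx.1.le]
    have b1 := hC1 x s s' hx.1 hs hs'
    have b2 := hC2 x s s' hx.1 hs hs'
    have hx2 := hx.2
    calc _ ≤ (2 * A + ν) * (C1 * (s' - s) ^ 2) + a * (C2 * (s' - s) ^ 2) := by
          gcongr
      _ ≤ _ := by
          have : 0 ≤ (2 * A + ν) * C1 * a * (s' - s) ^ 2 := by positivity
          have : 0 ≤ C2 * (s' - s) ^ 2 := by positivity
          nlinarith
  rw [sub_zero, abs_of_pos ha] at this
  refine this.trans (le_of_eq (by ring))

theorem ScalHyp.kd (H : ScalHyp h f ν A m) (j : ℕ) (τ a : ℝ) (hτ : 0 < τ) (ha : 0 < a) :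
    HasDerivAt (fun x => h j x (τ * x)) (((1 + ν) * (h j a (τ * a) - f j (τ * a)) +
      scalJ h ν A j a (τ * a)) / a - τ * h (j+1) a (τ * a)) a := by
  obtain ⟨C, h0, hC⟩ := H.ht j
  have hs : 0 < τ * a := by positivity
  refine core_path (C := C) ha hτ (H.hd j a (τ * a) ha hs.le)
    ((H.hc (j+1) _ hs.le).continuousAt (Ioi_mem_nhds ha)) ?_
  filter_upwards [lt_mem_nhds ha] with x hx s hs'
  exact hC x _ s hx hs.le hs'

theorem ScalHyp.Jpd (H : ScalHyp h f ν A m) (j : ℕ) (τ a : ℝ) (hτ : 0 < τ) (ha : 0 < a) :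
    HasDerivAt (fun x => scalJ h ν A j x (τ * x)) (scalE h ν A j a (τ * a)
      - τ * scalJ h ν A (j+1) a (τ * a)) a := by
  obtain ⟨C, h0, hC⟩ := H.Jt j
  have hs : 0 < τ * a := by positivity
  refine core_path (C := C * (1 + (a+1)) * (a+1)) ha hτ (H.Jd j a (τ * a) ha hs.le)
    (H.Jd (j+1) a (τ * a) ha hs.le).continuousAt ?_
  filter_upwards [lt_mem_nhds ha, gt_mem_nhds (show a < a + 1 by linarith)] with x hx hx1 s hs'
  refine (hC x _ s hx hs.le hs').trans ?_
  gcongr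

def scalV (h : ℕ → ℝ → ℝ → ℂ) (f : ℕ → ℝ → ℂ) (ν A τ a : ℝ) : ℂ :=
  (τ:ℂ) * a * h 1 a (τ * a) - (1 + ν) * f 0 (τ * a) + scalJ h ν A 0 a (τ * a)

theorem ScalHyp.Vd (H : ScalHyp h f ν A m) (τ a : ℝ) (hτ : 0 < τ) (ha : 0 < a) :
    HasDerivAt (scalV h f ν A τ) (((τ * (2 + ν) + (2 * A + ν) : ℝ) : ℂ) * h 1 a (τ * a) -
      ((τ ^ 2 - 1 : ℝ) : ℂ) * ((a:ℂ) * h 2 a (τ * a))) a := by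
  have h1 := H.kd 1 τ a hτ ha
  have h2 : HasDerivAt (fun x => f 0 (τ * x)) (τ • -f 1 (τ * a)) a := by
    have h3 : HasDerivAt (fun x => τ * x) τ a := by simpa using (hasDerivAt_id a).const_mul τ
    exact (H.fd 0 (τ * a) (by positivity)).scomp a h3
  have h3 := H.Jpd 0 τ a hτ ha
  have h0 : HasDerivAt (fun x : ℝ => (τ:ℂ) * x) (τ * 1) a := (Complex.ofRealCLM.hasDerivAt (x := a)).const_mul (τ:ℂ)
  have := ((h0.mul h1).sub (h2.const_mul (1 + ν : ℂ))).add h3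
  refine this.congr_deriv ?_
  unfold scalE
  have : (a:ℂ) ≠ 0 := by exact_mod_cast ha.ne'
  simp only [Complex.real_smul]
  push_cast
  field_simp
  ring

end

end

section

theorem core_intOn {u : ℝ → ℂ} {C τ : ℝ} (hτ : 0 < τ) (hu : ContinuousOn u (Ioi 0))
    (hb : ∀ a, 0 < a → ‖u a‖ ≤ C * ((1 + τ * a) ^ 2)⁻¹) : IntegrableOn u (Ioi 0) := by
  refine Integrable.mono' ((core_decay_int τ hτ).const_mul C)
    (hu.aestronglyMeasurable measurableSet_Ioi) ?_
  exact (ae_restrict_iff' measurableSet_Ioi).2 (Eventually.of_forall fun x hx => hb x hx)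

theorem core_decay_lim {u : ℝ → ℂ} {C τ : ℝ} (hτ : 0 < τ)
    (hb : ∀ a, 0 < a → ‖u a‖ ≤ C * ((1 + τ * a))⁻¹) : Tendsto u atTop (𝓝 0) := by
  refine squeeze_zero_norm' (a := fun a => C * ((1 + τ * a))⁻¹) ?_ ?_
  · filter_upwards [eventually_gt_atTop 0] with a ha using hb a ha
  · have : Tendsto (fun a : ℝ => 1 + τ * a) atTop atTop :=
      tendsto_atTop_add_const_left _ _ (tendsto_id.const_mul_atTop hτ)
    simpa using (tendsto_inv_atTop_zero.comp this).const_mul C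

/-- integral from `0` to infinity of a derivative -/
theorem core_FTC {V V' : ℝ → ℂ} {l : ℂ} (hd : ∀ a, 0 < a → HasDerivAt V (V' a) a)
    (hi : IntegrableOn V' (Ioi 0)) (h0 : Tendsto V (𝓝[>] 0) (𝓝 l)) (h1 : Tendsto V atTop (𝓝 0)) :
    ∫ a in Ioi (0:ℝ), V' a = -l := by
  have := integral_Ioi_of_hasDerivAt_of_tendsto (f := Function.update V 0 l) (f' := V') (a := 0) (m := 0)
    ?_ ?_ hi ?_
  · rw [this]
    simp
  · rw [← Ioi_union_left, union_comm, ← insert_eq, continuousWithinAt_insert_self]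
    unfold ContinuousWithinAt
    rw [Function.update_self]
    refine h0.congr' ?_
    filter_upwards [self_mem_nhdsWithin] with x hx
    rw [Function.update_of_ne (ne_of_gt hx)]
  · intro x hx
    refine (hd x hx).congr_of_eventuallyEq ?_
    filter_upwards [Ioi_mem_nhds (show (0:ℝ) < x from hx)] with y hy
    rw [Function.update_of_ne (ne_of_gt hy)]
  · refine h1.congr' ?_
    filter_upwards [eventually_gt_atTop 0] with x hx
    rw [Function.update_of_ne (ne_of_gt hx)]

theorem core_wt {C τ a x : ℝ} (hτ : 0 < τ) (ha : 0 < a) (p N : ℕ) (hx : (1 + τ * a) ^ (N + p) * x ≤ C)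
    (hx0 : 0 ≤ x) :
    a ^ p * x ≤ C * (τ⁻¹) ^ p * ((1 + τ * a) ^ N)⁻¹ := by
  have h1 : a ^ p ≤ (τ⁻¹) ^ p * (1 + τ * a) ^ p := by
    rw [← mul_pow]
    gcongr
    field_simp
    linarith
  have hp : 0 < (1 + τ * a) ^ N := by positivity
  rw [← div_eq_mul_inv, le_div_iff₀ hp]
  calc a ^ p * x * (1 + τ * a) ^ N ≤ ((τ⁻¹) ^ p * (1 + τ * a) ^ p) * x * (1 + τ * a) ^ N := by gcongr
    _ = (τ⁻¹) ^ p * ((1 + τ * a) ^ (N + p) * x) := by ring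
    _ ≤ (τ⁻¹) ^ p * C := by gcongr
    _ = _ := by ring

section
variable {h : ℕ → ℝ → ℝ → ℂ} {f : ℕ → ℝ → ℂ} {ν A : ℝ} {m : ℕ}

theorem ScalHyp.kc (H : ScalHyp h f ν A m) (j : ℕ) (τ : ℝ) (hτ : 0 < τ) :
    ContinuousOn (fun a => h j a (τ * a)) (Ioi 0) :=
  fun a ha => (H.kd j τ a hτ ha).continuousAt.continuousWithinAt

theorem ScalHyp.kb (H : ScalHyp h f ν A m) (j p N : ℕ) : ∃ C, 0 ≤ C ∧ ∀ τ a : ℝ, 0 < τ → 0 < a →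
    ‖(a:ℂ) ^ p * h j a (τ * a)‖ ≤ C * (τ⁻¹) ^ p * ((1 + τ * a) ^ N)⁻¹ := by
  obtain ⟨C, h0, hC⟩ := H.hb j (N + p)
  refine ⟨C, h0, fun τ a hτ ha => ?_⟩
  rw [norm_mul, norm_pow, Complex.norm_real, Real.norm_of_nonneg ha.le]
  exact core_wt hτ ha p N (hC a _ ha (by positivity)) (norm_nonneg _)

theorem ScalHyp.fkb (H : ScalHyp h f ν A m) (j p N : ℕ) : ∃ C, 0 ≤ C ∧ ∀ τ a : ℝ, 0 < τ → 0 < a →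
    ‖(a:ℂ) ^ p * f j (τ * a)‖ ≤ C * (τ⁻¹) ^ p * ((1 + τ * a) ^ N)⁻¹ := by
  obtain ⟨C, h0, hC⟩ := H.fb j (N + p)
  refine ⟨C, h0, fun τ a hτ ha => ?_⟩
  rw [norm_mul, norm_pow, Complex.norm_real, Real.norm_of_nonneg ha.le]
  exact core_wt hτ ha p N (hC _ (by positivity)) (norm_nonneg _)

theorem ScalHyp.kint (H : ScalHyp h f ν A m) (j p : ℕ) (τ : ℝ) (hτ : 0 < τ) :
    IntegrableOn (fun a : ℝ => (a:ℂ) ^ p * h j a (τ * a)) (Ioi 0) := by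
  obtain ⟨C, h0, hC⟩ := H.kb j p 2
  exact core_intOn hτ (((Complex.continuous_ofReal.pow p).continuousOn).mul (H.kc j τ hτ))
    fun a ha => hC τ a hτ ha

theorem ScalHyp.fkint (H : ScalHyp h f ν A m) (j p : ℕ) (τ : ℝ) (hτ : 0 < τ) :
    IntegrableOn (fun a : ℝ => (a:ℂ) ^ p * f j (τ * a)) (Ioi 0) := by
  obtain ⟨C, h0, hC⟩ := H.fkb j p 2
  refine core_intOn hτ (((Complex.continuous_ofReal.pow p).continuousOn).mul ?_)
    fun a ha => hC τ a hτ ha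
  refine (H.fc j).comp (by fun_prop) fun a ha => ?_
  have : 0 < a := ha
  exact mem_Ici.2 (by positivity)

def scalK (h : ℕ → ℝ → ℝ → ℂ) (τ : ℝ) : ℂ := ∫ a in Ioi (0:ℝ), h 1 a (τ * a)

def scalK' (h : ℕ → ℝ → ℝ → ℂ) (τ : ℝ) : ℂ := ∫ a in Ioi (0:ℝ), -((a:ℂ) * h 2 a (τ * a))

theorem ScalHyp.Kd (H : ScalHyp h f ν A m) (τ : ℝ) (hτ : 0 < τ) :
    HasDerivAt (scalK h) (scalK' h τ) τ := by
  obtain ⟨C, h0, hC⟩ := H.kb 2 1 2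
  have hτ2 : 0 < τ / 2 := by positivity
  refine (hasDerivAt_integral_of_dominated_loc_of_deriv_le (s := Ioi (τ/2))
    (F := fun τ a => h 1 a (τ * a)) (F' := fun τ a => -((a:ℂ) * h 2 a (τ * a)))
    (bound := fun a => (C * ((τ/2)⁻¹)^1) * ((1 + τ/2 * a)^2)⁻¹)
    (Ioi_mem_nhds (by linarith)) ?_ ?_ ?_ ?_ ?_ ?_).2
  · filter_upwards [lt_mem_nhds hτ] with t ht
    exact (H.kc 1 t ht).aestronglyMeasurable measurableSet_Ioi
  · have := H.kint 1 0 τ hτ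
    simp only [pow_zero, one_mul] at this
    exact this
  · have := (H.kint 2 1 τ hτ).neg.aestronglyMeasurable
    simp only [pow_one] at this
    exact this
  · refine (ae_restrict_iff' measurableSet_Ioi).2 (Eventually.of_forall fun a ha t ht => ?_)
    have ha : 0 < a := ha
    have ht : τ / 2 < t := ht
    have ht0 := hτ2.trans ht
    have := hC t a ht0 ha
    rw [pow_one] at this
    rw [norm_neg]
    refine this.trans ?_
    gcongr
  · exact (core_decay_int _ hτ2).const_mul _
  · refine (ae_restrict_iff' measurableSet_Ioi).2 (Eventually.of_forall fun a ha t ht => ?_)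
    have ha : 0 < a := ha
    have ht : τ / 2 < t := ht
    have ht0 := hτ2.trans ht
    have h3 : HasDerivAt (fun x => x * a) a t := by simpa using (hasDerivAt_id t).mul_const a
    have := (H.hsd 1 a (t * a) ha (by positivity)).scomp t h3
    refine this.congr_deriv ?_
    simp [Complex.real_smul]

theorem ScalHyp.Vlim0 (H : ScalHyp h f ν A m) (τ : ℝ) (hτ : 0 < τ) :
    Tendsto (scalV h f ν A τ) (𝓝[>] 0) (𝓝 (-((1 + ν) * f 0 0))) := by
  have hid : Tendsto (fun a : ℝ => a) (𝓝[>] 0) (𝓝 0) := tendsto_id.mono_left nhdsWithin_le_nhds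
  have h1 : Tendsto (fun a : ℝ => (τ:ℂ) * a * h 1 a (τ * a)) (𝓝[>] 0) (𝓝 0) := by
    obtain ⟨C, h0, hC⟩ := H.hb 1 0
    refine squeeze_zero_norm' (a := fun a => τ * a * C) ?_ ?_
    · filter_upwards [self_mem_nhdsWithin] with a ha
      have ha : 0 < a := ha
      have := hC a (τ * a) ha (by positivity)
      rw [pow_zero, one_mul] at this
      rw [norm_mul, norm_mul, Complex.norm_real, Complex.norm_real, Real.norm_of_nonneg ha.le,
        Real.norm_of_nonneg hτ.le]
      gcongr
    · have := (hid.const_mul τ).mul_const C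
      simpa using this
  have h2 : Tendsto (fun a : ℝ => f 0 (τ * a)) (𝓝[>] 0) (𝓝 (f 0 0)) := by
    have c := (H.fc 0) 0 self_mem_Ici
    refine c.tendsto.comp (tendsto_nhdsWithin_iff.2 ⟨?_, ?_⟩)
    · simpa using hid.const_mul τ
    · filter_upwards [self_mem_nhdsWithin] with a ha
      have ha : 0 < a := ha
      exact mem_Ici.2 (by positivity)
  have h3 : Tendsto (fun a : ℝ => scalJ h ν A 0 a (τ * a)) (𝓝[>] 0) (𝓝 0) := by
    obtain ⟨C, h0, hC⟩ := H.Jb 0 0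
    refine squeeze_zero_norm' (a := fun a => C * (1 + a) * a) ?_ ?_
    · filter_upwards [self_mem_nhdsWithin] with a ha
      have ha : 0 < a := ha
      have := hC a (τ * a) ha (by positivity)
      rwa [pow_zero, one_mul] at this
    · have := ((hid.const_add 1).const_mul C).mul hid
      simpa using this
  have := (h1.sub (h2.const_mul (1 + ν : ℂ))).add h3
  simp only [zero_sub, add_zero] at this
  exact this

theorem ScalHyp.Vlim1 (H : ScalHyp h f ν A m) (τ : ℝ) (hτ : 0 < τ) :
    Tendsto (scalV h f ν A τ) atTop (𝓝 0) := by
  have h1 : Tendsto (fun a : ℝ => (a:ℂ)^1 * h 1 a (τ * a)) atTop (𝓝 0) := by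
    obtain ⟨C, h0, hC⟩ := H.kb 1 1 1
    exact core_decay_lim hτ fun a ha => by have := hC τ a hτ ha; rwa [pow_one (1 + τ * a)] at this
  have h2 : Tendsto (fun a : ℝ => (a:ℂ)^0 * f 0 (τ * a)) atTop (𝓝 0) := by
    obtain ⟨C, h0, hC⟩ := H.fkb 0 0 1
    exact core_decay_lim hτ fun a ha => by have := hC τ a hτ ha; rwa [pow_one (1 + τ * a)] at this
  have h3 : Tendsto (fun a : ℝ => scalJ h ν A 0 a (τ * a)) atTop (𝓝 0) := by
    obtain ⟨C, h0, hC⟩ := H.Jb 0 3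
    refine core_decay_lim (C := C * (1 + τ⁻¹) * τ⁻¹) hτ fun a ha => ?_
    have := hC a (τ * a) ha (by positivity)
    have e1 : a ≤ τ⁻¹ * (1 + τ * a) := by field_simp; linarith
    have e2 : 1 + a ≤ (1 + τ⁻¹) * (1 + τ * a) := by
      have : 0 < τ * a := by positivity
      have : 0 < τ⁻¹ := by positivity
      nlinarith
    have hp : 0 < 1 + τ * a := by positivity
    have e3 : C * (1 + a) * a ≤ C * ((1 + τ⁻¹) * (1 + τ * a)) * (τ⁻¹ * (1 + τ * a)) := by gcongr
    rw [← div_eq_mul_inv, le_div_iff₀ hp]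
    refine le_of_mul_le_mul_left (a := (1 + τ * a) ^ 2) ?_ (by positivity)
    calc _ = (1 + τ * a) ^ 3 * ‖scalJ h ν A 0 a (τ * a)‖ := by ring
      _ ≤ _ := this.trans e3
      _ = _ := by ring
  have := ((h1.const_mul (τ:ℂ)).sub (h2.const_mul (1 + ν : ℂ))).add h3
  simp only [mul_zero, sub_zero, add_zero] at this
  refine this.congr fun a => ?_
  unfold scalV
  ring

theorem ScalHyp.Kode (H : ScalHyp h f ν A m) (τ : ℝ) (hτ : 0 < τ) :
    ((τ ^ 2 - 1 : ℝ) : ℂ) * scalK' h τ + (((ν + 2) * τ + (2 * A + ν) : ℝ) : ℂ) * scalK h τ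
      = (1 + ν) * f 0 0 := by
  have i1 : IntegrableOn (fun a : ℝ => h 1 a (τ * a)) (Ioi 0) := by simpa using H.kint 1 0 τ hτ
  have i2 : IntegrableOn (fun a : ℝ => (a:ℂ) * h 2 a (τ * a)) (Ioi 0) := by simpa using H.kint 2 1 τ hτ
  have := core_FTC (fun a ha => H.Vd τ a hτ ha) ((i1.const_mul _).sub (i2.const_mul _))
    (H.Vlim0 τ hτ) (H.Vlim1 τ hτ)
  rw [integral_sub (i1.const_mul _) (i2.const_mul _), integral_const_mul, integral_const_mul,
    neg_neg] at this
  rw [← this]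
  unfold scalK' scalK
  rw [integral_neg]
  push_cast
  ring

theorem ScalHyp.fmom (H : ScalHyp h f ν A m) (p : ℕ) (j : ℕ) (τ : ℝ) (hτ : 0 < τ) :
    ∫ a in Ioi (0:ℝ), (a:ℂ) ^ p * f (j + p + 1) (τ * a) = p.factorial * (τ⁻¹ : ℂ) ^ (p + 1) * f j 0 := by
  have hid : Tendsto (fun a : ℝ => a) (𝓝[>] 0) (𝓝 0) := tendsto_id.mono_left nhdsWithin_le_nhds
  have hτ' : (τ:ℂ) ≠ 0 := by exact_mod_cast hτ.ne'
  have h2 : ∀ i, Tendsto (fun a : ℝ => f i (τ * a)) (𝓝[>] 0) (𝓝 (f i 0)) := by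
    intro i
    have c := (H.fc i) 0 self_mem_Ici
    refine c.tendsto.comp (tendsto_nhdsWithin_iff.2 ⟨?_, ?_⟩)
    · simpa using hid.const_mul τ
    · filter_upwards [self_mem_nhdsWithin] with a ha
      have ha : 0 < a := ha
      exact mem_Ici.2 (by positivity)
  have hfd : ∀ i a, 0 < a → HasDerivAt (fun x => f i (τ * x)) (-(τ * f (i+1) (τ * a))) a := by
    intro i a ha
    have h3 : HasDerivAt (fun x => τ * x) τ a := by simpa using (hasDerivAt_id a).const_mul τ
    have := (H.fd i (τ * a) (by positivity)).scomp a h3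
    refine this.congr_deriv ?_
    simp [Complex.real_smul]
  induction p generalizing j with
  | zero =>
    have i1 : IntegrableOn (fun a : ℝ => f (j+1) (τ * a)) (Ioi 0) := by simpa using H.fkint (j+1) 0 τ hτ
    have l1 : Tendsto (fun a : ℝ => f j (τ * a)) atTop (𝓝 0) := by
      obtain ⟨C, h0, hC⟩ := H.fkb j 0 1
      refine core_decay_lim (C := C) hτ fun a ha => by have := hC τ a hτ ha; simpa using this
    have := core_FTC (hfd j) ((i1.const_mul (τ:ℂ)).neg) (h2 j) l1
    rw [integral_neg, integral_const_mul] at this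
    simp only [pow_zero, one_mul, Nat.add_zero, Nat.factorial_zero, Nat.cast_one, zero_add, pow_one]
    rw [eq_inv_mul_iff_mul_eq₀ hτ']
    exact neg_injective this
  | succ p ih =>
    have hpd : ∀ a : ℝ, HasDerivAt (fun x : ℝ => (x:ℂ) ^ (p+1)) ((p+1) * (a:ℂ)^p) a := by
      intro a
      have := (Complex.ofRealCLM.hasDerivAt (x := a)).pow (p+1)
      refine this.congr_deriv ?_
      simp
    have i1 := (H.fkint (j+p+1) p τ hτ).const_mul ((p:ℂ)+1)
    have i2 := (H.fkint (j+(p+1)+1) (p+1) τ hτ).const_mul (τ:ℂ)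
    have l1 : Tendsto (fun a : ℝ => (a:ℂ)^(p+1) * f (j+p+1) (τ * a)) atTop (𝓝 0) := by
      obtain ⟨C, h0, hC⟩ := H.fkb (j+p+1) (p+1) 1
      refine core_decay_lim hτ fun a ha => by have := hC τ a hτ ha; rwa [pow_one (1 + τ * a)] at this
    have l0 : Tendsto (fun a : ℝ => (a:ℂ)^(p+1) * f (j+p+1) (τ * a)) (𝓝[>] 0) (𝓝 0) := by
      have : Tendsto (fun a : ℝ => (a:ℂ)^(p+1)) (𝓝[>] 0) (𝓝 0) := by
        have := ((by fun_prop : Continuous fun a : ℝ => (a:ℂ)^(p+1)).tendsto 0).mono_left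
          (nhdsWithin_le_nhds (s := Ioi 0))
        simpa using this
      simpa using this.mul (h2 (j+p+1))
    have := core_FTC (V' := fun a : ℝ => ((p:ℂ)+1) * ((a:ℂ)^p * f (j+p+1) (τ * a)) -
      τ * ((a:ℂ)^(p+1) * f (j+(p+1)+1) (τ * a))) (fun a ha => ((hpd a).mul (hfd (j+p+1) a ha)).congr_deriv (by ring_nf))
      (i1.sub i2) l0 l1
    rw [integral_sub i1 i2, integral_const_mul, integral_const_mul, ih, neg_zero, sub_eq_zero] at this
    have e : ∫ a in Ioi (0:ℝ), (a:ℂ) ^ (p+1) * f (j + (p+1) + 1) (τ * a) = (τ:ℂ)⁻¹ * (((p:ℂ)+1) * (p.factorial * (τ⁻¹ : ℂ) ^ (p + 1) * f j 0)) := by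
      rw [this, inv_mul_cancel_left₀ hτ']
    rw [e, Nat.factorial_succ]
    push_cast
    ring

theorem ScalHyp.Kbd (H : ScalHyp h f ν A m) : ∃ C, 0 ≤ C ∧ ∀ τ, 0 < τ → ‖scalK h τ‖ ≤ C * τ⁻¹ := by
  obtain ⟨C, h0, hC⟩ := H.kb 1 0 2
  refine ⟨C * ∫ a in Ioi (0:ℝ), ((1 + a) ^ 2)⁻¹, ?_, fun τ hτ => ?_⟩
  · refine mul_nonneg h0 (setIntegral_nonneg measurableSet_Ioi fun x _ => by positivity)
  · have : ‖scalK h τ‖ ≤ ∫ a in Ioi (0:ℝ), C * ((1 + τ * a) ^ 2)⁻¹ := by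
      refine norm_integral_le_of_norm_le ((core_decay_int τ hτ).const_mul C) ?_
      refine (ae_restrict_iff' measurableSet_Ioi).2 (Eventually.of_forall fun a ha => ?_)
      simpa using hC τ a hτ ha
    rw [integral_const_mul, core_decay_intval τ hτ] at this
    refine this.trans (le_of_eq (by ring))

theorem ScalHyp.Kasymp (H : ScalHyp h f ν A m) : ∃ C, 0 ≤ C ∧ ∀ τ, 0 < τ →
    ‖scalK h τ - f 0 0 * ((∑ p ∈ Finset.range (m + 2), coreD (2 * A + ν) ν p * (τ⁻¹) ^ (p+1) : ℝ) : ℂ)‖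
      ≤ C * (τ⁻¹) ^ (m + 3) := by
  obtain ⟨C, h0, hC⟩ := H.rem 1 (m + 4)
  refine ⟨C * ∫ a in Ioi (0:ℝ), ((1 + a) ^ 2)⁻¹, ?_, fun τ hτ => ?_⟩
  · refine mul_nonneg h0 (setIntegral_nonneg measurableSet_Ioi fun x _ => by positivity)
  have i0 : IntegrableOn (fun a : ℝ => h 1 a (τ * a)) (Ioi 0) := by simpa using H.kint 1 0 τ hτ
  have i1 : ∀ p ∈ Finset.range (m+2), IntegrableOn (fun a : ℝ => (coreD (2 * A + ν) ν p : ℂ) * f (1 + p) (τ * a) *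
      ((a:ℂ) ^ p / (p.factorial : ℂ))) (Ioi 0) := by
    intro p _
    have := (H.fkint (1 + p) p τ hτ).const_mul ((coreD (2 * A + ν) ν p : ℂ) / p.factorial)
    refine this.congr (Eventually.of_forall fun a => ?_)
    simp only
    ring
  have e : scalK h τ - f 0 0 * ((∑ p ∈ Finset.range (m + 2), coreD (2 * A + ν) ν p * (τ⁻¹) ^ (p+1) : ℝ) : ℂ)
    = ∫ a in Ioi (0:ℝ), (h 1 a (τ * a) - ∑ p ∈ Finset.range (m + 2), (coreD (2 * A + ν) ν p : ℂ) * f (1 + p) (τ * a) *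
      ((a:ℂ) ^ p / (p.factorial : ℂ))) := by
    rw [integral_sub i0 (integrable_finsetSum _ i1), integral_finsetSum _ i1, scalK]
    congr 1
    push_cast
    rw [Finset.mul_sum]
    refine Finset.sum_congr rfl fun p _ => ?_
    have := H.fmom p 0 τ hτ
    have e2 : ∫ a in Ioi (0:ℝ), (coreD (2 * A + ν) ν p : ℂ) * f (1 + p) (τ * a) *
      ((a:ℂ) ^ p / (p.factorial : ℂ)) = ((coreD (2 * A + ν) ν p : ℂ) / p.factorial) *
        ∫ a in Ioi (0:ℝ), (a:ℂ) ^ p * f (0 + p + 1) (τ * a) := by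
      rw [← integral_const_mul]
      congr 1
      funext a
      rw [show 0 + p + 1 = 1 + p by omega]
      ring
    rw [e2, this]
    have : (p.factorial : ℂ) ≠ 0 := by exact_mod_cast p.factorial_ne_zero
    field_simp
  rw [e]
  have : ‖∫ a in Ioi (0:ℝ), (h 1 a (τ * a) - ∑ p ∈ Finset.range (m + 2), (coreD (2 * A + ν) ν p : ℂ) * f (1 + p) (τ * a) *
      ((a:ℂ) ^ p / (p.factorial : ℂ)))‖ ≤ ∫ a in Ioi (0:ℝ), C * (τ⁻¹) ^ (m+2) * ((1 + τ * a) ^ 2)⁻¹ := by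
    refine norm_integral_le_of_norm_le ((core_decay_int τ hτ).const_mul _) ?_
    refine (ae_restrict_iff' measurableSet_Ioi).2 (Eventually.of_forall fun a ha => ?_)
    have ha : 0 < a := ha
    have e3 := hC a (τ * a) ha (by positivity)
    have hp : 0 < (1 + τ * a) ^ (m + 4) := by positivity
    have e4 := core_wt (x := ((1 + τ * a) ^ (m+4))⁻¹) (C := 1) hτ ha (m+2) 2 (by
      rw [show 2 + (m + 2) = m + 4 by omega, mul_inv_cancel₀ hp.ne']) (by positivity)
    rw [mul_comm, ← le_div_iff₀ hp] at e3
    refine e3.trans ?_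
    calc _ = C * (a ^ (m + 2) * ((1 + τ * a) ^ (m+4))⁻¹) := by rw [div_eq_mul_inv]; ring
      _ ≤ C * (1 * (τ⁻¹) ^ (m+2) * ((1 + τ * a) ^ 2)⁻¹) := by gcongr
      _ = _ := by ring
  rw [integral_const_mul, core_decay_intval τ hτ] at this
  refine this.trans (le_of_eq (by ring))
end

end

section

section
variable {h : ℕ → ℝ → ℝ → ℂ} {f : ℕ → ℝ → ℂ} {ν A : ℝ} {m : ℕ}

def scalN (h : ℕ → ℝ → ℝ → ℂ) (f : ℕ → ℝ → ℂ) (ν A : ℝ) (m : ℕ) (τ : ℝ) : ℂ :=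
  scalK h τ - f 0 0 * (coreS A ν (m + 2) τ : ℂ)

theorem ScalHyp.Nasymp (H : ScalHyp h f ν A m) : ∃ C, 0 ≤ C ∧ ∀ τ, 1 ≤ τ →
    ‖scalN h f ν A m τ‖ ≤ C * (τ⁻¹) ^ (m + 3) := by
  obtain ⟨C1, h1, hC1⟩ := H.Kasymp
  obtain ⟨C2, h2, hC2⟩ := coreTab_asymp A ν (m + 2) 0
  refine ⟨C1 + ‖f 0 0‖ * C2, by positivity, fun τ hτ => ?_⟩
  have e1 := hC1 τ (by linarith)
  have e2 := hC2 τ hτ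
  have e : scalN h f ν A m τ = (scalK h τ - f 0 0 * ((∑ p ∈ Finset.range (m + 2), coreD (2 * A + ν) ν p * (τ⁻¹) ^ (p+1) : ℝ) : ℂ))
    + f 0 0 * ((∑ p ∈ Finset.range (m + 2), coreTab A ν p 0 * (τ⁻¹) ^ (p+1) - ∑ p ∈ Finset.range (m + 2), coreEta A ν (0 + p) * ((τ+1)⁻¹) ^ (p+1) : ℝ) : ℂ) := by
    have : ∑ p ∈ Finset.range (m + 2), coreD (2 * A + ν) ν p * (τ⁻¹) ^ (p+1) = ∑ p ∈ Finset.range (m + 2), coreTab A ν p 0 * (τ⁻¹) ^ (p+1) :=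
      Finset.sum_congr rfl fun p _ => by rw [coreTab_eq A ν H.hne p]
    rw [this]
    simp only [scalN, coreS, zero_add]
    rw [Complex.ofReal_sub]
    ring
  rw [e]
  refine (norm_add_le _ _).trans ?_
  rw [norm_mul, Complex.norm_real, Real.norm_eq_abs, add_mul, mul_assoc]
  gcongr

def scalM (h : ℕ → ℝ → ℝ → ℂ) (f : ℕ → ℝ → ℂ) (ν A : ℝ) (m : ℕ) (τ : ℝ) : ℂ :=
  (((τ + 1) ^ (1 - A) * (τ - 1) ^ (ν + A + 1) : ℝ) : ℂ) * scalN h f ν A m τ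

theorem ScalHyp.Md (H : ScalHyp h f ν A m) (τ : ℝ) (hτ : 1 < τ) :
    HasDerivAt (scalM h f ν A m) ((-(2 * ((m + 1 : ℝ) + A) * coreEta A ν (m + 1)) : ℝ) * f 0 0 *
      (((τ + 1) ^ (-A) * (τ - 1) ^ (ν + A) * ((τ + 1)⁻¹) ^ (m + 2) : ℝ) : ℂ)) τ := by
  have p1 : 0 < τ + 1 := by linarith
  have p2 : 0 < τ - 1 := by linarith
  have d1 : HasDerivAt (fun x : ℝ => (x + 1) ^ (1 - A)) ((1 - A) * (τ + 1) ^ (-A)) τ := by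
    have := ((hasDerivAt_id τ).add_const 1).rpow_const (p := 1 - A) (Or.inl p1.ne')
    refine this.congr_deriv ?_
    rw [show 1 - A - 1 = -A by ring]
    simp
  have d2 : HasDerivAt (fun x : ℝ => (x - 1) ^ (ν + A + 1)) ((ν + A + 1) * (τ - 1) ^ (ν + A)) τ := by
    have := ((hasDerivAt_id τ).sub_const 1).rpow_const (p := ν + A + 1) (Or.inl p2.ne')
    refine this.congr_deriv ?_
    rw [show ν + A + 1 - 1 = ν + A by ring]
    simp
  have dS := (coreS_deriv A ν (m + 2) τ (by linarith)).ofReal_comp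
  have dN : HasDerivAt (scalN h f ν A m) (scalK' h τ - f 0 0 * (coreS' A ν (m+2) τ : ℂ)) τ :=
    (H.Kd τ (by linarith)).sub (dS.const_mul _)
  have := ((d1.mul d2).ofReal_comp).mul dN
  refine this.congr_deriv ?_
  have o1 := H.Kode τ (by linarith)
  have o2 := coreS_ode A ν H.hne (m + 1) τ (by linarith)
  have o2' : ((τ:ℂ) ^ 2 - 1) * coreS' A ν (m+2) τ + ((ν + 2) * τ + (2 * A + ν)) * coreS A ν (m + 2) τ
    = (1 + ν) + 2 * ((m + 1) + A) * coreEta A ν (m+1) * ((((τ+1)⁻¹) ^ (m + 2) : ℝ):ℂ) := by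
    have := congrArg (fun x : ℝ => (x : ℂ)) o2
    push_cast at this ⊢
    exact this
  rw [Pi.mul_apply, show (τ + 1) ^ (1 - A) = (τ + 1) ^ (-A) * (τ + 1) by
    rw [show 1 - A = -A + 1 by ring, Real.rpow_add_one p1.ne'],
    show (τ - 1) ^ (ν + A + 1) = (τ - 1) ^ (ν + A) * (τ - 1) by
    rw [Real.rpow_add_one p2.ne']]
  unfold scalN
  generalize (τ + 1) ^ (-A) = P
  generalize (τ - 1) ^ (ν + A) = Q
  generalize ((τ+1)⁻¹) ^ (m + 2) = R at o2' ⊢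
  push_cast at o1 o2' ⊢
  linear_combination (P:ℂ) * Q * o1 - (P:ℂ) * Q * f 0 0 * o2'

theorem ScalHyp.Mlim1 (H : ScalHyp h f ν A m) : Tendsto (scalM h f ν A m) (𝓝[>] 1) (𝓝 0) := by
  have hν := H.hν
  have hA := H.hA
  have dN : Tendsto (scalN h f ν A m) (𝓝[>] 1) (𝓝 (scalN h f ν A m 1)) := by
    have : ContinuousAt (scalN h f ν A m) 1 :=
      (H.Kd 1 one_pos).continuousAt.sub
        (continuousAt_const.mul (coreS_deriv A ν (m + 2) 1 one_pos).ofReal_comp.continuousAt)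
    exact this.tendsto.mono_left nhdsWithin_le_nhds
  have dP : Tendsto (fun τ : ℝ => (((τ + 1) ^ (1 - A) * (τ - 1) ^ (ν + A + 1) : ℝ) : ℂ)) (𝓝[>] 1) (𝓝 0) := by
    have c : ContinuousAt (fun τ : ℝ => (((τ + 1) ^ (1 - A) * (τ - 1) ^ (ν + A + 1) : ℝ) : ℂ)) 1 := by
      refine Complex.continuous_ofReal.continuousAt.comp (ContinuousAt.mul ?_ ?_)
      · exact ContinuousAt.rpow_const (by fun_prop) (Or.inl (by norm_num))
      · exact ContinuousAt.rpow_const (by fun_prop) (Or.inr (by positivity))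
    have := c.tendsto.mono_left (nhdsWithin_le_nhds (s := Ioi 1))
    rwa [sub_self, Real.zero_rpow (by positivity), mul_zero, Complex.ofReal_zero] at this
  have := dP.mul dN
  rw [zero_mul] at this
  exact this

theorem ScalHyp.MlimT (H : ScalHyp h f ν A m) : Tendsto (scalM h f ν A m) atTop (𝓝 0) := by
  have hν := H.hν
  have hA := H.hA
  obtain ⟨C, h0, hC⟩ := H.Nasymp
  refine squeeze_zero_norm' (a := fun τ : ℝ => C * 2 ^ (m + 3) * (τ + 1) ^ (-(m + 1 - ν))) ?_ ?_
  · filter_upwards [eventually_gt_atTop 1] with τ hτ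
    have p1 : 0 < τ + 1 := by linarith
    have p2 : 0 < τ - 1 := by linarith
    unfold scalM
    rw [norm_mul, Complex.norm_real, Real.norm_of_nonneg (by positivity)]
    have e1 : (τ - 1) ^ (ν + A + 1) ≤ (τ + 1) ^ (ν + A + 1) :=
      Real.rpow_le_rpow p2.le (by linarith) (by positivity)
    have e2 : (τ⁻¹) ^ (m + 3) ≤ 2 ^ (m + 3) * ((τ + 1)⁻¹) ^ (m + 3) := by
      rw [← mul_pow]
      have : τ⁻¹ ≤ 2 * (τ + 1)⁻¹ := by
        rw [← div_eq_mul_inv, le_div_iff₀ p1, inv_mul_le_iff₀ (by linarith)]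
        linarith
      gcongr
    have e3 : ((τ + 1)⁻¹) ^ (m + 3) = (τ + 1) ^ (-((m:ℝ) + 3)) := by
      rw [Real.rpow_neg p1.le, inv_pow]
      norm_cast
    calc _ ≤ ((τ + 1) ^ (1 - A) * (τ + 1) ^ (ν + A + 1)) * (C * (2 ^ (m + 3) * ((τ + 1)⁻¹) ^ (m + 3))) := by
          gcongr
          exact (hC τ hτ.le).trans (by gcongr)
      _ = C * 2 ^ (m + 3) * ((τ + 1) ^ (1 - A) * (τ + 1) ^ (ν + A + 1) * (τ + 1) ^ (-((m:ℝ) + 3))) := by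
          rw [e3]; ring
      _ = _ := by
          rw [← Real.rpow_add p1, ← Real.rpow_add p1]
          congr 2
          ring
  · have hm := H.hm
    have : Tendsto (fun τ : ℝ => τ + 1) atTop atTop := tendsto_atTop_add_const_right _ _ tendsto_id
    have := ((tendsto_rpow_neg_atTop (y := m + 1 - ν) (by linarith)).comp this).const_mul (C * 2 ^ (m + 3))
    simpa using this

theorem ScalHyp.main (H : ScalHyp h f ν A m) : f 0 0 = 0 := by
  by_contra hf
  have hν := H.hν
  have hA := H.hA
  set c : ℝ := -(2 * ((m + 1 : ℝ) + A) * coreEta A ν (m + 1)) with hc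
  have hc0 : c ≠ 0 := by
    have := coreEta_ne A ν H.hA H.hne (m + 1)
    rw [hc]
    refine neg_ne_zero.2 (mul_ne_zero (by positivity) this)
  have hcf : (c:ℂ) * f 0 0 ≠ 0 := mul_ne_zero (by exact_mod_cast hc0) hf
  set R : ℝ → ℝ := fun τ => (((c:ℂ) * f 0 0)⁻¹ * scalM h f ν A m τ).re with hR
  have dR : ∀ τ, 1 < τ → HasDerivAt R ((τ + 1) ^ (-A) * (τ - 1) ^ (ν + A) * ((τ + 1)⁻¹) ^ (m + 2)) τ := by
    intro τ hτ
    have := ((H.Md τ hτ).const_mul (((c:ℂ) * f 0 0)⁻¹))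
    rw [← hc, ← mul_assoc, inv_mul_cancel₀ hcf, one_mul] at this
    have := (Complex.reCLM.hasFDerivAt.comp_hasDerivAt τ this)
    refine this.congr_deriv ?_
    rw [Complex.reCLM_apply, Complex.ofReal_re]
  have mono : StrictMonoOn R (Ioi 1) := by
    refine strictMonoOn_of_deriv_pos (convex_Ioi 1) (fun τ hτ => (dR τ hτ).continuousAt.continuousWithinAt) ?_
    intro τ hτ
    rw [interior_Ioi] at hτ
    rw [(dR τ hτ).deriv]
    have hτ : 1 < τ := hτ
    have p1 : 0 < τ + 1 := by linarith
    have p2 : 0 < τ - 1 := by linarith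
    positivity
  have lim : ∀ {l : Filter ℝ}, Tendsto (scalM h f ν A m) l (𝓝 0) → Tendsto R l (𝓝 0) := by
    intro l hl
    have := (Complex.continuous_re.tendsto 0).comp (by simpa using hl.const_mul (((c:ℂ) * f 0 0)⁻¹))
    simpa [hR, Function.comp_def] using this
  have a1 : 0 ≤ R 2 := by
    refine le_of_tendsto (lim H.Mlim1) ?_
    filter_upwards [self_mem_nhdsWithin, mem_nhdsWithin_of_mem_nhds (gt_mem_nhds (show (1:ℝ) < 2 by norm_num))] with τ h1 h2
    exact (mono h1 (by simp) h2).le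
  have a2 : R 3 ≤ 0 := by
    refine ge_of_tendsto (lim H.MlimT) ?_
    filter_upwards [eventually_gt_atTop 3] with τ h2
    exact (mono (by simp) (by simp; linarith) h2).le
  have a3 : R 2 < R 3 := mono (by simp) (by simp) (by norm_num)
  linarith
end

end

section

structure FamHyp {V : Type*} [AddCommGroup V] [Module ℂ V] [TopologicalSpace V]
    (L T : V →ₗ[ℂ] V) (e : ℕ → ℝ → V) (b : ℝ) : Prop where
  eL : ∀ j s, 0 ≤ s → L (e j s) = (b:ℂ) • e (j+1) s
  eT : ∀ j s, 0 ≤ s → T (e j s) = - e (j+2) s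
  decay : ∀ q : Seminorm ℂ V, Continuous q → ∀ j N : ℕ, ∃ C, 0 ≤ C ∧ ∀ s, 0 ≤ s →
    (1 + s) ^ N * q (e j s) ≤ C
  taylor : ∀ q : Seminorm ℂ V, Continuous q → ∀ j : ℕ, ∃ C, 0 ≤ C ∧ ∀ s s', 0 ≤ s → 0 ≤ s' →
    q (e j s' - e j s + ((s' - s : ℝ) : ℂ) • e (j+1) s) ≤ C * (s' - s) ^ 2

section
variable {V : Type*} [AddCommGroup V] [Module ℂ V] [TopologicalSpace V]
variable {L T : V →ₗ[ℂ] V} {g : ℝ → V →ₗ[ℂ] ℂ} {f : V →ₗ[ℂ] ℂ} {gd : ℕ → ℝ → V → ℂ}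
    {D : Set V} {ν α : ℝ} {m : ℕ} {e : ℕ → ℝ → V} {b : ℝ}

theorem FamHyp.coreF_apply (E : FamHyp L T e b) (p : ℕ) (j : ℕ) (s : ℝ) (hs : 0 ≤ s) :
    coreF L T f ν α p (e j s) = (coreD (α * b) ν p : ℂ) * f (e (j + p) s) := by
  induction p using Nat.strong_induction_on generalizing j with
  | _ p ih =>
    cases p with
    | zero => rw [coreF_zero, coreD_zero]; simp
    | succ p =>
      rw [coreF_succ, coreD_succ, E.eL j s hs, E.eT j s hs, map_smul, map_neg, smul_eq_mul,
        ih p (by omega), ih (p-1) (by omega)]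
      cases p with
      | zero => push_cast; simp; ring
      | succ p =>
        rw [Nat.add_sub_cancel, show j + 1 + (p + 1) = j + (p + 1 + 1) by omega,
          show j + 2 + p = j + (p + 1 + 1) by omega]
        push_cast
        ring

theorem FamHyp.scal_decay (E : FamHyp L T e b) {F : V → ℝ} (hF : SBd F) (j N : ℕ) :
    ∃ C, 0 ≤ C ∧ ∀ s, 0 ≤ s → (1 + s) ^ N * F (e j s) ≤ C := by
  obtain ⟨q, hq, h⟩ := hF
  obtain ⟨C, h0, hC⟩ := E.decay q hq j N
  refine ⟨C, h0, fun s hs => le_trans ?_ (hC s hs)⟩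
  gcongr
  exact h _

theorem core_main [IsTopologicalAddGroup V] (h : CoreHyp L T g f gd D ν α m) (E : FamHyp L T e b)
    {A : ℝ} (hA : 0 < A) (hb : α * b = 2 * A + ν) : f (e 0 0) = 0 := by
  have hν := h.hν
  have hft : ∀ j : ℕ, ∃ C, 0 ≤ C ∧ ∀ s s' : ℝ, 0 ≤ s → 0 ≤ s' →
      ‖f (e j s') - f (e j s) + ((s' - s : ℝ) : ℂ) * f (e (j+1) s)‖ ≤ C * (s' - s) ^ 2 := by
    intro j
    obtain ⟨q, hq, h'⟩ := h.fbd
    obtain ⟨C, h0, hC⟩ := E.taylor q hq j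
    refine ⟨C, h0, fun s s' hs hs' => le_trans ?_ (hC s s' hs hs')⟩
    have := h' (e j s' - e j s + ((s' - s : ℝ) : ℂ) • e (j+1) s)
    simpa only [map_add, map_sub, map_smul, smul_eq_mul] using this
  by_cases hmeq : (m:ℝ) = ν
  · -- integer case
    have hz : ∀ s, 0 ≤ s → ∀ j, f (e (m + 1 + j) s) = 0 := by
      intro s hs j
      have := h.integer_case hmeq (e j s)
      rw [E.eL j s hs, E.eT j s hs, map_smul, map_neg, smul_eq_mul, E.coreF_apply _ _ _ hs,
        E.coreF_apply _ _ _ hs] at this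
      have hne := coreD_int_ne (α * b) m (by rw [hb, hmeq]; linarith)
      have e1 : (m:ℂ) * ((coreD (α * b) ν (m-1) : ℂ) * f (e (j + 2 + (m-1)) s)) =
        (m:ℂ) * ((coreD (α * b) ν (m-1) : ℂ) * f (e (m + 1 + j) s)) := by
        cases m with
        | zero => simp
        | succ m => rw [show j + 2 + (m + 1 - 1) = m + 1 + 1 + j by omega]
      rw [mul_neg, sub_neg_eq_add, e1, show j + 1 + m = m + 1 + j by omega] at this
      have h2 : ((α * b * coreD (α * b) m m + m * coreD (α * b) m (m-1) : ℝ) : ℂ) * f (e (m + 1 + j) s) = 0 := by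
        rw [← this, ← hmeq]
        push_cast
        ring
      exact (mul_eq_zero.1 h2).resolve_left (by exact_mod_cast hne)
    have step : ∀ j, (∀ s, 0 ≤ s → f (e (j+1) s) = 0) → ∀ s, 0 ≤ s → f (e j s) = 0 := by
      intro j hj
      obtain ⟨C, h0, hC⟩ := hft j
      have hc : ContinuousOn (fun s => f (e j s)) (Ici 0) :=
        core_cont_of_taylor (u1 := fun s => f (e (j+1) s)) hC
      have hd : ∀ s, 0 < s → HasDerivAt (fun s => f (e j s)) 0 s := by
        intro s hs
        have := core_deriv_of_taylor (u := fun s => f (e j s)) (u1 := f (e (j+1) s)) hs (C := C)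
          fun s' hs' => hC s s' hs.le hs'
        rwa [hj s hs.le, neg_zero] at this
      obtain ⟨C2, h2, hC2⟩ := E.scal_decay h.fbd j 1
      have hlim : Tendsto (fun s => f (e j s)) atTop (𝓝 0) := by
        refine core_decay_lim (C := C2) (τ := 1) one_pos fun a ha => ?_
        have := hC2 a ha.le
        rw [pow_one, mul_comm] at this
        rw [← div_eq_mul_inv, le_div_iff₀ (by positivity), one_mul]
        exact this
      intro s hs
      have hconst := core_const_of_deriv_zero hd (l := f (e j 0)) ((hc 0 self_mem_Ici).tendsto.mono_left (nhdsWithin_mono _ Ioi_subset_Ici_self))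
      have hz0 : f (e j 0) = 0 := by
        refine tendsto_nhds_unique (tendsto_const_nhds.congr' ?_) hlim
        filter_upwards [eventually_gt_atTop 0] with x hx
        exact (hconst x hx).symm
      rcases hs.eq_or_lt with rfl | hs
      · exact hz0
      · rw [hconst s hs, hz0]
    have all : ∀ i ≤ m + 1, ∀ s, 0 ≤ s → f (e (m + 1 - i) s) = 0 := by
      intro i
      induction i with
      | zero => intro _ s hs; simpa using hz s hs 0
      | succ i ih =>
        intro hi
        refine step _ ?_
        rw [show m + 1 - (i + 1) + 1 = m + 1 - i by omega]
        exact ih (by omega)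
    simpa using all (m+1) le_rfl 0 le_rfl
  · have hne : ∀ q : ℕ, (q:ℝ) ≠ ν := by
      intro q hq
      apply hmeq
      rw [h.hm, ← hq, Nat.floor_natCast]
    obtain ⟨q0, hq0, hbd⟩ := h.bdd
    have key : ScalHyp (fun j a s => g a (e j s)) (fun j s => f (e j s)) ν A m := by
      refine ⟨hν, hA, by rw [h.hm]; exact Nat.lt_floor_add_one ν, hne, ?_, ?_, ?_, hft, ?_, ?_⟩
      · intro j N
        obtain ⟨C, h0, hC⟩ := E.decay q0 hq0 j N
        refine ⟨C, h0, fun a s ha hs => le_trans ?_ (hC s hs)⟩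
        gcongr
        exact hbd a ha _
      · intro j N
        exact E.scal_decay h.fbd j N
      · intro j
        obtain ⟨C, h0, hC⟩ := E.taylor q0 hq0 j
        refine ⟨C, h0, fun a s s' ha hs hs' => le_trans ?_ (hC s s' hs hs')⟩
        have := hbd a ha (e j s' - e j s + ((s' - s : ℝ) : ℂ) • e (j+1) s)
        simpa only [map_add, map_sub, map_smul, smul_eq_mul] using this
      · intro j a s ha hs
        refine (h.deriv_g (e j s) a ha).congr_deriv ?_
        unfold coreG1 coreI coreE
        simp only [E.eL j s hs, E.eT j s hs, map_smul, map_neg, smul_eq_mul]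
        rw [← hb]
        congr 3
        funext x
        push_cast
        ring
      · intro j N
        obtain ⟨q, hq, hrem⟩ := h.remainder hne
        obtain ⟨C, h0, hC⟩ := E.decay q hq j N
        refine ⟨C, h0, fun a s ha hs => ?_⟩
        have := hrem (e j s) a ha
        simp only [E.coreF_apply _ _ _ hs, hb] at this
        calc _ ≤ (1 + s) ^ N * (q (e j s) * a ^ (m+2)) := by gcongr
          _ = ((1 + s) ^ N * q (e j s)) * a ^ (m + 2) := by ring
          _ ≤ _ := by gcongr; exact hC s hs
    exact key.main
end

end

section

open scoped SchwartzMap ContDiff in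
theorem schwartz_dense_compact (E : Type) [NormedAddCommGroup E] [NormedSpace ℝ E]
    [FiniteDimensional ℝ E] : Dense {φ : 𝓢(E, ℂ) | HasCompactSupport φ} := by
  let χ : ContDiffBump (0:E) := ⟨1, 2, one_pos, by norm_num⟩
  let c : E → ℂ := fun x => ((χ x : ℝ) : ℂ)
  have hc : ContDiff ℝ ∞ c := Complex.ofRealCLM.contDiff.comp χ.contDiff
  have hcs : HasCompactSupport c := χ.hasCompactSupport.comp_left (g := fun x : ℝ => (x:ℂ)) (by simp)
  let u : ℕ → E → ℂ := fun R x => c (((R:ℝ) + 1)⁻¹ • x)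
  have hu : ∀ R, ContDiff ℝ ∞ (u R) := fun R => hc.comp (contDiff_const_smul _)
  have hus : ∀ R, HasCompactSupport (u R) := by
    intro R
    exact hcs.comp_homeomorph (Homeomorph.smulOfNeZero (((R:ℝ) + 1)⁻¹) (by positivity))
  have hbd : ∀ i, ∃ C, ∀ R x, ‖iteratedFDeriv ℝ i (u R) x‖ ≤ C := by
    intro i
    obtain ⟨C, hC⟩ := (hcs.iteratedFDeriv (𝕜 := ℝ) i).exists_bound_of_continuous
      (hc.continuous_iteratedFDeriv (m := i) (by exact_mod_cast le_top))
    refine ⟨C, fun R x => ?_⟩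
    let g : E →L[ℝ] E := ((R:ℝ) + 1)⁻¹ • ContinuousLinearMap.id ℝ E
    have e : u R = c ∘ g := by
      funext x
      simp [u, g]
    rw [e, g.iteratedFDeriv_comp_right hc x (by exact_mod_cast le_top)]
    refine (ContinuousMultilinearMap.norm_compContinuousLinearMap_le _ _).trans ?_
    have hC0 : 0 ≤ C := (norm_nonneg _).trans (hC 0)
    have hg : ‖g‖ ≤ 1 := by
      refine ContinuousLinearMap.opNorm_le_bound _ zero_le_one fun y => ?_
      simp only [g, smul_apply, ContinuousLinearMap.id_apply, norm_smul]
      rw [Real.norm_of_nonneg (by positivity)]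
      have : ((R:ℝ) + 1)⁻¹ ≤ 1 := inv_le_one_of_one_le₀ (by have : (0:ℝ) ≤ R := R.cast_nonneg; linarith)
      gcongr
    calc _ ≤ C * ∏ _j : Fin i, (1:ℝ) := by
          gcongr
          exact hC _
      _ = C := by simp
  intro φ
  let φR : ℕ → 𝓢(E, ℂ) := fun R => (HasCompactSupport.mul_right (f' := φ) (hus R)).toSchwartzMap ((hu R).mul (φ.smooth _))
  have hφR : ∀ R x, φR R x = u R x * φ x := fun R x => rfl
  refine mem_closure_of_tendsto (b := atTop) (f := φR) ?_ (Eventually.of_forall fun R => ?_)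
  · rw [(schwartz_withSeminorms ℂ E ℂ).tendsto_nhds]
    rintro ⟨k, l⟩ ε hε
    choose C hC using hbd
    have hC0 : ∀ i, 0 ≤ C i := fun i => (norm_nonneg _).trans (hC i 0 0)
    have key : ∃ B, 0 ≤ B ∧ ∀ R, SchwartzMap.seminorm ℂ k l (φR R - φ) ≤ B * ((R:ℝ) + 1)⁻¹ := by
      let B : ℝ := ∑ i ∈ Finset.range (l+1), (l.choose i : ℝ) * (C i + 1) * SchwartzMap.seminorm ℂ (k+1) (l-i) φ
      have hB0 : 0 ≤ B := Finset.sum_nonneg fun i _ => by have := hC0 i; positivity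
      refine ⟨B, hB0, fun R => ?_⟩
      refine SchwartzMap.seminorm_le_bound ℂ k l _ (by positivity) fun x => ?_
      have e : ⇑(φR R - φ) = fun x => (u R x - 1) * φ x := by
        funext y
        rw [sub_apply, hφR]
        ring
      rw [e]
      have hR : (0:ℝ) < R + 1 := by positivity
      by_cases hx : ‖x‖ < R + 1
      · have : (fun x => (u R x - 1) * φ x) =ᶠ[𝓝 x] fun _ => 0 := by
          have : ∀ᶠ y in 𝓝 x, ‖y‖ < R + 1 := continuous_norm.continuousAt.eventually_lt continuousAt_const hx
          filter_upwards [this] with y hy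
          have : u R y = 1 := by
            simp only [u, c]
            rw [χ.one_of_mem_closedBall, Complex.ofReal_one]
            rw [mem_closedBall_zero_iff, norm_smul, Real.norm_of_nonneg (by positivity)]
            show _ ≤ (1:ℝ)
            rw [inv_mul_le_iff₀ hR]
            linarith
          rw [this]
          simp
        rw [Filter.EventuallyEq.eq_of_nhds (Filter.EventuallyEq.iteratedFDeriv ℝ this l)]
        rw [iteratedFDeriv_fun_zero]
        simp
        positivity
      · push Not at hx
        have hm := norm_iteratedFDeriv_mul_le (𝕜 := ℝ) (N := ∞) ((hu R).sub (contDiff_const (c := (1:ℂ)))) (φ.smooth ⊤) x (n := l)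
          (by exact_mod_cast le_top)
        have hu1 : ∀ i, ‖iteratedFDeriv ℝ i (fun x => u R x - 1) x‖ ≤ C i + 1 := by
          intro i
          have h1 := iteratedFDeriv_sub_apply (𝕜 := ℝ) (i := i) (x := x) ((hu R).of_le (m := i) (by exact_mod_cast le_top)).contDiffAt (contDiff_const (c := (1:ℂ))).contDiffAt
          have h2 : (fun x => u R x - 1) = u R - fun _ => (1:ℂ) := rfl
          rw [h2, h1]
          refine (norm_sub_le _ _).trans (add_le_add (hC i R x) ?_)
          cases i with
          | zero => simp
          | succ i => rw [iteratedFDeriv_succ_const]; simp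
        have hk : ‖x‖ ^ k ≤ ((R:ℝ) + 1)⁻¹ * ‖x‖ ^ (k+1) := by
          rw [pow_succ, ← mul_assoc, mul_comm, ← mul_assoc]
          refine le_mul_of_one_le_left (by positivity) ?_
          rw [← div_eq_mul_inv, le_div_iff₀ hR]
          linarith
        calc ‖x‖ ^ k * ‖iteratedFDeriv ℝ l (fun x => (u R x - 1) * φ x) x‖
            ≤ (((R:ℝ) + 1)⁻¹ * ‖x‖ ^ (k+1)) * ∑ i ∈ Finset.range (l+1), (l.choose i : ℝ) * ‖iteratedFDeriv ℝ i (fun x => u R x - 1) x‖ * ‖iteratedFDeriv ℝ (l-i) φ x‖ := by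
              gcongr
          _ ≤ (((R:ℝ) + 1)⁻¹ * ‖x‖ ^ (k+1)) * ∑ i ∈ Finset.range (l+1), (l.choose i : ℝ) * (C i + 1) * ‖iteratedFDeriv ℝ (l-i) φ x‖ := by
              gcongr with i _
              exact hu1 i
          _ = (∑ i ∈ Finset.range (l+1), (l.choose i : ℝ) * (C i + 1) * (‖x‖ ^ (k+1) * ‖iteratedFDeriv ℝ (l-i) φ x‖)) * ((R:ℝ) + 1)⁻¹ := by
              rw [mul_assoc, mul_comm _ (((R:ℝ) + 1)⁻¹), Finset.mul_sum]
              congr 1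
              refine Finset.sum_congr rfl fun i _ => by ring
          _ ≤ _ := by
              refine mul_le_mul_of_nonneg_right ?_ (by positivity)
              refine Finset.sum_le_sum fun i _ => ?_
              have := hC0 i
              refine mul_le_mul_of_nonneg_left ?_ (by positivity)
              exact SchwartzMap.le_seminorm ℂ (k+1) (l-i) φ x
    obtain ⟨B, hB0, hB⟩ := key
    have lim : Tendsto (fun R : ℕ => B * ((R:ℝ) + 1)⁻¹) atTop (𝓝 0) := by
      have := (tendsto_inv_atTop_zero.comp (tendsto_atTop_add_const_right _ (1:ℝ) (tendsto_natCast_atTop_atTop (R := ℝ)))).const_mul B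
      simpa using this
    filter_upwards [lim.eventually (gt_mem_nhds hε)] with R hR
    exact (hB R).trans_lt hR
  · exact HasCompactSupport.mul_right (f' := φ) (hus R)

end

section

open scoped SchwartzMap ContDiff LineDeriv

instance instHaarHn (n : ℕ) : (volume : Measure (Hn n)).IsAddHaarMeasure := by
  have h1 : (volume : Measure (Fin n → ℂ)).IsAddHaarMeasure := inferInstance
  have h2 : (volume : Measure ℝ).IsAddHaarMeasure := inferInstance
  rw [Measure.volume_eq_prod]
  exact Measure.prod.instIsAddHaarMeasure _ _

/-- coefficient of ∂_t in X_j -/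
def cX (n : ℕ) (j : Fin n) (p : Hn n) : ℂ := 2 * ((p.1 j).im : ℂ)
def cY (n : ℕ) (j : Fin n) (p : Hn n) : ℂ := -(2 * ((p.1 j).re : ℂ))

/-- the first order operator `∂_v + c ∂_t` -/
def POp (n : ℕ) (v : Hn n) (c : Hn n → ℂ) (f : Hn n → ℂ) (p : Hn n) : ℂ :=
  dirD v f p + c p * dirD (eT n) f p

theorem XH_eq (n : ℕ) (j : Fin n) : XH n j = POp n (eX n j) (cX n j) := by
  funext f p; simp only [XH, POp, cX]

theorem YH_eq (n : ℕ) (j : Fin n) : YH n j = POp n (eY n j) (cY n j) := by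
  funext f p; simp only [YH, POp, cY]; ring

theorem POp_zero_coeff (n : ℕ) : TH n = POp n (eT n) (fun _ => 0) := by
  funext f p; simp only [TH, POp]; ring

def imL (n : ℕ) (j : Fin n) : Hn n →L[ℝ] ℝ :=
  Complex.imCLM ∘L (ContinuousLinearMap.proj j) ∘L ContinuousLinearMap.fst ℝ (Fin n → ℂ) ℝ
def reL (n : ℕ) (j : Fin n) : Hn n →L[ℝ] ℝ :=
  Complex.reCLM ∘L (ContinuousLinearMap.proj j) ∘L ContinuousLinearMap.fst ℝ (Fin n → ℂ) ℝ

structure GoodC (n : ℕ) (c : Hn n → ℂ) : Prop where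
  lin : ∃ l : Hn n →L[ℝ] ℂ, c = l
  inv : ∀ l : Hn n →L[ℝ] ℂ, c = l → l (eT n) = 0

theorem GoodC.tg {n : ℕ} {c : Hn n → ℂ} (h : GoodC n c) : c.HasTemperateGrowth := by
  obtain ⟨l, rfl⟩ := h.lin
  exact l.hasTemperateGrowth

theorem GoodC.smooth {n : ℕ} {c : Hn n → ℂ} (h : GoodC n c) : ContDiff ℝ ∞ c := by
  obtain ⟨l, rfl⟩ := h.lin
  exact l.contDiff

theorem GoodC.fderiv {n : ℕ} {c : Hn n → ℂ} (h : GoodC n c) (p : Hn n) :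
    fderiv ℝ c p (eT n) = 0 := by
  obtain ⟨l, hl⟩ := h.lin
  have := h.inv l hl
  rw [hl, ContinuousLinearMap.fderiv, this]

theorem goodC_X (n : ℕ) (j : Fin n) : GoodC n (cX n j) := by
  have : cX n j = ((2:ℂ) • (Complex.ofRealCLM ∘L imL n j) : Hn n →L[ℝ] ℂ) := by
    funext p; simp [cX, imL]
  refine ⟨⟨_, this⟩, fun l hl => ?_⟩
  rw [← hl]; simp [cX, eT]

theorem goodC_Y (n : ℕ) (j : Fin n) : GoodC n (cY n j) := by
  have : cY n j = ((-2:ℂ) • (Complex.ofRealCLM ∘L reL n j) : Hn n →L[ℝ] ℂ) := by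
    funext p; simp [cY, reL]
  refine ⟨⟨_, this⟩, fun l hl => ?_⟩
  rw [← hl]; simp [cY, eT]

theorem goodC_zero (n : ℕ) : GoodC n (fun _ => 0) :=
  ⟨⟨0, rfl⟩, fun l hl => by rw [← hl]⟩

/-- the operator on Schwartz space -/
def PV (n : ℕ) (v : Hn n) (c : Hn n → ℂ) : 𝓢(Hn n, ℂ) →L[ℂ] 𝓢(Hn n, ℂ) :=
  LineDeriv.lineDerivOpCLM ℂ 𝓢(Hn n, ℂ) v +
    (SchwartzMap.smulLeftCLM ℂ c) ∘L (LineDeriv.lineDerivOpCLM ℂ 𝓢(Hn n, ℂ) (eT n))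

theorem PV_apply {n : ℕ} (v : Hn n) {c : Hn n → ℂ} (hc : GoodC n c) (φ : 𝓢(Hn n, ℂ)) :
    (PV n v c φ : Hn n → ℂ) = POp n v c φ := by
  funext p
  simp only [PV, add_apply,
    ContinuousLinearMap.comp_apply, SchwartzMap.smulLeftCLM_apply_apply hc.tg, POp, dirD,
    LineDeriv.lineDerivOpCLM_apply, SchwartzMap.lineDerivOp_apply_eq_fderiv, smul_eq_mul]

theorem POp_compact {n : ℕ} (v : Hn n) (c : Hn n → ℂ) {f : Hn n → ℂ} (hf : HasCompactSupport f) :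
    HasCompactSupport (POp n v c f) := by
  have h1 : HasCompactSupport (fun p => fderiv ℝ f p v) := hf.fderiv_apply (𝕜 := ℝ) v
  have h2 : HasCompactSupport (fun p => fderiv ℝ f p (eT n)) := hf.fderiv_apply (𝕜 := ℝ) (eT n)
  exact h1.add (h2.mul_left (f := c))

theorem dirD_smooth {E : Type} [NormedAddCommGroup E] [NormedSpace ℝ E] (v : E) {f : E → ℂ}
    (hf : ContDiff ℝ ∞ f) : ContDiff ℝ ∞ (dirD v f) :=
  (hf.fderiv_right (m := ∞) (by simp)).clm_apply contDiff_const

theorem POp_smooth {n : ℕ} (v : Hn n) {c : Hn n → ℂ} (hc : GoodC n c) {f : Hn n → ℂ}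
    (hf : ContDiff ℝ ∞ f) : ContDiff ℝ ∞ (POp n v c f) :=
  (dirD_smooth v hf).add (hc.smooth.mul (dirD_smooth _ hf))

theorem ibp_dir {n : ℕ} (v : Hn n) {G φ : Hn n → ℂ} (hG : ContDiff ℝ ∞ G) (hφ : ContDiff ℝ ∞ φ)
    (hc : HasCompactSupport φ) :
    ∫ w, dirD v G w * φ w = - ∫ w, G w * dirD v φ w := by
  have h := integral_mul_fderiv_eq_neg_fderiv_mul_of_integrable (μ := (volume : Measure (Hn n)))
    (f := φ) (g := G) (v := v) (𝕜 := ℂ) ?_ ?_ ?_ (fun x _ => hφ.differentiable (by simp) x) (fun x _ => hG.differentiable (by simp) x)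
  · simp only [dirD]
    rw [show (fun w => fderiv ℝ G w v * φ w) = fun w => φ w * fderiv ℝ G w v from by
      funext w; ring, h]
    congr 1; congr 1; funext w; ring
  · exact ((dirD_smooth v hφ).continuous.mul hG.continuous).integrable_of_hasCompactSupport
      ((hc.fderiv_apply (𝕜 := ℝ) v).mul_right)
  · exact (hφ.continuous.mul (dirD_smooth v hG).continuous).integrable_of_hasCompactSupport
      hc.mul_right
  · exact (hφ.continuous.mul hG.continuous).integrable_of_hasCompactSupport hc.mul_right

theorem ibp_POp {n : ℕ} (v : Hn n) {c : Hn n → ℂ} (hcc : GoodC n c) {G φ : Hn n → ℂ}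
    (hG : ContDiff ℝ ∞ G) (hφ : ContDiff ℝ ∞ φ) (hc : HasCompactSupport φ) :
    ∫ w, POp n v c G w * φ w = - ∫ w, G w * POp n v c φ w := by
  have h1 := ibp_dir v hG hφ hc
  have h2 := ibp_dir (eT n) hG (hcc.smooth.mul hφ) (hc.mul_left (f := c))
  have h3 : ∀ w, dirD (eT n) (fun w => c w * φ w) w = c w * dirD (eT n) φ w := by
    intro w
    simp only [dirD]
    rw [show (fun w => c w * φ w) = c * φ from rfl, fderiv_mul (hcc.smooth.differentiable (by simp) w) (hφ.differentiable (by simp) w)]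
    simp [hcc.fderiv]
  have i1 : Integrable (fun w => dirD v G w * φ w) :=
    ((dirD_smooth v hG).continuous.mul hφ.continuous).integrable_of_hasCompactSupport hc.mul_left
  have i2 : Integrable (fun w => dirD (eT n) G w * (c w * φ w)) :=
    ((dirD_smooth _ hG).continuous.mul (hcc.smooth.continuous.mul hφ.continuous)).integrable_of_hasCompactSupport
      (hc.mul_left (f := c)).mul_left
  have i3 : Integrable (fun w => G w * dirD v φ w) :=
    (hG.continuous.mul (dirD_smooth v hφ).continuous).integrable_of_hasCompactSupport
      (hc.fderiv_apply (𝕜 := ℝ) v).mul_left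
  have i4 : Integrable (fun w => G w * (c w * dirD (eT n) φ w)) :=
    (hG.continuous.mul (hcc.smooth.continuous.mul (dirD_smooth _ hφ).continuous)).integrable_of_hasCompactSupport
      ((hc.fderiv_apply (𝕜 := ℝ) (eT n)).mul_left (f := c)).mul_left
  calc ∫ w, POp n v c G w * φ w = ∫ w, (dirD v G w * φ w + dirD (eT n) G w * (c w * φ w)) := by
        congr 1; funext w; simp only [POp]; ring
    _ = (- ∫ w, G w * dirD v φ w) + - ∫ w, G w * (c w * dirD (eT n) φ w) := by
        rw [integral_add i1 i2, h1, h2]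
        simp only [h3]
    _ = - ∫ w, (G w * dirD v φ w + G w * (c w * dirD (eT n) φ w)) := by
        rw [integral_add i3 i4]; ring
    _ = _ := by
        congr 2; funext w; simp only [POp]; ring

theorem ibp_POp2 {n : ℕ} (v : Hn n) {c : Hn n → ℂ} (hcc : GoodC n c) {G φ : Hn n → ℂ}
    (hG : ContDiff ℝ ∞ G) (hφ : ContDiff ℝ ∞ φ) (hc : HasCompactSupport φ) :
    ∫ w, POp n v c (POp n v c G) w * φ w = ∫ w, G w * POp n v c (POp n v c φ) w := by
  rw [ibp_POp v hcc (POp_smooth v hcc hG) hφ hc,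
    ibp_POp v hcc hG (POp_smooth v hcc hφ) (POp_compact v c hc), neg_neg]

/-- `ℒ` on Schwartz space -/
def LV (n : ℕ) : 𝓢(Hn n, ℂ) →L[ℂ] 𝓢(Hn n, ℂ) :=
  (-(1/4) : ℂ) • ∑ j, (PV n (eX n j) (cX n j) ∘L PV n (eX n j) (cX n j) +
    PV n (eY n j) (cY n j) ∘L PV n (eY n j) (cY n j))

def TV (n : ℕ) : 𝓢(Hn n, ℂ) →L[ℂ] 𝓢(Hn n, ℂ) :=
  PV n (eT n) (fun _ => 0) ∘L PV n (eT n) (fun _ => 0)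

theorem LV_apply {n : ℕ} (φ : 𝓢(Hn n, ℂ)) (w : Hn n) : LV n φ w =
    -(1/4) * ∑ j, (XH n j (XH n j φ) w + YH n j (YH n j φ) w) := by
  simp only [LV, smul_apply, smul_eq_mul]
  congr 1
  rw [sum_apply, sum_apply]
  refine Finset.sum_congr rfl fun j _ => ?_
  simp only [add_apply, ContinuousLinearMap.comp_apply]
  rw [PV_apply _ (goodC_X n j), PV_apply _ (goodC_X n j), PV_apply _ (goodC_Y n j),
    PV_apply _ (goodC_Y n j), XH_eq, YH_eq]

theorem TV_apply {n : ℕ} (φ : 𝓢(Hn n, ℂ)) (w : Hn n) : TV n φ w = TH n (TH n φ) w := by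
  simp only [TV, ContinuousLinearMap.comp_apply]
  rw [PV_apply _ (goodC_zero n), PV_apply _ (goodC_zero n), POp_zero_coeff]

theorem TV_compact {n : ℕ} (φ : 𝓢(Hn n, ℂ)) (h : HasCompactSupport φ) :
    HasCompactSupport (TV n φ) := by
  rw [show (TV n φ : Hn n → ℂ) = TH n (TH n φ) from funext (TV_apply φ), POp_zero_coeff]
  exact POp_compact _ _ (POp_compact _ _ h)

theorem hasCompactSupport_sum {X ι : Type*} [TopologicalSpace X] (s : Finset ι) (f : ι → X → ℂ)
    (h : ∀ i ∈ s, HasCompactSupport (f i)) : HasCompactSupport (fun x => ∑ i ∈ s, f i x) := by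
  classical
  induction s using Finset.induction_on with
  | empty => simp only [Finset.sum_empty]; exact HasCompactSupport.zero
  | insert a s ha ih =>
    simp only [Finset.sum_insert ha]
    exact (h a (by simp)).add (ih fun i hi => h i (by simp [hi]))

theorem LV_compact {n : ℕ} (φ : 𝓢(Hn n, ℂ)) (h : HasCompactSupport φ) :
    HasCompactSupport (LV n φ) := by
  rw [show (LV n φ : Hn n → ℂ) = _ from funext (LV_apply φ)]
  refine HasCompactSupport.mul_left (f := fun _ => (-(1/4):ℂ)) (hasCompactSupport_sum _ _ fun j _ => ?_)
  rw [XH_eq, YH_eq]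
  exact (POp_compact _ _ (POp_compact _ _ h)).add (POp_compact _ _ (POp_compact _ _ h))

end

section

open scoped SchwartzMap ContDiff LineDeriv

def US (n : ℕ) : Set (Sg n) := {p : Sg n | 0 < p.2}

theorem US_open (n : ℕ) : IsOpen (US n) := isOpen_lt continuous_const continuous_snd

theorem dirD_smoothOn {n : ℕ} (v : Sg n) {G : Sg n → ℂ} (hG : ContDiffOn ℝ ∞ G (US n)) :
    ContDiffOn ℝ ∞ (dirD v G) (US n) :=
  (hG.fderiv_of_isOpen (m := ∞) (US_open n) (by simp)).clm_apply contDiffOn_const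

theorem DA_iter_smoothOn {n : ℕ} {F : Sg n → ℂ} (hF : ContDiffOn ℝ ∞ F (US n)) (p : ℕ) :
    ContDiffOn ℝ ∞ ((DA n)^[p] F) (US n) := by
  induction p with
  | zero => exact hF
  | succ p ih =>
    rw [Function.iterate_succ_apply']
    exact dirD_smoothOn _ ih

theorem slice_hasFDerivAt {n : ℕ} {G : Sg n → ℂ} (hG : ContDiffOn ℝ ∞ G (US n)) {a : ℝ} (ha : 0 < a)
    (w : Hn n) : HasFDerivAt (fun w => G (w, a))
      ((fderiv ℝ G (w, a)).comp (ContinuousLinearMap.inl ℝ (Hn n) ℝ)) w := by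
  have h1 : HasFDerivAt G (fderiv ℝ G (w, a)) (w, a) :=
    ((hG.contDiffAt ((US_open n).mem_nhds ha)).differentiableAt (by simp)).hasFDerivAt
  exact h1.comp w (hasFDerivAt_prodMk_left w a)

theorem slice_dirD {n : ℕ} {G : Sg n → ℂ} (hG : ContDiffOn ℝ ∞ G (US n)) {a : ℝ} (ha : 0 < a)
    (w v : Hn n) : dirD (v, (0:ℝ)) G (w, a) = dirD v (fun w => G (w, a)) w := by
  simp only [dirD]
  rw [(slice_hasFDerivAt hG ha w).fderiv]
  simp

theorem slice_smooth {n : ℕ} {G : Sg n → ℂ} (hG : ContDiffOn ℝ ∞ G (US n)) {a : ℝ} (ha : 0 < a) :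
    ContDiff ℝ ∞ (fun w => G (w, a)) := by
  rw [← contDiffOn_univ]
  exact hG.comp (contDiff_prodMk_left a).contDiffOn (fun w _ => ha)

theorem slice_a {n : ℕ} {G : Sg n → ℂ} (hG : ContDiffOn ℝ ∞ G (US n)) {a : ℝ} (ha : 0 < a)
    (w : Hn n) : HasDerivAt (fun x => G (w, x)) (DA n G (w, a)) a := by
  have h1 : HasFDerivAt G (fderiv ℝ G (w, a)) (w, a) :=
    ((hG.contDiffAt ((US_open n).mem_nhds ha)).differentiableAt (by simp)).hasFDerivAt
  have := (h1.comp a (hasFDerivAt_prodMk_right w a)).hasDerivAt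
  simpa [DA, dirD, eA, Function.comp_def] using this

theorem coeffS_smooth {n : ℕ} {c : Hn n → ℂ} (hc : GoodC n c) :
    ContDiffOn ℝ ∞ (fun p : Sg n => c p.1) (US n) :=
  (hc.smooth.comp contDiff_fst).contDiffOn

theorem slice_POp2 {n : ℕ} {v : Hn n} {c : Hn n → ℂ} (hc : GoodC n c)
    {P : (Sg n → ℂ) → (Sg n → ℂ)}
    (hP : ∀ G p, P G p = dirD (v, (0:ℝ)) G p + c p.1 * dirD (eT n, (0:ℝ)) G p)
    {F : Sg n → ℂ} (hF : ContDiffOn ℝ ∞ F (US n)) {a : ℝ} (ha : 0 < a) (w : Hn n) :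
    P (P F) (w, a) = POp n v c (POp n v c (fun w => F (w, a))) w := by
  have key : ∀ G : Sg n → ℂ, ContDiffOn ℝ ∞ G (US n) → ∀ w, P G (w, a) = POp n v c (fun w => G (w, a)) w := by
    intro G hG w
    rw [hP, POp, slice_dirD hG ha, slice_dirD hG ha]
  have hPF : ContDiffOn ℝ ∞ (P F) (US n) := by
    rw [show P F = _ from funext (hP F)]
    exact (dirD_smoothOn _ hF).add ((coeffS_smooth hc).mul (dirD_smoothOn _ hF))
  rw [key _ hPF w, show (fun w => P F (w, a)) = POp n v c (fun w => F (w, a)) from funext (key _ hF)]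

theorem slice_XX {n : ℕ} {F : Sg n → ℂ} (hF : ContDiffOn ℝ ∞ F (US n)) {a : ℝ} (ha : 0 < a)
    (j : Fin n) (w : Hn n) : XS n j (XS n j F) (w, a) =
      POp n (eX n j) (cX n j) (POp n (eX n j) (cX n j) (fun w => F (w, a))) w :=
  slice_POp2 (goodC_X n j) (fun G p => rfl) hF ha w

theorem slice_YY {n : ℕ} {F : Sg n → ℂ} (hF : ContDiffOn ℝ ∞ F (US n)) {a : ℝ} (ha : 0 < a)
    (j : Fin n) (w : Hn n) : YS n j (YS n j F) (w, a) =
      POp n (eY n j) (cY n j) (POp n (eY n j) (cY n j) (fun w => F (w, a))) w :=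
  slice_POp2 (P := YS n j) (goodC_Y n j) (fun G p => by
    simp only [YS, cY, eYS, eTS]; ring) hF ha w

theorem slice_TT {n : ℕ} {F : Sg n → ℂ} (hF : ContDiffOn ℝ ∞ F (US n)) {a : ℝ} (ha : 0 < a)
    (w : Hn n) : TS n (TS n F) (w, a) =
      POp n (eT n) (fun _ => 0) (POp n (eT n) (fun _ => 0) (fun w => F (w, a))) w :=
  slice_POp2 (P := TS n) (goodC_zero n) (fun G p => by
    simp only [TS, eTS]; ring) hF ha w

theorem int_TT {n : ℕ} {G : Hn n → ℂ} (hG : ContDiff ℝ ∞ G) (φ : 𝓢(Hn n, ℂ))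
    (hc : HasCompactSupport φ) :
    ∫ w, POp n (eT n) (fun _ => 0) (POp n (eT n) (fun _ => 0) G) w * φ w = ∫ w, G w * TV n φ w := by
  rw [ibp_POp2 _ (goodC_zero n) hG (φ.smooth ⊤) hc]
  simp only [TV_apply, POp_zero_coeff]

theorem int_LL {n : ℕ} {G : Hn n → ℂ} (hG : ContDiff ℝ ∞ G) (φ : 𝓢(Hn n, ℂ))
    (hc : HasCompactSupport φ) :
    ∫ w, (-(1/4) * ∑ j, (POp n (eX n j) (cX n j) (POp n (eX n j) (cX n j) G) w
       + POp n (eY n j) (cY n j) (POp n (eY n j) (cY n j) G) w)) * φ w = ∫ w, G w * LV n φ w := by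
  have hφ : ContDiff ℝ ∞ φ := φ.smooth ⊤
  have i1 : ∀ v c, GoodC n c → Integrable (fun w => POp n v c (POp n v c G) w * φ w) := fun v c h =>
    ((POp_smooth v h (POp_smooth v h hG)).continuous.mul φ.continuous).integrable_of_hasCompactSupport hc.mul_left
  have i2 : ∀ v c, GoodC n c → Integrable (fun w => G w * POp n v c (POp n v c φ) w) := fun v c h =>
    (hG.continuous.mul (POp_smooth v h (POp_smooth v h hφ)).continuous).integrable_of_hasCompactSupport
      (POp_compact _ _ (POp_compact _ _ hc)).mul_left
  have i1' : ∀ j, Integrable (fun w => POp n (eX n j) (cX n j) (POp n (eX n j) (cX n j) G) w * φ w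
       + POp n (eY n j) (cY n j) (POp n (eY n j) (cY n j) G) w * φ w) := fun j =>
    (i1 _ _ (goodC_X n j)).add (i1 _ _ (goodC_Y n j))
  have i2' : ∀ j, Integrable (fun w => G w * POp n (eX n j) (cX n j) (POp n (eX n j) (cX n j) φ) w +
       G w * POp n (eY n j) (cY n j) (POp n (eY n j) (cY n j) φ) w) := fun j =>
    (i2 _ _ (goodC_X n j)).add (i2 _ _ (goodC_Y n j))
  simp only [LV_apply, XH_eq, YH_eq]
  calc _ = ∫ w, (-(1/4):ℂ) * ∑ j, (POp n (eX n j) (cX n j) (POp n (eX n j) (cX n j) G) w * φ w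
       + POp n (eY n j) (cY n j) (POp n (eY n j) (cY n j) G) w * φ w) := by
        congr 1; funext w; rw [mul_assoc, Finset.sum_mul]; simp only [add_mul]
    _ = (-(1/4):ℂ) * ∑ j, ((∫ w, POp n (eX n j) (cX n j) (POp n (eX n j) (cX n j) G) w * φ w) +
       ∫ w, POp n (eY n j) (cY n j) (POp n (eY n j) (cY n j) G) w * φ w) := by
        rw [integral_const_mul, integral_finsetSum _ fun j _ => i1' j]
        congr 1
        refine Finset.sum_congr rfl fun j _ => integral_add (i1 _ _ (goodC_X n j)) (i1 _ _ (goodC_Y n j))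
    _ = (-(1/4):ℂ) * ∑ j, ((∫ w, G w * POp n (eX n j) (cX n j) (POp n (eX n j) (cX n j) φ) w) +
       ∫ w, G w * POp n (eY n j) (cY n j) (POp n (eY n j) (cY n j) φ) w) := by
        congr 1
        refine Finset.sum_congr rfl fun j _ => ?_
        rw [ibp_POp2 _ (goodC_X n j) hG hφ hc, ibp_POp2 _ (goodC_Y n j) hG hφ hc]
    _ = ∫ w, (-(1/4):ℂ) * ∑ j, (G w * POp n (eX n j) (cX n j) (POp n (eX n j) (cX n j) φ) w +
       G w * POp n (eY n j) (cY n j) (POp n (eY n j) (cY n j) φ) w) := by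
        rw [integral_const_mul, integral_finsetSum _ fun j _ => i2' j]
        congr 1
        refine Finset.sum_congr rfl fun j _ => (integral_add (i2 _ _ (goodC_X n j)) (i2 _ _ (goodC_Y n j))).symm
    _ = _ := by
        congr 1; funext w; simp only [← mul_add]; rw [← Finset.mul_sum]; ring

/-- pairing -/
def gdF (n : ℕ) (F : Sg n → ℂ) (p : ℕ) (a : ℝ) (φ : 𝓢(Hn n, ℂ)) : ℂ :=
  if 0 < a then ∫ w : Hn n, ((DA n)^[p] F) (w, a) * φ w else 0

theorem bdd_integrable {n : ℕ} {G : Hn n → ℂ} (hG : AEStronglyMeasurable G volume) {C : ℝ}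
    (hC : ∀ w, ‖G w‖ ≤ C) (φ : 𝓢(Hn n, ℂ)) : Integrable (fun w => G w * φ w) :=
  φ.integrable.bdd_mul hG (Eventually.of_forall hC)

def pairLin {n : ℕ} {G : Hn n → ℂ} (hG : ∀ φ : 𝓢(Hn n, ℂ), Integrable (fun w => G w * φ w)) :
    𝓢(Hn n, ℂ) →ₗ[ℂ] ℂ where
  toFun φ := ∫ w, G w * φ w
  map_add' φ χ := by
    rw [← integral_add (hG φ) (hG χ)]
    congr 1; funext w; simp only [add_apply]; ring
  map_smul' c φ := by
    rw [RingHom.id_apply, smul_eq_mul, ← integral_const_mul]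
    congr 1; funext w; simp only [smul_apply, smul_eq_mul]; ring

theorem gdF_hasDeriv {n : ℕ} {F : Sg n → ℂ} (hF : ContDiffOn ℝ ∞ F (US n)) (φ : 𝓢(Hn n, ℂ))
    (hc : HasCompactSupport φ) (p : ℕ) {a : ℝ} (ha : 0 < a) :
    HasDerivAt (fun x => gdF n F p x φ) (gdF n F (p+1) a φ) a := by
  have hG := DA_iter_smoothOn hF p
  have hG' := DA_iter_smoothOn hF (p+1)
  set G := (DA n)^[p] F with hGdef
  have e1 : (DA n)^[p+1] F = DA n G := Function.iterate_succ_apply' _ _ _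
  rw [e1] at hG'
  have ev : (fun x => gdF n F p x φ) =ᶠ[𝓝 a] fun x => ∫ w, G (w, x) * φ w := by
    filter_upwards [lt_mem_nhds ha] with x hx
    simp only [gdF, if_pos hx, hGdef]
  refine HasDerivAt.congr_of_eventuallyEq ?_ ev
  simp only [gdF, if_pos ha, e1]
  have hK : IsCompact ((tsupport φ) ×ˢ (Icc (a/2) (2*a)) : Set (Sg n)) := hc.isCompact.prod isCompact_Icc
  obtain ⟨M, hM⟩ := hK.exists_bound_of_continuousOn (f := DA n G) (hG'.continuousOn.mono (by
    rintro ⟨w, x⟩ ⟨_, hx⟩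
    have := hx.1
    show 0 < x
    simp only at this; linarith))
  have hs : Icc (a/2) (2*a) ∈ 𝓝 a := Icc_mem_nhds (by linarith) (by linarith)
  refine (hasDerivAt_integral_of_dominated_loc_of_deriv_le (bound := fun w => M * ‖φ w‖)
    (F := fun x w => G (w, x) * φ w) (F' := fun x w => DA n G (w, x) * φ w) hs ?_ ?_ ?_ ?_ ?_ ?_).2
  · filter_upwards [lt_mem_nhds ha] with x hx
    exact ((slice_smooth hG hx).continuous.mul φ.continuous).aestronglyMeasurable
  · exact ((slice_smooth hG ha).continuous.mul φ.continuous).integrable_of_hasCompactSupport hc.mul_left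
  · exact ((slice_smooth hG' ha).continuous.mul φ.continuous).aestronglyMeasurable
  · refine Eventually.of_forall fun w x hx => ?_
    rw [norm_mul]
    by_cases hw : w ∈ tsupport φ
    · exact mul_le_mul_of_nonneg_right (hM (w, x) ⟨hw, hx⟩) (norm_nonneg _)
    · rw [image_eq_zero_of_notMem_tsupport hw]; simp
  · exact φ.integrable.norm.const_mul M
  · refine Eventually.of_forall fun w x hx => ?_
    have hx0 : 0 < x := by have := hx.1; linarith
    exact (slice_a hG hx0 w).mul_const _

end

section

open scoped SchwartzMap ContDiff LineDeriv

theorem concrete_core (n : ℕ) (hn : 1 ≤ n) (α : ℝ) (hα : 0 < α)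
    (k₀ : ℕ) (hk₀ : k₀ = Nat.floor ((n : ℝ) * α) + 1)
    (f : Hn n → ℂ) (hfmeas : Measurable f) (hfbdd : BddFun f)
    (F : Sg n → ℂ) (hFbdd : ∃ C, ∀ p : Sg n, 0 < p.2 → ‖F p‖ ≤ C)
    (hFsmooth : ContDiffOn ℝ (⊤ : ℕ∞) F {p : Sg n | 0 < p.2})
    (hFharm : ∀ p : Sg n, 0 < p.2 → Lalpha n α F p = 0)
    (hbv : IsBoundaryValue n F f)
    (hreg : ∀ φ : SchwartzMap (Hn n) ℂ, ∀ p : ℕ, p ≤ k₀ + 1 → ∃ C : ℝ,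
      ∀ a : ℝ, 0 < a → a ≤ 1 →
        ‖∫ w : Hn n, ((DA n)^[p] F) (w, a) * φ w‖ ≤ C)
    (κ : ℕ) (hκ : 1 ≤ κ) (e : ℕ → ℝ → 𝓢(Hn n, ℂ))
    (E : FamHyp (LV n : 𝓢(Hn n, ℂ) →ₗ[ℂ] 𝓢(Hn n, ℂ)) (TV n : 𝓢(Hn n, ℂ) →ₗ[ℂ] 𝓢(Hn n, ℂ)) e (2 * κ + n)) :
    ∫ w, f w * e 0 0 w = 0 := by
  have hF : ContDiffOn ℝ ∞ F (US n) := hFsmooth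
  obtain ⟨C0, hC0⟩ := hFbdd
  obtain ⟨C1, hC1⟩ := hfbdd
  set C := max C0 0 with hCdef
  have hC : ∀ p : Sg n, 0 < p.2 → ‖F p‖ ≤ C := fun p hp => (hC0 p hp).trans (le_max_left _ _)
  have hCn : 0 ≤ C := le_max_right _ _
  have hn0 : (0:ℝ) < n := by exact_mod_cast hn
  have hi : ∀ a : ℝ, 0 < a → ∀ φ : 𝓢(Hn n, ℂ), Integrable (fun w => F (w, a) * φ w) := fun a ha φ =>
    bdd_integrable (G := fun w => F (w, a)) (slice_smooth hF ha).continuous.aestronglyMeasurable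
      (fun w => hC (w, a) ha) φ
  have hfi : ∀ φ : 𝓢(Hn n, ℂ), Integrable (fun w => f w * φ w) := fun φ =>
    bdd_integrable hfmeas.aestronglyMeasurable hC1 φ
  let g : ℝ → 𝓢(Hn n, ℂ) →ₗ[ℂ] ℂ := fun a => if ha : 0 < a then pairLin (hi a ha) else 0
  have hg : ∀ a : ℝ, 0 < a → ∀ φ, g a φ = ∫ w, F (w, a) * φ w := by
    intro a ha φ
    simp only [g, dif_pos ha]; rfl
  have key : CoreHyp (LV n : 𝓢(Hn n, ℂ) →ₗ[ℂ] 𝓢(Hn n, ℂ)) (TV n : 𝓢(Hn n, ℂ) →ₗ[ℂ] 𝓢(Hn n, ℂ))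
      g (pairLin hfi) (gdF n F) {φ | HasCompactSupport φ} (n * α) α (Nat.floor ((n : ℝ) * α)) := by
    refine ⟨by positivity, hα, rfl, (LV n).continuous, (TV n).continuous, ?_, ?_, ?_,
      schwartz_dense_compact (Hn n), fun φ h => LV_compact φ h, fun φ h => TV_compact φ h, ?_,
      fun φ h p a ha => gdF_hasDeriv hF φ h p ha, ?_, ?_⟩
    · let q : Seminorm ℂ 𝓢(Hn n, ℂ) := (normSeminorm ℂ (Lp ℂ 1 (volume : Measure (Hn n)))).comp
        (SchwartzMap.toLpCLM ℂ ℂ 1 (volume : Measure (Hn n)) : 𝓢(Hn n, ℂ) →ₗ[ℂ] _)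
      have hq : ∀ φ, q φ = ∫ w, ‖φ w‖ := fun φ => SchwartzMap.norm_toLp_one
      have hqc : Continuous q := (SchwartzMap.toLpCLM ℂ ℂ 1 (volume : Measure (Hn n))).continuous.norm
      refine ⟨C.toNNReal • q, ?_, ?_⟩
      · exact hqc.const_smul C.toNNReal
      · intro a ha φ
        rw [hg a ha, smul_apply, hq, NNReal.smul_def, Real.coe_toNNReal _ hCn, smul_eq_mul]

        rw [← integral_const_mul]
        refine norm_integral_le_of_norm_le (φ.integrable.norm.const_mul C) (Eventually.of_forall fun w => ?_)
        rw [norm_mul]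
        exact mul_le_mul_of_nonneg_right (hC (w, a) ha) (norm_nonneg _)
    · intro φ
      have : ContinuousOn (fun a => ∫ w, F (w, a) * φ w) (Ioi 0) := by
        refine continuousOn_of_dominated (bound := fun w => C * ‖φ w‖) ?_ ?_ (φ.integrable.norm.const_mul C) ?_
        · exact fun a ha => (hi a ha φ).aestronglyMeasurable
        · refine fun a ha => Eventually.of_forall fun w => ?_
          rw [norm_mul]
          exact mul_le_mul_of_nonneg_right (hC (w, a) ha) (norm_nonneg _)
        · exact Eventually.of_forall fun w a ha =>
            ((slice_a hF ha w).continuousAt.mul continuousAt_const).continuousWithinAt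
      exact this.congr fun a ha => hg a ha φ
    · intro φ
      refine (hbv φ φ.integrable).congr' ?_
      filter_upwards [self_mem_nhdsWithin] with a ha
      exact (hg a ha φ).symm
    · intro a φ
      by_cases ha : 0 < a
      · rw [hg a ha, gdF, if_pos ha]; rfl
      · simp [gdF, ha, g]
    · intro φ h a ha
      show (a:ℂ) * gdF n F 2 a φ - ((n * α : ℝ):ℂ) * gdF n F 1 a φ = (α:ℂ) * g a (LV n φ) - (a:ℂ) * g a (TV n φ)
      rw [hg a ha, hg a ha]
      have hG := slice_smooth hF ha
      have hd : ∀ p, Integrable (fun w => ((DA n)^[p] F) (w, a) * φ w) := fun p =>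
        ((slice_smooth (DA_iter_smoothOn hF p) ha).continuous.mul φ.continuous).integrable_of_hasCompactSupport
          (HasCompactSupport.mul_left h)
      have hc : ∀ (G : Hn n → ℂ), Continuous G → Integrable (fun w => G w * φ w) := fun G h' =>
        (h'.mul φ.continuous).integrable_of_hasCompactSupport (HasCompactSupport.mul_left h)
      rw [← int_LL hG φ h, ← int_TT hG φ h]
      simp only [gdF, if_pos ha]
      have iT : Integrable (fun w => POp n (eT n) (fun _ => 0) (POp n (eT n) (fun _ => 0) (fun w => F (w, a))) w * φ w) :=
        hc _ (POp_smooth _ (goodC_zero n) (POp_smooth _ (goodC_zero n) hG)).continuous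
      have iL : Integrable (fun w => (-(1/4) * ∑ j, (POp n (eX n j) (cX n j) (POp n (eX n j) (cX n j) (fun w => F (w, a))) w
       + POp n (eY n j) (cY n j) (POp n (eY n j) (cY n j) (fun w => F (w, a))) w)) * φ w) := by
        refine hc _ (continuous_const.mul (continuous_finsetSum _ fun j _ => ?_))
        exact ((POp_smooth _ (goodC_X n j) (POp_smooth _ (goodC_X n j) hG)).continuous).add
          ((POp_smooth _ (goodC_Y n j) (POp_smooth _ (goodC_Y n j) hG)).continuous)
      rw [← integral_const_mul, ← integral_const_mul, ← integral_const_mul, ← integral_const_mul,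
        ← integral_sub ((hd 2).const_mul _) ((hd 1).const_mul _), ← integral_sub (iL.const_mul _) (iT.const_mul _)]
      congr 1
      funext w
      have hz := hFharm (w, a) ha
      simp only [Lalpha, LS0, slice_XX hF ha, slice_YY hF ha, slice_TT hF ha] at hz
      have ha' : (a:ℂ) ≠ 0 := by exact_mod_cast ha.ne'
      simp only [Function.iterate_succ, Function.iterate_zero, Function.comp_apply, id]
      apply mul_left_cancel₀ ha'
      push_cast
      linear_combination (φ w) * hz
    · intro φ h p hp
      obtain ⟨C, hC⟩ := hreg φ p (by omega)
      refine ⟨C, fun a ha ha1 => ?_⟩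
      rw [gdF, if_pos ha]
      exact hC a ha ha1
  have hκ0 : (0:ℝ) < κ := by exact_mod_cast hκ
  exact core_main key E (A := α * κ) (by positivity) (by ring)

end

section

open scoped ContDiff

/-- polynomial-type multipliers -/
inductive Mult {E : Type} [NormedAddCommGroup E] [NormedSpace ℝ E] : (E → ℂ) → Prop
  | const (c : ℂ) : Mult (fun _ => c)
  | lin (l : E →L[ℝ] ℂ) : Mult (fun x => l x)
  | add {f g : E → ℂ} : Mult f → Mult g → Mult (fun x => f x + g x)
  | mul {f g : E → ℂ} : Mult f → Mult g → Mult (fun x => f x * g x)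

section
variable {E : Type} [NormedAddCommGroup E] [NormedSpace ℝ E]

theorem Mult.sum {ι : Type} (s : Finset ι) (f : ι → E → ℂ) (h : ∀ i ∈ s, Mult (f i)) :
    Mult (fun x => ∑ i ∈ s, f i x) := by
  classical
  induction s using Finset.induction_on with
  | empty => simpa using Mult.const (E := E) 0
  | insert a s ha ih =>
    simp only [Finset.sum_insert ha]
    exact (h a (by simp)).add (ih fun i hi => h i (by simp [hi]))

theorem Mult.pow {f : E → ℂ} (h : Mult f) (n : ℕ) : Mult (fun x => f x ^ n) := by
  induction n with
  | zero => simpa using Mult.const (E := E) 1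
  | succ n ih => simp only [pow_succ]; exact ih.mul h

theorem Mult.smooth {f : E → ℂ} (h : Mult f) : ContDiff ℝ ∞ f := by
  induction h with
  | const c => exact contDiff_const
  | lin l => exact l.contDiff
  | add _ _ h1 h2 => exact h1.add h2
  | mul _ _ h1 h2 => exact h1.mul h2

theorem Mult.comp_affine {E' : Type} [NormedAddCommGroup E'] [NormedSpace ℝ E'] {f : E → ℂ} (h : Mult f)
    (A : E' →L[ℝ] E) (b : E) : Mult (fun x => f (A x + b)) := by
  induction h with
  | const c => exact Mult.const c
  | lin l =>
    simp only [map_add]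
    exact (Mult.lin (l ∘L A)).add (Mult.const (l b))
  | add _ _ h1 h2 => exact h1.add h2
  | mul _ _ h1 h2 => exact h1.mul h2

theorem Mult.growth {f : E → ℂ} (h : Mult f) : ∃ C : ℝ, 0 ≤ C ∧ ∃ a : ℕ, ∀ x, ‖f x‖ ≤ C * (1 + ‖x‖) ^ a := by
  induction h with
  | const c => exact ⟨‖c‖, norm_nonneg _, 0, fun x => by simp⟩
  | lin l =>
    refine ⟨‖l‖, norm_nonneg _, 1, fun x => (l.le_opNorm x).trans ?_⟩
    rw [pow_one]
    gcongr
    linarith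
  | @add f g _ _ h1 h2 =>
    obtain ⟨C, hC, a, h1⟩ := h1
    obtain ⟨C', hC', b, h2⟩ := h2
    refine ⟨C + C', by positivity, max a b, fun x => (norm_add_le _ _).trans ?_⟩
    have h0 : 1 ≤ 1 + ‖x‖ := by linarith [norm_nonneg x]
    rw [add_mul]
    refine add_le_add ((h1 x).trans ?_) ((h2 x).trans ?_)
    · gcongr; exact le_max_left _ _
    · gcongr; exact le_max_right _ _
  | @mul f g _ _ h1 h2 =>
    obtain ⟨C, hC, a, h1⟩ := h1
    obtain ⟨C', hC', b, h2⟩ := h2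
    refine ⟨C * C', by positivity, a + b, fun x => ?_⟩
    rw [norm_mul, pow_add, mul_mul_mul_comm]
    exact mul_le_mul (h1 x) (h2 x) (norm_nonneg _) (by positivity)

theorem Mult.deriv {f : E → ℂ} (h : Mult f) : ∃ (N : ℕ) (v : Fin N → E → ℂ) (l : Fin N → E →L[ℝ] ℂ),
    (∀ i, Mult (v i)) ∧ ∀ x, HasFDerivAt f (∑ i, v i x • l i) x := by
  induction h with
  | const c => exact ⟨0, fun _ _ => 0, fun _ => 0, fun i => i.elim0, fun x => by
      simpa using hasFDerivAt_const c x⟩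
  | lin l => exact ⟨1, fun _ _ => 1, fun _ => l, fun i => Mult.const 1, fun x => by
      simpa using l.hasFDerivAt⟩
  | @add f g _ _ h1 h2 =>
    obtain ⟨N, v, l, hv, h1⟩ := h1
    obtain ⟨N', v', l', hv', h2⟩ := h2
    refine ⟨N + N', Fin.append v v', Fin.append l l', fun i => ?_, fun x => ?_⟩
    · refine Fin.addCases (fun i => ?_) (fun i => ?_) i
      · simpa using hv i
      · simpa using hv' i
    · refine ((h1 x).add (h2 x)).congr_fderiv ?_
      simp [Fin.sum_univ_add]
  | @mul f g hf hg h1 h2 =>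
    obtain ⟨N, v, l, hv, h1⟩ := h1
    obtain ⟨N', v', l', hv', h2⟩ := h2
    refine ⟨N + N', Fin.append (fun i x => v i x * g x) (fun i x => v' i x * f x), Fin.append l l',
      fun i => ?_, fun x => ?_⟩
    · refine Fin.addCases (fun i => ?_) (fun i => ?_) i
      · simpa using (hv i).mul hg
      · simpa using (hv' i).mul hf
    · refine ((h1 x).mul (h2 x)).congr_fderiv ?_
      simp only [Fin.sum_univ_add, Fin.append_left, Fin.append_right, Finset.smul_sum, smul_smul]
      rw [add_comm]
      congr 1 <;> refine Finset.sum_congr rfl fun i _ => by rw [mul_comm]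

/-- closed class of families of functions -/
structure ClosedClass {Pi : Type} (Cl : (Pi → E → ℂ) → Prop) : Prop where
  decay : ∀ u, Cl u → ∀ a : ℕ, ∃ C : ℝ, ∀ p x, ‖x‖ ^ a * ‖u p x‖ ≤ C
  deriv : ∀ u, Cl u → ∃ (N : ℕ) (v : Fin N → Pi → E → ℂ) (l : Fin N → E →L[ℝ] ℂ),
    (∀ i, Cl (v i)) ∧ ∀ p x, HasFDerivAt (u p) (∑ i, v i p x • l i) x

theorem ClosedClass.smooth {Pi : Type} {Cl : (Pi → E → ℂ) → Prop} (h : ClosedClass Cl)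
    {u : Pi → E → ℂ} (hu : Cl u) (p : Pi) : ContDiff ℝ ∞ (u p) := by
  rw [contDiff_infty]
  intro m
  induction m generalizing u with
  | zero =>
    obtain ⟨N, v, l, hv, hd⟩ := h.deriv u hu
    rw [Nat.cast_zero, contDiff_zero]
    exact continuous_iff_continuousAt.2 fun x => (hd p x).continuousAt
  | succ m ih =>
    obtain ⟨N, v, l, hv, hd⟩ := h.deriv u hu
    rw [Nat.cast_succ, contDiff_succ_iff_fderiv]
    refine ⟨fun x => (hd p x).differentiableAt, by simp, ?_⟩
    rw [show fderiv ℝ (u p) = fun x => ∑ i, v i p x • l i from funext fun x => (hd p x).fderiv]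
    exact ContDiff.sum fun i _ => (ih (hv i)).smul contDiff_const

theorem ClosedClass.bound {Pi : Type} {Cl : (Pi → E → ℂ) → Prop} (h : ClosedClass Cl) (a b : ℕ)
    {u : Pi → E → ℂ} (hu : Cl u) : ∃ C : ℝ, ∀ p x, ‖x‖ ^ a * ‖iteratedFDeriv ℝ b (u p) x‖ ≤ C := by
  induction b generalizing u with
  | zero => simpa using h.decay u hu a
  | succ b ih =>
    obtain ⟨N, v, l, hv, hd⟩ := h.deriv u hu
    choose C hC using fun i => ih (hv i)
    let K : Fin N → ℂ →L[ℝ] (E →L[ℝ] ℂ) := fun i =>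
      (ContinuousLinearMap.lsmul ℝ ℂ : ℂ →L[ℝ] (E →L[ℝ] ℂ) →L[ℝ] (E →L[ℝ] ℂ)).flip (l i)
    refine ⟨∑ i, ‖K i‖ * C i, fun p x => ?_⟩
    have hs : ∀ i, ContDiff ℝ ∞ (v i p) := fun i => h.smooth (hv i) p
    rw [← norm_iteratedFDeriv_fderiv,
      show fderiv ℝ (u p) = fun x => ∑ i, (K i ∘ v i p) x from funext fun x => (hd p x).fderiv,
      iteratedFDeriv_fun_sum_apply (fun i _ => ((K i).contDiff.comp
        ((hs i).of_le (by exact_mod_cast le_top))).contDiffAt)]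
    calc _ ≤ ‖x‖ ^ a * ∑ i, ‖K i‖ * ‖iteratedFDeriv ℝ b (v i p) x‖ := by
          gcongr
          refine (norm_sum_le _ _).trans (Finset.sum_le_sum fun i _ => ?_)
          exact (K i).norm_iteratedFDeriv_comp_left (hs i).contDiffAt (by exact_mod_cast le_top)
      _ = ∑ i, ‖K i‖ * (‖x‖ ^ a * ‖iteratedFDeriv ℝ b (v i p) x‖) := by
          rw [Finset.mul_sum]; refine Finset.sum_congr rfl fun i _ => by ring
      _ ≤ _ := Finset.sum_le_sum fun i _ => mul_le_mul_of_nonneg_left (hC i p x) (by positivity)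
end

end

section

open scoped ContDiff

structure Adm {Pi : Type} (Psi : Pi → ℝ → ℂ) : Prop where
  smooth : ∀ p, ContDiff ℝ ∞ (Psi p)
  supp : ∃ d : ℝ, 0 ≤ d ∧ ∀ p mu, mu ∉ Icc 0 d → Psi p mu = 0
  bound : ∀ l : ℕ, ∃ C : ℝ, ∀ p mu, ‖iteratedDeriv l (Psi p) mu‖ ≤ C

theorem Adm.deriv {Pi : Type} {Psi : Pi → ℝ → ℂ} (h : Adm Psi) : Adm (fun p => _root_.deriv (Psi p)) := by
  refine ⟨fun p => ?_, ?_, fun l => ?_⟩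
  · exact (contDiff_infty_iff_deriv.1 (h.smooth p)).2
  · obtain ⟨d, hd, hs⟩ := h.supp
    refine ⟨d, hd, fun p mu hmu => ?_⟩
    have : Psi p =ᶠ[𝓝 mu] fun _ => 0 := by
      filter_upwards [isClosed_Icc.isOpen_compl.mem_nhds hmu] with x hx
      exact hs p x hx
    rw [this.deriv_eq]; simp
  · obtain ⟨C, hC⟩ := h.bound (l+1)
    refine ⟨C, fun p mu => ?_⟩
    rw [← iteratedDeriv_succ']
    exact hC p mu

theorem Adm.mulI {Pi : Type} {Psi : Pi → ℝ → ℂ} (h : Adm Psi) (c : ℂ) :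
    Adm (fun p mu => c * (mu:ℂ) * Psi p mu) := by
  have hsm : ∀ {Psi : Pi → ℝ → ℂ}, Adm Psi → ∀ p, ContDiff ℝ ∞ (fun mu : ℝ => c * (mu:ℂ) * Psi p mu) := by
    intro Psi h p
    exact (contDiff_const.mul Complex.ofRealCLM.contDiff).mul (h.smooth p)
  refine ⟨hsm h, ?_, fun l => ?_⟩
  · obtain ⟨d, hd, hs⟩ := h.supp
    exact ⟨d, hd, fun p mu hmu => by rw [hs p mu hmu, mul_zero]⟩
  · induction l generalizing Psi with
    | zero =>
      obtain ⟨d, hd, hs⟩ := h.supp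
      obtain ⟨C, hC⟩ := h.bound 0
      refine ⟨‖c‖ * d * |C|, fun p mu => ?_⟩
      simp only [iteratedDeriv_zero] at hC ⊢
      by_cases hmu : mu ∈ Icc 0 d
      · rw [norm_mul, norm_mul, Complex.norm_real, Real.norm_of_nonneg hmu.1]
        gcongr
        · exact hmu.2
        · exact (hC p mu).trans (le_abs_self _)
      · rw [hs p mu hmu]; simp; positivity
    | succ l ih =>
      obtain ⟨C1, h1⟩ := ih h.deriv
      obtain ⟨C2, h2⟩ := h.bound l
      refine ⟨‖c‖ * C2 + C1, fun p mu => ?_⟩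
      have e : _root_.deriv (fun mu : ℝ => c * (mu:ℂ) * Psi p mu) =
          (fun mu : ℝ => c * Psi p mu) + fun mu : ℝ => c * (mu:ℂ) * _root_.deriv (Psi p) mu := by
        funext mu
        have a1 : HasDerivAt (fun mu : ℝ => c * (mu:ℂ)) (c * 1) mu :=
          (Complex.ofRealCLM.hasDerivAt (x := mu)).const_mul c
        have a2 : HasDerivAt (Psi p) (_root_.deriv (Psi p) mu) mu :=
          ((h.smooth p).differentiable (by simp) mu).hasDerivAt
        rw [(a1.fun_mul a2).deriv]
        simp
      rw [iteratedDeriv_succ', e, iteratedDeriv_add]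
      · refine (norm_add_le _ _).trans (add_le_add ?_ (h1 p mu))
        rw [iteratedDeriv_const_mul_field, norm_mul]
        gcongr
        exact h2 p mu
      · exact ((contDiff_const.mul (h.smooth p)).of_le (by exact_mod_cast le_top)).contDiffAt
      · exact ((hsm h.deriv p).of_le (by exact_mod_cast le_top)).contDiffAt

def PhiT (psi : ℝ → ℂ) (z : ℂ) : ℂ := ∫ mu : ℝ, psi mu * Complex.exp (Complex.I * mu * z)

theorem Adm.compactSupp {Pi : Type} {Psi : Pi → ℝ → ℂ} (h : Adm Psi) (p : Pi) : HasCompactSupport (Psi p) := by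
  obtain ⟨d, hd, hs⟩ := h.supp
  exact HasCompactSupport.intro isCompact_Icc (fun x hx => hs p x hx)

theorem Adm.integrable {Pi : Type} {Psi : Pi → ℝ → ℂ} (h : Adm Psi) (p : Pi) (z : ℂ) :
    Integrable (fun mu : ℝ => Psi p mu * Complex.exp (Complex.I * mu * z)) :=
  Continuous.integrable_of_hasCompactSupport ((h.smooth p).continuous.mul (by fun_prop)) (h.compactSupp p).mul_right

theorem PhiT_bound {Pi : Type} {Psi : Pi → ℝ → ℂ} (h : Adm Psi) :
    ∃ C : ℝ, ∀ p (z : ℂ), 0 ≤ z.im → ‖PhiT (Psi p) z‖ ≤ C := by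
  obtain ⟨d, hd, hs⟩ := h.supp
  obtain ⟨C, hC⟩ := h.bound 0
  refine ⟨∫ mu : ℝ, (Icc 0 d).indicator (fun _ => |C|) mu, fun p z hz => ?_⟩
  refine norm_integral_le_of_norm_le ?_ (Eventually.of_forall fun mu => ?_)
  · exact (integrable_indicator_iff measurableSet_Icc).2 (by simp [integrableOn_const])
  · by_cases hmu : mu ∈ Icc 0 d
    · rw [indicator_of_mem hmu, norm_mul, Complex.norm_exp]
      have : (Complex.I * mu * z).re ≤ 0 := by
        simp
        exact mul_nonneg hmu.1 hz
      have h1 : Real.exp (Complex.I * mu * z).re ≤ 1 := Real.exp_le_one_iff.2 this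
      have h2 := hC p mu
      simp only [iteratedDeriv_zero] at h2
      calc _ ≤ |C| * 1 := by gcongr; exact h2.trans (le_abs_self _)
        _ = _ := mul_one _
    · rw [hs p mu hmu, indicator_of_notMem hmu]; simp

theorem PhiT_ibp {Pi : Type} {Psi : Pi → ℝ → ℂ} (h : Adm Psi) (p : Pi) (z : ℂ) :
    z * PhiT (Psi p) z = Complex.I * PhiT (_root_.deriv (Psi p)) z := by
  have hexp : ∀ mu : ℝ, HasDerivAt (fun mu : ℝ => Complex.exp (Complex.I * mu * z))
      (Complex.exp (Complex.I * mu * z) * (Complex.I * z)) mu := by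
    intro mu
    have : HasDerivAt (fun mu : ℝ => Complex.I * (mu:ℂ) * z) (Complex.I * 1 * z) mu :=
      ((Complex.ofRealCLM.hasDerivAt (x := mu)).const_mul Complex.I).mul_const z
    simpa using this.cexp
  have key := integral_mul_deriv_eq_deriv_mul_of_integrable (u := Psi p) (u' := _root_.deriv (Psi p))
    (v := fun mu : ℝ => Complex.exp (Complex.I * mu * z))
    (v' := fun mu : ℝ => Complex.exp (Complex.I * mu * z) * (Complex.I * z))
    (fun x _ => ((h.smooth p).differentiable (by simp) x).hasDerivAt) (fun x _ => hexp x) ?_ ?_ ?_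
  · simp only [PhiT]
    simp only [← mul_assoc] at key
    rw [integral_mul_const, integral_mul_const] at key
    have hI : Complex.I * Complex.I = -1 := Complex.I_mul_I
    linear_combination (-Complex.I) * key + (z * ∫ mu : ℝ, Psi p mu * Complex.exp (Complex.I * mu * z)) * hI
  · have := (h.integrable p z).mul_const (Complex.I * z)
    refine this.congr (Eventually.of_forall fun mu => ?_)
    show _ = Psi p mu * (Complex.exp (Complex.I*mu*z) * (Complex.I*z))
    ring
  · exact h.deriv.integrable p z
  · exact h.integrable p z

theorem PhiT_decay {Pi : Type} {Psi : Pi → ℝ → ℂ} (h : Adm Psi) (m : ℕ) :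
    ∃ C : ℝ, ∀ p (z : ℂ), 0 ≤ z.im → (1 + ‖z‖) ^ m * ‖PhiT (Psi p) z‖ ≤ C := by
  induction m generalizing Psi with
  | zero => simpa using PhiT_bound h
  | succ m ih =>
    obtain ⟨C1, h1⟩ := ih h
    obtain ⟨C2, h2⟩ := ih h.deriv
    refine ⟨C1 + C2, fun p z hz => ?_⟩
    have e : ‖z‖ * ‖PhiT (Psi p) z‖ = ‖PhiT (_root_.deriv (Psi p)) z‖ := by
      rw [← norm_mul, PhiT_ibp h, norm_mul, Complex.norm_I, one_mul]
    calc _ = (1 + ‖z‖) ^ m * ‖PhiT (Psi p) z‖ + (1 + ‖z‖) ^ m * (‖z‖ * ‖PhiT (Psi p) z‖) := by ring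
      _ ≤ _ := by rw [e]; exact add_le_add (h1 p z hz) (h2 p z hz)

theorem PhiT_deriv {Pi : Type} {Psi : Pi → ℝ → ℂ} (h : Adm Psi) (p : Pi) (z : ℂ) :
    HasDerivAt (PhiT (Psi p)) (PhiT (fun mu => Complex.I * mu * Psi p mu) z) z := by
  have hc := (h.smooth p).continuous
  have := (hasDerivAt_integral_of_dominated_loc_of_deriv_le (μ := (volume : Measure ℝ)) (𝕜 := ℂ) (x₀ := z)
    (s := Metric.ball z 1)
    (F := fun z (mu : ℝ) => Psi p mu * Complex.exp (Complex.I * mu * z))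
    (F' := fun z (mu : ℝ) => Psi p mu * (Complex.exp (Complex.I * mu * z) * (Complex.I * mu)))
    (bound := fun mu : ℝ => ‖Psi p mu‖ * (Real.exp (|mu| * (‖z‖ + 1)) * |mu|))
    (Metric.ball_mem_nhds z one_pos) ?_ ?_ ?_ ?_ ?_ ?_).2
  · refine this.congr_deriv ?_
    simp only [PhiT]
    congr 1; funext mu; ring
  · exact Eventually.of_forall fun z => (h.integrable p z).aestronglyMeasurable
  · exact h.integrable p z
  · exact (hc.mul (by fun_prop)).aestronglyMeasurable
  · refine Eventually.of_forall fun mu w hw => ?_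
    rw [norm_mul, norm_mul, Complex.norm_exp, norm_mul, Complex.norm_I, one_mul, Complex.norm_real, Real.norm_eq_abs]
    gcongr
    refine (Complex.re_le_norm _).trans ?_
    rw [norm_mul, norm_mul, Complex.norm_I, one_mul, Complex.norm_real, Real.norm_eq_abs]
    gcongr
    have : ‖w - z‖ < 1 := by simpa [dist_eq_norm] using hw
    have h3 := norm_add_le (w - z) z
    simp at h3
    linarith
  · exact Continuous.integrable_of_hasCompactSupport (hc.norm.mul (by fun_prop)) (h.compactSupp p).norm.mul_right
  · refine Eventually.of_forall fun mu w _ => ?_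
    have h1 : HasDerivAt (fun w : ℂ => Complex.I * mu * w) (Complex.I * mu) w := by
      simpa using (hasDerivAt_id w).const_mul (Complex.I * (mu:ℂ))
    exact h1.cexp.const_mul _

structure ZDat {E : Type} [NormedAddCommGroup E] [NormedSpace ℝ E] (z : E → ℂ) : Prop where
  mult : Mult z
  im : ∀ x, 0 ≤ (z x).im
  grow : ∃ K : ℝ, 0 ≤ K ∧ ∀ x, 1 + ‖x‖ ≤ K * (1 + ‖z x‖)

def ClZ {E : Type} [NormedAddCommGroup E] [NormedSpace ℝ E] (z : E → ℂ) (Pi : Type)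
    (u : Pi → E → ℂ) : Prop :=
  ∃ (c : E → ℂ) (Psi : Pi → ℝ → ℂ), Mult c ∧ Adm Psi ∧ u = fun p x => c x * PhiT (Psi p) (z x)

theorem ClZ_closed {E : Type} [NormedAddCommGroup E] [NormedSpace ℝ E] {z : E → ℂ} (hz : ZDat z) (Pi : Type) :
    ClosedClass (ClZ z Pi) := by
  refine ⟨?_, ?_⟩
  · rintro u ⟨c, Psi, hc, hP, rfl⟩ a
    obtain ⟨C, hC, b, hb⟩ := hc.growth
    obtain ⟨K, hK, hg⟩ := hz.grow
    obtain ⟨M, hM⟩ := PhiT_decay hP (a + b)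
    refine ⟨C * (K ^ (a+b) * M), fun p x => ?_⟩
    rw [norm_mul]
    calc ‖x‖ ^ a * (‖c x‖ * ‖PhiT (Psi p) (z x)‖)
        ≤ (1 + ‖x‖) ^ a * ((C * (1 + ‖x‖) ^ b) * ‖PhiT (Psi p) (z x)‖) := by
          gcongr
          · linarith
          · exact hb x
      _ = C * ((1 + ‖x‖) ^ (a + b) * ‖PhiT (Psi p) (z x)‖) := by ring
      _ ≤ C * ((K * (1 + ‖z x‖)) ^ (a + b) * ‖PhiT (Psi p) (z x)‖) := by
          gcongr
          exact hg x
      _ = C * (K ^ (a + b) * ((1 + ‖z x‖) ^ (a + b) * ‖PhiT (Psi p) (z x)‖)) := by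
          rw [mul_pow]; ring
      _ ≤ _ := by
          gcongr
          exact hM p (z x) (hz.im x)
  · rintro u ⟨c, Psi, hc, hP, rfl⟩
    obtain ⟨N, v, l, hv, hd⟩ := hc.deriv
    obtain ⟨N', v', l', hv', hd'⟩ := hz.mult.deriv
    refine ⟨N + N', Fin.append (fun i p x => v i x * PhiT (Psi p) (z x))
      (fun i p x => (c x * v' i x) * PhiT (fun mu => Complex.I * mu * Psi p mu) (z x)), Fin.append l l', ?_, ?_⟩
    · intro i
      refine Fin.addCases (fun i => ?_) (fun i => ?_) i
      · simp only [Fin.append_left]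
        exact ⟨v i, Psi, hv i, hP, rfl⟩
      · simp only [Fin.append_right]
        exact ⟨fun x => c x * v' i x, _, hc.mul (hv' i), hP.mulI Complex.I, rfl⟩
    · intro p x
      have h1 := (PhiT_deriv hP p (z x)).comp_hasFDerivAt x (hd' x)
      refine ((hd x).mul h1).congr_fderiv ?_
      simp only [Fin.sum_univ_add, Fin.append_left, Fin.append_right, Finset.smul_sum, smul_smul, Function.comp_apply]
      rw [add_comm]
      congr 1 <;> refine Finset.sum_congr rfl fun i _ => ?_
      · rw [mul_comm]
      · congr 1; ring

end

section

open scoped ContDiff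

structure Chi (c d : ℝ) (chi : ℝ → ℂ) : Prop where
  smooth : ContDiff ℝ ∞ chi
  supp : ∀ mu, mu ∉ Icc c d → chi mu = 0

def EG (chi : ℝ → ℂ) (s : ℝ) (mu : ℝ) : ℂ := chi mu * Complex.exp (-(mu:ℂ) * s)

theorem Chi.deriv {c d : ℝ} {chi : ℝ → ℂ} (h : Chi c d chi) : Chi c d (_root_.deriv chi) := by
  refine ⟨(contDiff_infty_iff_deriv.1 h.smooth).2, fun mu hmu => ?_⟩
  have : chi =ᶠ[𝓝 mu] fun _ => 0 := by
    filter_upwards [isClosed_Icc.isOpen_compl.mem_nhds hmu] with x hx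
    exact h.supp x hx
  rw [this.deriv_eq]; simp

theorem Chi.mulId {c d : ℝ} {chi : ℝ → ℂ} (h : Chi c d chi) : Chi c d (fun mu => (mu:ℂ) * chi mu) :=
  ⟨Complex.ofRealCLM.contDiff.mul h.smooth, fun mu hmu => by rw [h.supp mu hmu, mul_zero]⟩

theorem Chi.mulPow {c d : ℝ} {chi : ℝ → ℂ} (h : Chi c d chi) (j : ℕ) :
    Chi c d (fun mu => (mu:ℂ)^j * chi mu) :=
  ⟨(Complex.ofRealCLM.contDiff.pow j).mul h.smooth, fun mu hmu => by rw [h.supp mu hmu, mul_zero]⟩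

theorem Chi.eg_smooth {c d : ℝ} {chi : ℝ → ℂ} (h : Chi c d chi) (s : ℝ) : ContDiff ℝ ∞ (EG chi s) :=
  h.smooth.mul (((Complex.ofRealCLM.contDiff.neg).mul contDiff_const).cexp)

theorem Chi.eg_supp {c d : ℝ} {chi : ℝ → ℂ} (h : Chi c d chi) (s : ℝ) (mu : ℝ) (hmu : mu ∉ Icc c d) :
    EG chi s mu = 0 := by rw [EG, h.supp mu hmu, zero_mul]

theorem Chi.eg_deriv {c d : ℝ} {chi : ℝ → ℂ} (h : Chi c d chi) (s : ℝ) :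
    _root_.deriv (EG chi s) = fun mu => EG (_root_.deriv chi) s mu - (s:ℂ) * EG chi s mu := by
  funext mu
  have a1 : HasDerivAt (fun mu : ℝ => -(mu:ℂ) * s) (-1 * s) mu :=
    (Complex.ofRealCLM.hasDerivAt (x := mu)).neg.mul_const _
  have a2 : HasDerivAt chi (_root_.deriv chi mu) mu :=
    (h.smooth.differentiable (by simp) mu).hasDerivAt
  have a3 := (a2.fun_mul a1.cexp).deriv
  show _root_.deriv (fun mu : ℝ => chi mu * Complex.exp (-(mu:ℂ) * s)) mu = _
  rw [a3]; simp only [EG]; ring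

theorem Chi.iter_succ {c d : ℝ} {chi : ℝ → ℂ} (h : Chi c d chi) (s : ℝ) (l : ℕ) (mu : ℝ) :
    iteratedDeriv (l+1) (EG chi s) mu =
      iteratedDeriv l (EG (_root_.deriv chi) s) mu - (s:ℂ) * iteratedDeriv l (EG chi s) mu := by
  rw [iteratedDeriv_succ', h.eg_deriv]
  have := iteratedDeriv_fun_sub (n := l) (x := mu) (f := EG (_root_.deriv chi) s) (g := fun mu => (s:ℂ) * EG chi s mu)
    (((h.deriv.eg_smooth s).of_le (by exact_mod_cast le_top)).contDiffAt)
    (((contDiff_const.mul (h.eg_smooth s)).of_le (by exact_mod_cast le_top)).contDiffAt)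
  rw [this, iteratedDeriv_const_mul_field]

theorem Chi.iter_bound {c d : ℝ} (hc : 0 < c) {chi : ℝ → ℂ} (h : Chi c d chi) (l N : ℕ) :
    ∃ C : ℝ, 0 ≤ C ∧ ∀ s mu : ℝ, 0 ≤ s → (1+s)^N * ‖iteratedDeriv l (EG chi s) mu‖ ≤ C := by
  induction l generalizing chi N with
  | zero =>
    obtain ⟨K, hK⟩ := (HasCompactSupport.intro isCompact_Icc (fun x hx => h.supp x hx)).exists_bound_of_continuous h.smooth.continuous
    have hK0 : 0 ≤ K := (norm_nonneg _).trans (hK 0)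
    -- (1+s)^N exp(-c s) bounded
    obtain ⟨B, hB⟩ : ∃ B : ℝ, ∀ s : ℝ, 0 ≤ s → (1+s)^N * Real.exp (-(c*s)) ≤ B := by
      refine ⟨(N.factorial : ℝ) * (1/c)^N * Real.exp c, fun s hs => ?_⟩
      have h1 := Real.pow_div_factorial_le_exp (x := c*(1+s)) (by positivity) N
      have h2 : Real.exp (c*(1+s)) = Real.exp c * Real.exp (c*s) := by rw [← Real.exp_add]; ring_nf
      have hf : (0:ℝ) < N.factorial := by positivity
      rw [div_le_iff₀ hf, h2, mul_pow] at h1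
      rw [Real.exp_neg, ← div_eq_mul_inv, div_le_iff₀ (Real.exp_pos _), one_div, inv_pow]
      have hcN : 0 < c^N := by positivity
      calc (1+s)^N = (c^N)⁻¹ * (c^N * (1+s)^N) := by field_simp
        _ ≤ (c^N)⁻¹ * (Real.exp c * Real.exp (c*s) * N.factorial) := by gcongr
        _ = _ := by ring
    have hB0 : 0 ≤ B := by have := hB 0 le_rfl; simp at this; linarith
    refine ⟨K * B, by positivity, fun s mu hs => ?_⟩
    rw [iteratedDeriv_zero]
    by_cases hmu : mu ∈ Icc c d
    · rw [EG, norm_mul, Complex.norm_exp]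
      have e : (-(mu:ℂ) * s).re = -(mu*s) := by simp
      rw [e]
      have : Real.exp (-(mu*s)) ≤ Real.exp (-(c*s)) := by
        apply Real.exp_le_exp.2
        have := mul_le_mul_of_nonneg_right hmu.1 hs
        linarith
      calc (1+s)^N * (‖chi mu‖ * Real.exp (-(mu*s))) ≤ (1+s)^N * (K * Real.exp (-(c*s))) := by
            gcongr; exact hK mu
        _ = K * ((1+s)^N * Real.exp (-(c*s))) := by ring
        _ ≤ _ := by gcongr; exact hB s hs
    · rw [h.eg_supp s mu hmu]; simp; positivity
  | succ l ih =>
    obtain ⟨C1, h1, b1⟩ := ih h.deriv N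
    obtain ⟨C2, h2, b2⟩ := ih h (N+1)
    refine ⟨C1 + C2, by positivity, fun s mu hs => ?_⟩
    rw [h.iter_succ]
    calc _ ≤ (1+s)^N * (‖iteratedDeriv l (EG (_root_.deriv chi) s) mu‖ + (1+s) * ‖iteratedDeriv l (EG chi s) mu‖) := by
          gcongr
          refine (norm_sub_le _ _).trans ?_
          rw [norm_mul, Complex.norm_real, Real.norm_of_nonneg hs]
          gcongr; linarith
      _ = (1+s)^N * ‖iteratedDeriv l (EG (_root_.deriv chi) s) mu‖ + (1+s)^(N+1) * ‖iteratedDeriv l (EG chi s) mu‖ := by ring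
      _ ≤ _ := add_le_add (b1 s mu hs) (b2 s mu hs)

theorem Chi.iter_hasDeriv {c d : ℝ} {chi : ℝ → ℂ} (h : Chi c d chi) (l : ℕ) (mu s : ℝ) :
    HasDerivAt (fun s => iteratedDeriv l (EG chi s) mu)
      (- iteratedDeriv l (EG (fun mu => (mu:ℂ) * chi mu) s) mu) s := by
  induction l generalizing chi with
  | zero =>
    simp only [iteratedDeriv_zero, EG]
    have a1 : HasDerivAt (fun s : ℝ => -(mu:ℂ) * s) (-(mu:ℂ) * 1) s :=
      (Complex.ofRealCLM.hasDerivAt (x := s)).const_mul _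
    refine (a1.cexp.const_mul (chi mu)).congr_deriv ?_
    ring
  | succ l ih =>
    have e : (fun s => iteratedDeriv (l+1) (EG chi s) mu) = fun s : ℝ =>
      iteratedDeriv l (EG (_root_.deriv chi) s) mu - (s:ℂ) * iteratedDeriv l (EG chi s) mu := by
      funext s; exact h.iter_succ s l mu
    rw [e]
    have a1 : HasDerivAt (fun s : ℝ => (s:ℂ)) 1 s := Complex.ofRealCLM.hasDerivAt (x := s)
    refine ((ih h.deriv).fun_sub (a1.fun_mul (ih h))).congr_deriv ?_
    rw [h.mulId.iter_succ]
    have e2 : EG (_root_.deriv fun mu : ℝ => (mu:ℂ) * chi mu) s =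
        EG chi s + EG (fun mu => (mu:ℂ) * _root_.deriv chi mu) s := by
      funext mu
      have b1 : HasDerivAt (fun mu : ℝ => (mu:ℂ)) 1 mu := Complex.ofRealCLM.hasDerivAt (x := mu)
      have b2 : HasDerivAt chi (_root_.deriv chi mu) mu :=
        (h.smooth.differentiable (by simp) mu).hasDerivAt
      simp only [EG, Pi.add_apply]
      rw [(b1.fun_mul b2).deriv]; ring
    rw [e2, iteratedDeriv_add]
    · ring
    · exact ((h.eg_smooth s).of_le (by exact_mod_cast le_top)).contDiffAt
    · exact ((h.deriv.mulId.eg_smooth s).of_le (by exact_mod_cast le_top)).contDiffAt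

theorem taylor2 (P P1 P2 : ℝ → ℂ) (C : ℝ) (h1 : ∀ s, HasDerivAt P (P1 s) s) (h2 : ∀ s, HasDerivAt P1 (P2 s) s)
    (hC : ∀ s, 0 ≤ s → ‖P2 s‖ ≤ C) (s s' : ℝ) (hs : 0 ≤ s) (hs' : 0 ≤ s') :
    ‖P s' - P s - ((s'-s:ℝ):ℂ) * P1 s‖ ≤ C * (s'-s)^2 := by
  have hC0 : 0 ≤ C := (norm_nonneg _).trans (hC 0 le_rfl)
  have hsub : ∀ r ∈ uIcc s s', 0 ≤ r := fun r hr => (le_min hs hs').trans hr.1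
  have st : ∀ r ∈ uIcc s s', ‖P1 r - P1 s‖ ≤ C * |s' - s| := by
    intro r hr
    have := (convex_uIcc s s').norm_image_sub_le_of_norm_hasDerivWithin_le (f := P1) (f' := P2) (C := C)
      (fun x _ => (h2 x).hasDerivWithinAt) (fun x hx => hC x (hsub x hx)) left_mem_uIcc hr
    refine this.trans ?_
    gcongr
    exact abs_sub_left_of_mem_uIcc hr
  have a1 : ∀ r : ℝ, HasDerivAt (fun r : ℝ => P r - (r:ℂ) * P1 s) (P1 r - 1 * P1 s) r := fun r =>
    (h1 r).fun_sub ((Complex.ofRealCLM.hasDerivAt (x := r)).mul_const _)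
  have := (convex_uIcc s s').norm_image_sub_le_of_norm_hasDerivWithin_le (f := fun r : ℝ => P r - (r:ℂ) * P1 s)
      (f' := fun r => P1 r - 1 * P1 s) (C := C * |s' - s|)
      (fun x _ => (a1 x).hasDerivWithinAt) (fun x hx => by rw [one_mul]; exact st x hx) left_mem_uIcc right_mem_uIcc
  calc _ = ‖P s' - (s':ℂ) * P1 s - (P s - (s:ℂ) * P1 s)‖ := by congr 1; push_cast; ring
    _ ≤ _ := this
    _ = C * (|s' - s| * |s' - s|) := by rw [Real.norm_eq_abs]; ring
    _ = _ := by rw [abs_mul_abs_self]; ring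

theorem adm_decay {c d : ℝ} (hc : 0 < c) (hd : 0 ≤ d) {chi : ℝ → ℂ} (h : Chi c d chi) (N : ℕ) :
    Adm (Pi := {s : ℝ // 0 ≤ s}) (fun p mu => (((1 + p.1)^N : ℝ) : ℂ) * EG chi p.1 mu) := by
  refine ⟨fun p => contDiff_const.mul (h.eg_smooth _), ⟨d, hd, fun p mu hmu => ?_⟩, fun l => ?_⟩
  · rw [h.eg_supp, mul_zero]; exact fun hh => hmu ⟨hc.le.trans hh.1, hh.2⟩
  · obtain ⟨C, _, hC⟩ := h.iter_bound hc l N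
    refine ⟨C, fun p mu => ?_⟩
    rw [iteratedDeriv_const_mul_field, norm_mul, Complex.norm_real, Real.norm_of_nonneg (by have := p.2; positivity)]
    exact hC _ mu p.2

theorem adm_taylor {c d : ℝ} (hc : 0 < c) (hd : 0 ≤ d) {chi : ℝ → ℂ} (h : Chi c d chi) :
    Adm (Pi := {s : ℝ × ℝ // 0 ≤ s.1 ∧ 0 ≤ s.2 ∧ s.2 - s.1 ≠ 0}) (fun p mu => ((((p.1.2 - p.1.1)^2)⁻¹ : ℝ) : ℂ) *
      (EG chi p.1.2 mu - EG chi p.1.1 mu + ((p.1.2 - p.1.1 : ℝ):ℂ) * EG (fun mu => (mu:ℂ) * chi mu) p.1.1 mu)) := by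
  have sm : ∀ s s' : ℝ, ContDiff ℝ ∞ (fun mu => EG chi s' mu - EG chi s mu + ((s' - s : ℝ):ℂ) * EG (fun mu => (mu:ℂ) * chi mu) s mu) :=
    fun s s' => ((h.eg_smooth _).sub (h.eg_smooth _)).add (contDiff_const.mul (h.mulId.eg_smooth _))
  refine ⟨fun p => contDiff_const.mul (sm _ _), ⟨d, hd, fun p mu hmu => ?_⟩, fun l => ?_⟩
  · have : mu ∉ Icc c d := fun hh => hmu ⟨hc.le.trans hh.1, hh.2⟩
    rw [h.eg_supp _ _ this, h.eg_supp _ _ this, h.mulId.eg_supp _ _ this]; simp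
  · obtain ⟨C, hC0, hC⟩ := h.mulId.mulId.iter_bound hc l 0
    refine ⟨C, fun p mu => ?_⟩
    obtain ⟨⟨s, s'⟩, hs, hs', hne⟩ := p
    simp only at hs hs' hne ⊢
    rw [iteratedDeriv_const_mul_field, norm_mul, Complex.norm_real, Real.norm_of_nonneg (by positivity),
      inv_mul_le_iff₀ (by positivity)]
    have hl : ∀ {f : ℝ → ℂ}, ContDiff ℝ ∞ f → ContDiffAt ℝ l f mu := fun hf =>
      (hf.of_le (by exact_mod_cast le_top)).contDiffAt
    rw [iteratedDeriv_fun_add (hl ((h.eg_smooth _).sub (h.eg_smooth _))) (hl (contDiff_const.mul (h.mulId.eg_smooth _))),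
      iteratedDeriv_fun_sub (hl (h.eg_smooth _)) (hl (h.eg_smooth _)), iteratedDeriv_const_mul_field]
    have := taylor2 (fun s => iteratedDeriv l (EG chi s) mu)
      (fun s => - iteratedDeriv l (EG (fun mu => (mu:ℂ) * chi mu) s) mu)
      (fun s => - - iteratedDeriv l (EG (fun mu => (mu:ℂ) * ((mu:ℂ) * chi mu)) s) mu) C
      (fun s => h.iter_hasDeriv l mu s) (fun s => (h.mulId.iter_hasDeriv l mu s).fun_neg)
      (fun s hs => by have := hC s mu hs; simpa using this) s s' hs hs'
    rw [mul_comm C] at this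
    simpa only [mul_neg, sub_neg_eq_add] using this

end

section

open scoped ContDiff SchwartzMap

section
variable {E : Type} [NormedAddCommGroup E] [NormedSpace ℝ E]

def IsSch (u : E → ℂ) : Prop :=
  ContDiff ℝ ∞ u ∧ ∀ a b : ℕ, ∃ C : ℝ, ∀ x, ‖x‖ ^ a * ‖iteratedFDeriv ℝ b u x‖ ≤ C

open Classical in
def toS (u : E → ℂ) : 𝓢(E, ℂ) := if h : IsSch u then ⟨u, h.1, h.2⟩ else 0

theorem toS_apply {u : E → ℂ} (h : IsSch u) (x : E) : toS u x = u x := by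
  rw [toS, dif_pos h]; rfl

theorem toS_coe {u : E → ℂ} (h : IsSch u) : (toS u : E → ℂ) = u := funext fun x => toS_apply h x

/-- kernel data -/
def KDat (z : E → ℂ) (Q : ℝ → E → ℂ) : Prop :=
  ZDat z ∧ ∃ (ι : Type) (s : Finset ι) (m : ι → ℕ) (c : ι → E → ℂ), (∀ i ∈ s, Mult (c i)) ∧
    ∀ mu x, Q mu x = (∑ i ∈ s, (mu:ℂ)^(m i) * c i x) * Complex.exp (Complex.I * mu * z x)

def KI (Q : ℝ → E → ℂ) (psi : ℝ → ℂ) (x : E) : ℂ := ∫ mu : ℝ, psi mu * Q mu x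

theorem Adm.mulPow {Pi : Type} {Psi : Pi → ℝ → ℂ} (h : Adm Psi) (m : ℕ) :
    Adm (fun p mu => (mu:ℂ)^m * Psi p mu) := by
  induction m with
  | zero => simpa using h
  | succ m ih => simpa only [pow_succ', one_mul, mul_assoc] using ih.mulI 1

theorem KI_expand {z : E → ℂ} {Q : ℝ → E → ℂ} {Pi : Type} {Psi : Pi → ℝ → ℂ} (h : Adm Psi) {ι : Type} (s : Finset ι)
    (m : ι → ℕ) (c : ι → E → ℂ)
    (hQ : ∀ mu x, Q mu x = (∑ i ∈ s, (mu:ℂ)^(m i) * c i x) * Complex.exp (Complex.I * mu * z x)) (p : Pi) (x : E) :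
    Integrable (fun mu => Psi p mu * Q mu x) ∧
    KI Q (Psi p) x = ∑ i ∈ s, c i x * PhiT (fun mu => (mu:ℂ)^(m i) * Psi p mu) (z x) := by
  have e : (fun mu => Psi p mu * Q mu x) = fun mu : ℝ =>
      ∑ i ∈ s, c i x * ((mu:ℂ)^(m i) * Psi p mu * Complex.exp (Complex.I * mu * z x)) := by
    funext mu
    rw [hQ, Finset.sum_mul, Finset.mul_sum]
    exact Finset.sum_congr rfl fun i _ => by ring
  have hi : ∀ i ∈ s, Integrable (fun mu : ℝ => c i x * ((mu:ℂ)^(m i) * Psi p mu * Complex.exp (Complex.I * mu * z x))) :=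
    fun i _ => ((h.mulPow (m i)).integrable p (z x)).const_mul _
  refine ⟨by rw [e]; exact integrable_finsetSum _ hi, ?_⟩
  rw [KI, e, integral_finsetSum _ hi]
  refine Finset.sum_congr rfl fun i _ => ?_
  rw [integral_const_mul]; rfl

theorem KI_integrable {z : E → ℂ} {Q : ℝ → E → ℂ} (hQ : KDat z Q) {Pi : Type} {Psi : Pi → ℝ → ℂ} (h : Adm Psi) (p : Pi) (x : E) :
    Integrable (fun mu => Psi p mu * Q mu x) := by
  obtain ⟨hz, ι, s, m, c, hc, hQ⟩ := hQ
  exact (KI_expand h s m c hQ p x).1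

theorem KI_bound {z : E → ℂ} {Q : ℝ → E → ℂ} (hQ : KDat z Q) {Pi : Type} {Psi : Pi → ℝ → ℂ} (h : Adm Psi) :
    (∀ p, ContDiff ℝ ∞ (KI Q (Psi p))) ∧
    ∀ a b : ℕ, ∃ C : ℝ, ∀ p x, ‖x‖ ^ a * ‖iteratedFDeriv ℝ b (KI Q (Psi p)) x‖ ≤ C := by
  obtain ⟨hz, ι, s, m, c, hc, hQ⟩ := hQ
  have e : ∀ p, KI Q (Psi p) = fun x => ∑ i ∈ s, c i x * PhiT (fun mu => (mu:ℂ)^(m i) * Psi p mu) (z x) :=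
    fun p => funext fun x => (KI_expand h s m c hQ p x).2
  have cl := ClZ_closed hz Pi
  have hcl : ∀ i ∈ s, ClZ z Pi (fun p x => c i x * PhiT (fun mu => (mu:ℂ)^(m i) * Psi p mu) (z x)) :=
    fun i hi => ⟨c i, _, hc i hi, h.mulPow (m i), rfl⟩
  refine ⟨fun p => ?_, fun a b => ?_⟩
  · rw [e]
    exact ContDiff.sum fun i hi => cl.smooth (hcl i hi) p
  · choose! C hC using fun i hi => cl.bound a b (hcl i hi)
    refine ⟨∑ i ∈ s, C i, fun p x => ?_⟩
    rw [e, iteratedFDeriv_fun_sum_apply (fun i hi => ((cl.smooth (hcl i hi) p).of_le (by exact_mod_cast le_top)).contDiffAt)]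
    calc _ ≤ ‖x‖ ^ a * ∑ i ∈ s, ‖iteratedFDeriv ℝ b (fun x => c i x * PhiT (fun mu => (mu:ℂ)^(m i) * Psi p mu) (z x)) x‖ := by
          gcongr; exact norm_sum_le _ _
      _ = ∑ i ∈ s, ‖x‖ ^ a * ‖iteratedFDeriv ℝ b (fun x => c i x * PhiT (fun mu => (mu:ℂ)^(m i) * Psi p mu) (z x)) x‖ := by
          rw [Finset.mul_sum]
      _ ≤ _ := Finset.sum_le_sum fun i hi => hC i hi p x

theorem KI_isSch {z : E → ℂ} {Q : ℝ → E → ℂ} (hQ : KDat z Q) {Pi : Type} {Psi : Pi → ℝ → ℂ} (h : Adm Psi) (p : Pi) :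
    IsSch (KI Q (Psi p)) := by
  obtain ⟨h1, h2⟩ := KI_bound hQ h
  refine ⟨h1 p, fun a b => ?_⟩
  obtain ⟨C, hC⟩ := h2 a b
  exact ⟨C, hC p⟩

theorem KI_seminorm {z : E → ℂ} {Q : ℝ → E → ℂ} (hQ : KDat z Q) {Pi : Type} {Psi : Pi → ℝ → ℂ} (h : Adm Psi)
    (q : Seminorm ℂ 𝓢(E, ℂ)) (hq : Continuous q) : ∃ C : ℝ, 0 ≤ C ∧ ∀ p, q (toS (KI Q (Psi p))) ≤ C := by
  obtain ⟨h1, h2⟩ := KI_bound hQ h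
  obtain ⟨s, C, hC0, hC⟩ := Seminorm.bound_of_continuous (schwartz_withSeminorms ℂ E ℂ) q hq
  choose B hB using h2
  refine ⟨C * ∑ i ∈ s, |B i.1 i.2|, by positivity, fun p => ?_⟩
  refine (hC _).trans ?_
  rw [Seminorm.smul_apply, NNReal.smul_def, smul_eq_mul]
  gcongr
  refine Seminorm.finset_sup_apply_le (by positivity) fun i hi => ?_
  refine (SchwartzMap.seminorm_le_bound ℂ i.1 i.2 _ (abs_nonneg (B i.1 i.2)) fun x => ?_).trans
    (Finset.single_le_sum (f := fun i : ℕ × ℕ => |B i.1 i.2|) (fun i _ => abs_nonneg _) hi)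
  rw [toS_coe (KI_isSch hQ h p)]
  exact (hB i.1 i.2 p x).trans (le_abs_self _)

theorem Chi.adm {c d : ℝ} (hc : 0 < c) (hd : 0 ≤ d) {chi : ℝ → ℂ} (h : Chi c d chi) : Adm (Pi := Unit) (fun _ => chi) := by
  refine ⟨fun _ => h.smooth, ⟨d, hd, fun _ mu hmu => h.supp mu fun hh => hmu ⟨hc.le.trans hh.1, hh.2⟩⟩, fun l => ?_⟩
  obtain ⟨C, _, hC⟩ := h.iter_bound hc l 0
  refine ⟨C, fun _ mu => ?_⟩
  have e : EG chi 0 = chi := by funext x; simp [EG]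
  have := hC 0 mu le_rfl
  rwa [e, pow_zero, one_mul] at this

theorem Chi.eg {c d : ℝ} {chi : ℝ → ℂ} (h : Chi c d chi) (s : ℝ) : Chi c d (EG chi s) :=
  ⟨h.eg_smooth s, h.eg_supp s⟩

theorem KS_apply {c d : ℝ} (hc : 0 < c) (hd : 0 ≤ d) {z : E → ℂ} {Q : ℝ → E → ℂ} (hQ : KDat z Q) {chi : ℝ → ℂ} (h : Chi c d chi) (x : E) :
    toS (KI Q chi) x = KI Q chi x := toS_apply (KI_isSch hQ (h.adm hc hd) ()) x

def eFam (Q : ℝ → E → ℂ) (chi : ℝ → ℂ) (j : ℕ) (s : ℝ) : 𝓢(E, ℂ) :=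
  toS (KI Q (EG (fun mu => (mu:ℂ)^j * chi mu) s))

theorem famHyp_of_kernel {c d : ℝ} (hc : 0 < c) (hd : 0 ≤ d) {z : E → ℂ} {Q : ℝ → E → ℂ} (hQ : KDat z Q)
    {chi : ℝ → ℂ} (h : Chi c d chi) (L T : 𝓢(E, ℂ) →ₗ[ℂ] 𝓢(E, ℂ)) (b : ℝ)
    (hL : ∀ psi, Chi c d psi → L (toS (KI Q psi)) = (b:ℂ) • toS (KI Q (fun mu => (mu:ℂ) * psi mu)))
    (hT : ∀ psi, Chi c d psi → T (toS (KI Q psi)) = - toS (KI Q (fun mu => (mu:ℂ) * ((mu:ℂ) * psi mu)))) :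
    FamHyp L T (eFam Q chi) b := by
  have eq1 : ∀ j s, (fun mu : ℝ => (mu:ℂ) * EG (fun mu => (mu:ℂ)^j * chi mu) s mu) =
      EG (fun mu => (mu:ℂ)^(j+1) * chi mu) s := by
    intro j s; funext mu; simp only [EG]; ring
  refine ⟨fun j s hs => ?_, fun j s hs => ?_, fun q hq j N => ?_, fun q hq j => ?_⟩
  · rw [eFam, hL _ ((h.mulPow j).eg s), eq1]; rfl
  · rw [eFam, hT _ ((h.mulPow j).eg s)]
    have e3 : (fun mu : ℝ => (mu:ℂ) * ((mu:ℂ) * EG (fun mu => (mu:ℂ)^j * chi mu) s mu)) =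
        EG (fun mu => (mu:ℂ)^(j+2) * chi mu) s := by
      funext mu; simp only [EG]; ring
    rw [e3]; rfl
  · have ad := adm_decay hc hd (h.mulPow j) N
    obtain ⟨C, hC0, hC⟩ := KI_seminorm hQ ad q hq
    refine ⟨C, hC0, fun s hs => ?_⟩
    refine le_trans (le_of_eq ?_) (hC ⟨s, hs⟩)
    have : toS (KI Q (fun mu => (((1 + s)^N : ℝ) : ℂ) * EG (fun mu => (mu:ℂ)^j * chi mu) s mu)) =
        (((1 + s)^N : ℝ) : ℂ) • eFam Q chi j s := by
      ext x
      rw [SchwartzMap.smul_apply, eFam, KS_apply hc hd hQ ((h.mulPow j).eg s)]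
      rw [toS_apply (KI_isSch hQ ad ⟨s, hs⟩)]
      simp only [KI, mul_assoc, smul_eq_mul]
      rw [integral_const_mul]
    show _ = q (toS (KI Q (fun mu => (((1 + s)^N : ℝ) : ℂ) * EG (fun mu => (mu:ℂ)^j * chi mu) s mu)))
    rw [this, map_smul_eq_mul, Complex.norm_real, Real.norm_of_nonneg (by positivity)]
  · have ad := adm_taylor hc hd (h.mulPow j)
    obtain ⟨C, hC0, hC⟩ := KI_seminorm hQ ad q hq
    refine ⟨C, hC0, fun s s' hs hs' => ?_⟩
    by_cases hne : s' - s = 0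
    · have : s' = s := by linarith
      subst this; simp
    have hp := hC ⟨(s, s'), hs, hs', hne⟩
    have eq2 : (fun mu : ℝ => (mu:ℂ) * ((mu:ℂ)^j * chi mu)) = fun mu : ℝ => (mu:ℂ)^(j+1) * chi mu := by
      funext mu; ring
    simp only [eq2] at hp ad
    have : toS (KI Q (fun mu => ((((s' - s)^2)⁻¹ : ℝ) : ℂ) *
      (EG (fun mu => (mu:ℂ)^j * chi mu) s' mu - EG (fun mu => (mu:ℂ)^j * chi mu) s mu + ((s' - s : ℝ):ℂ) * EG (fun mu => (mu:ℂ)^(j+1) * chi mu) s mu))) =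
        ((((s' - s)^2)⁻¹ : ℝ) : ℂ) • (eFam Q chi j s' - eFam Q chi j s + ((s'-s:ℝ):ℂ) • eFam Q chi (j+1) s) := by
      ext x
      have i1 := KI_integrable hQ (((h.mulPow j).eg s').adm hc hd) () x
      have i2 := KI_integrable hQ (((h.mulPow j).eg s).adm hc hd) () x
      have i3 := KI_integrable hQ (((h.mulPow (j+1)).eg s).adm hc hd) () x
      rw [SchwartzMap.smul_apply, SchwartzMap.add_apply, SchwartzMap.sub_apply, SchwartzMap.smul_apply,
        eFam, eFam, eFam, KS_apply hc hd hQ ((h.mulPow j).eg s), KS_apply hc hd hQ ((h.mulPow j).eg s'),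
        KS_apply hc hd hQ ((h.mulPow (j+1)).eg s)]
      rw [toS_apply (KI_isSch hQ ad ⟨(s, s'), hs, hs', hne⟩)]
      simp only [KI, smul_eq_mul]
      rw [← integral_const_mul, ← integral_sub i1 i2, ← integral_add (by exact i1.sub i2) (i3.const_mul _), ← integral_const_mul]
      congr 1; funext mu
      ring
    rw [this, map_smul_eq_mul, Complex.norm_real, Real.norm_of_nonneg (by positivity),
      inv_mul_le_iff₀ (by positivity), mul_comm] at hp
    exact hp

end

end

section

open scoped ContDiff

def JS (n : ℕ) (G : ℝ → Hn n → ℂ) : Prop := ContDiff ℝ ∞ (fun q : ℝ × Hn n => G q.1 q.2)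

theorem JS.fd {n : ℕ} {G : ℝ → Hn n → ℂ} (h : JS n G) (mu : ℝ) (x : Hn n) :
    HasFDerivAt (G mu) ((fderiv ℝ (fun q : ℝ × Hn n => G q.1 q.2) (mu, x)).comp
      (ContinuousLinearMap.inr ℝ ℝ (Hn n))) x := by
  have h1 := (h.differentiable (by simp) (mu, x)).hasFDerivAt
  exact h1.comp x (hasFDerivAt_prodMk_right mu x)

theorem JS.dirD {n : ℕ} {G : ℝ → Hn n → ℂ} (h : JS n G) (v : Hn n) : JS n (fun mu => dirD v (G mu)) := by
  have : (fun q : ℝ × Hn n => _root_.dirD v (G q.1) q.2) =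
      fun q => fderiv ℝ (fun q : ℝ × Hn n => G q.1 q.2) q (0, v) := by
    funext q
    simp only [_root_.dirD]
    rw [(h.fd q.1 q.2).fderiv]
    simp
  unfold JS
  rw [this]
  exact (h.fderiv_right (m := ∞) (by simp)).clm_apply contDiff_const

theorem JS.POp {n : ℕ} {G : ℝ → Hn n → ℂ} (h : JS n G) (v : Hn n) {c : Hn n → ℂ} (hc : GoodC n c) :
    JS n (fun mu => POp n v c (G mu)) := by
  have h1 := h.dirD v
  have h2 := h.dirD (eT n)
  have h3 : ContDiff ℝ ∞ (fun q : ℝ × Hn n => c q.2) := hc.smooth.comp contDiff_snd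
  exact h1.add (h3.mul h2)

theorem JS.integrable {n : ℕ} {G : ℝ → Hn n → ℂ} (h : JS n G) {psi : ℝ → ℂ} (hp : Continuous psi)
    (hs : HasCompactSupport psi) (x : Hn n) : Integrable (fun mu => psi mu * G mu x) := by
  refine Continuous.integrable_of_hasCompactSupport (hp.mul ?_) hs.mul_right
  exact h.continuous.comp (continuous_id.prodMk continuous_const)

theorem param_hasFDerivAt {E : Type} [NormedAddCommGroup E] [NormedSpace ℝ E] [ProperSpace E] {G : ℝ → E → ℂ}
    {G' : ℝ × E → E →L[ℝ] ℂ} (hc : Continuous G') (hG : ∀ mu x, HasFDerivAt (G mu) (G' (mu, x)) x) {psi : ℝ → ℂ} (hp : Continuous psi)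
    (hs : HasCompactSupport psi) (hi : ∀ x, Integrable (fun mu => psi mu * G mu x)) (x : E) :
    Integrable (fun mu => psi mu • G' (mu, x)) ∧
    HasFDerivAt (KI G psi) (∫ mu, psi mu • G' (mu, x)) x := by
  obtain ⟨B, hB⟩ := (hs.isCompact.prod (isCompact_closedBall x 1)).exists_bound_of_continuousOn hc.continuousOn
  have hcx : ∀ x, Continuous (fun mu => G' (mu, x)) := fun x => hc.comp (continuous_id.prodMk continuous_const)
  have hcs : HasCompactSupport (fun mu => psi mu • G' (mu, x)) :=
    HasCompactSupport.intro hs.isCompact (fun mu hmu => by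
      rw [image_eq_zero_of_notMem_tsupport hmu]; ext v; simp)
  have hcc : Continuous (fun mu => psi mu • G' (mu, x)) := hp.smul (hcx x)
  refine ⟨hcc.integrable_of_hasCompactSupport hcs, ?_⟩
  refine hasFDerivAt_integral_of_dominated_of_fderiv_le (𝕜 := ℝ) (F := fun x mu => psi mu * G mu x)
    (F' := fun x mu => psi mu • G' (mu, x)) (bound := fun mu => ‖psi mu‖ * B)
    (Metric.ball_mem_nhds x one_pos) ?_ ?_ ?_ ?_ ?_ ?_
  · exact Eventually.of_forall fun y => (hi y).aestronglyMeasurable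
  · exact hi x
  · exact (hp.smul (hcx x)).aestronglyMeasurable
  · refine Eventually.of_forall fun mu y hy => ?_
    rw [norm_smul]
    by_cases hmu : mu ∈ tsupport psi
    · gcongr
      exact hB (mu, y) ⟨hmu, Metric.ball_subset_closedBall hy⟩
    · rw [image_eq_zero_of_notMem_tsupport hmu]; simp
  · exact (Continuous.integrable_of_hasCompactSupport hp hs).norm.mul_const _
  · refine Eventually.of_forall fun mu y _ => ?_
    exact (hG mu y).const_mul (psi mu)

theorem KI_hasFDerivAt {n : ℕ} {G : ℝ → Hn n → ℂ} (h : JS n G) {psi : ℝ → ℂ} (hp : Continuous psi)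
    (hs : HasCompactSupport psi) (x : Hn n) :
    Integrable (fun mu => psi mu • fderiv ℝ (G mu) x) ∧
    HasFDerivAt (KI G psi) (∫ mu, psi mu • fderiv ℝ (G mu) x) x := by
  have e : ∀ mu x, fderiv ℝ (G mu) x = (fderiv ℝ (fun q : ℝ × Hn n => G q.1 q.2) (mu, x)).comp
      (ContinuousLinearMap.inr ℝ ℝ (Hn n)) := fun mu x => (h.fd mu x).fderiv
  have hc : Continuous (fun q : ℝ × Hn n => fderiv ℝ (G q.1) q.2) := by
    have : (fun q : ℝ × Hn n => fderiv ℝ (G q.1) q.2) = fun q => (fderiv ℝ (fun q : ℝ × Hn n => G q.1 q.2) q).comp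
      (ContinuousLinearMap.inr ℝ ℝ (Hn n)) := funext fun q => e q.1 q.2
    rw [this]
    exact (h.continuous_fderiv (by simp)).clm_comp continuous_const
  exact param_hasFDerivAt (G' := fun q : ℝ × Hn n => fderiv ℝ (G q.1) q.2) hc
    (fun mu x => (h.fd mu x).differentiableAt.hasFDerivAt) hp hs (fun x => h.integrable hp hs x) x

theorem KI_dirD {n : ℕ} {G : ℝ → Hn n → ℂ} (h : JS n G) {psi : ℝ → ℂ} (hp : Continuous psi)
    (hs : HasCompactSupport psi) (v : Hn n) :
    dirD v (KI G psi) = KI (fun mu => dirD v (G mu)) psi := by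
  funext x
  obtain ⟨h1, h2⟩ := KI_hasFDerivAt h hp hs x
  rw [dirD, h2.fderiv, ContinuousLinearMap.integral_apply h1]
  rfl

theorem KI_POp {n : ℕ} {G : ℝ → Hn n → ℂ} (h : JS n G) {psi : ℝ → ℂ} (hp : Continuous psi)
    (hs : HasCompactSupport psi) (v : Hn n) (c : Hn n → ℂ) :
    POp n v c (KI G psi) = KI (fun mu => POp n v c (G mu)) psi := by
  funext x
  rw [POp, KI_dirD h hp hs, KI_dirD h hp hs, KI, KI, ← integral_const_mul, ← integral_add
    ((h.dirD v).integrable hp hs x) (((h.dirD (eT n)).integrable hp hs x).const_mul _), KI]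
  congr 1; funext mu; simp only [POp]; ring

theorem KI_POp2 {n : ℕ} {G : ℝ → Hn n → ℂ} (h : JS n G) {psi : ℝ → ℂ} (hp : Continuous psi)
    (hs : HasCompactSupport psi) (v : Hn n) {c : Hn n → ℂ} (hc : GoodC n c) :
    POp n v c (POp n v c (KI G psi)) = KI (fun mu => POp n v c (POp n v c (G mu))) psi := by
  rw [KI_POp h hp hs, KI_POp (h.POp v hc) hp hs]

/-- eigen relations pass to the integral -/
theorem KI_LV {n : ℕ} {G : ℝ → Hn n → ℂ} (h : JS n G) {psi : ℝ → ℂ} (hp : Continuous psi)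
    (hs : HasCompactSupport psi) (b : ℝ)
    (hb : ∀ mu w, -(1/4) * ∑ j, (XH n j (XH n j (G mu)) w + YH n j (YH n j (G mu)) w) = (b:ℂ) * (mu:ℂ) * G mu w)
    (w : Hn n) :
    -(1/4) * ∑ j, (XH n j (XH n j (KI G psi)) w + YH n j (YH n j (KI G psi)) w) = (b:ℂ) * KI G (fun mu => (mu:ℂ) * psi mu) w := by
  have i1 : ∀ j, Integrable (fun mu => psi mu * XH n j (XH n j (G mu)) w) := fun j => by
    rw [XH_eq]; exact ((h.POp _ (goodC_X n j)).POp _ (goodC_X n j)).integrable hp hs w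
  have i2 : ∀ j, Integrable (fun mu => psi mu * YH n j (YH n j (G mu)) w) := fun j => by
    rw [YH_eq]; exact ((h.POp _ (goodC_Y n j)).POp _ (goodC_Y n j)).integrable hp hs w
  have e1 : ∀ j, XH n j (XH n j (KI G psi)) w + YH n j (YH n j (KI G psi)) w =
      ∫ mu, (psi mu * XH n j (XH n j (G mu)) w + psi mu * YH n j (YH n j (G mu)) w) := by
    intro j
    rw [integral_add (i1 j) (i2 j), XH_eq, YH_eq, KI_POp2 h hp hs _ (goodC_X n j), KI_POp2 h hp hs _ (goodC_Y n j)]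
    rfl
  rw [Finset.sum_congr rfl fun j _ => e1 j, ← integral_finsetSum _ (fun j _ => by exact (i1 j).add (i2 j)), ← integral_const_mul, KI,
    ← integral_const_mul]
  congr 1; funext mu
  have := hb mu w
  calc _ = psi mu * (-(1/4) * ∑ j, (XH n j (XH n j (G mu)) w + YH n j (YH n j (G mu)) w)) := by
        simp only [← mul_add, ← Finset.mul_sum]; ring
    _ = _ := by rw [this]; ring

theorem KI_TV {n : ℕ} {G : ℝ → Hn n → ℂ} (h : JS n G) {psi : ℝ → ℂ} (hp : Continuous psi)
    (hs : HasCompactSupport psi)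
    (hb : ∀ mu w, TH n (TH n (G mu)) w = - ((mu:ℂ) * (mu:ℂ) * G mu w))
    (w : Hn n) :
    TH n (TH n (KI G psi)) w = - KI G (fun mu => (mu:ℂ) * ((mu:ℂ) * psi mu)) w := by
  rw [POp_zero_coeff, KI_POp2 h hp hs _ (goodC_zero n), ← POp_zero_coeff, KI, KI, ← integral_neg]
  congr 1; funext mu
  rw [hb]; ring

end

section

open scoped ContDiff

def lagA (k i : ℕ) : ℂ := (-1)^i * (k.choose i : ℂ) / (i.factorial : ℂ)

def lag (k : ℕ) : Polynomial ℂ := ∑ i ∈ Finset.range (k+1), Polynomial.C (lagA k i) * Polynomial.X ^ i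

theorem lag_coeff (k i : ℕ) : (lag k).coeff i = lagA k i := by
  rw [lag, Polynomial.finset_sum_coeff]
  simp only [Polynomial.coeff_C_mul, Polynomial.coeff_X_pow, mul_ite, mul_one, mul_zero]
  rw [Finset.sum_ite_eq]
  split_ifs with h
  · rfl
  · have : k < i := by simpa [Nat.lt_succ_iff] using h
    simp [lagA, Nat.choose_eq_zero_of_lt this]

theorem lagA_rec (k i : ℕ) : ((i:ℂ)+1)^2 * lagA k (i+1) + ((k:ℂ) - i) * lagA k i = 0 := by
  have h1 : (k.choose (i+1) : ℂ) * (i+1) = (k.choose i : ℂ) * ((k:ℂ) - i) := by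
    by_cases h : i ≤ k
    · have := Nat.choose_succ_right_eq k i
      have h2 : ((k.choose (i+1) * (i+1) : ℕ) : ℂ) = ((k.choose i * (k - i) : ℕ) : ℂ) := by rw [this]
      push_cast [Nat.cast_sub h] at h2
      exact h2
    · rw [Nat.choose_eq_zero_of_lt (by omega : k < i), Nat.choose_eq_zero_of_lt (by omega : k < i + 1)]; simp
  have hf : (i.factorial : ℂ) ≠ 0 := by exact_mod_cast i.factorial_ne_zero
  have hi : (i:ℂ) + 1 ≠ 0 := by exact_mod_cast i.succ_ne_zero
  simp only [lagA, Nat.factorial_succ]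
  push_cast
  field_simp
  linear_combination ((-1:ℂ)^(i+1)) * h1

theorem lag_ode (k : ℕ) : Polynomial.X * (lag k).derivative.derivative + (1 - Polynomial.X) * (lag k).derivative
    + Polynomial.C (k:ℂ) * lag k = 0 := by
  ext i
  rw [sub_mul, one_mul]
  cases i with
  | zero =>
    have := lagA_rec k 0
    simp [Polynomial.coeff_derivative, lag_coeff, Polynomial.mul_coeff_zero] at this ⊢
    linear_combination this
  | succ i =>
    have := lagA_rec k (i+1)
    simp only [Polynomial.coeff_add, Polynomial.coeff_sub, Polynomial.coeff_X_mul, Polynomial.coeff_derivative,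
      lag_coeff, Polynomial.coeff_C_mul, Polynomial.coeff_zero]
    push_cast at this ⊢
    linear_combination this

def Lam (mu : ℝ) (k : ℕ) (r : ℝ) : ℂ := (lag k).eval (2 * mu * r : ℂ) * Complex.exp (-(mu * r : ℂ))
def Lam1 (mu : ℝ) (k : ℕ) (r : ℝ) : ℂ :=
  (2 * mu * (lag k).derivative.eval (2 * mu * r : ℂ) - mu * (lag k).eval (2 * mu * r : ℂ)) * Complex.exp (-(mu * r : ℂ))
def Lam2 (mu : ℝ) (k : ℕ) (r : ℝ) : ℂ :=
  (4 * mu^2 * (lag k).derivative.derivative.eval (2 * mu * r : ℂ) - 4 * mu^2 * (lag k).derivative.eval (2 * mu * r : ℂ)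
    + mu^2 * (lag k).eval (2 * mu * r : ℂ)) * Complex.exp (-(mu * r : ℂ))

theorem hasDeriv_poly (P : Polynomial ℂ) (mu r : ℝ) :
    HasDerivAt (fun r : ℝ => P.eval (2 * mu * r : ℂ)) (P.derivative.eval (2 * mu * r : ℂ) * (2 * mu * 1)) r := by
  have a1 : HasDerivAt (fun r : ℝ => (2 * mu * r : ℂ)) (2 * mu * 1) r :=
    (Complex.ofRealCLM.hasDerivAt (x := r)).const_mul _
  exact (P.hasDerivAt (2 * mu * r : ℂ)).comp r a1

theorem hasDeriv_ex (mu r : ℝ) :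
    HasDerivAt (fun r : ℝ => Complex.exp (-(mu * r : ℂ))) (Complex.exp (-(mu * r : ℂ)) * (-(mu * 1))) r := by
  have a1 : HasDerivAt (fun r : ℝ => (mu * r : ℂ)) (mu * 1) r :=
    (Complex.ofRealCLM.hasDerivAt (x := r)).const_mul _
  exact a1.fun_neg.cexp

theorem Lam_deriv (mu : ℝ) (k : ℕ) (r : ℝ) : HasDerivAt (Lam mu k) (Lam1 mu k r) r := by
  refine ((hasDeriv_poly (lag k) mu r).fun_mul (hasDeriv_ex mu r)).congr_deriv ?_
  simp only [Lam1]; ring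

theorem Lam1_deriv (mu : ℝ) (k : ℕ) (r : ℝ) : HasDerivAt (Lam1 mu k) (Lam2 mu k r) r := by
  refine ((((hasDeriv_poly (lag k).derivative mu r).const_mul (2 * mu : ℂ)).fun_sub
    ((hasDeriv_poly (lag k) mu r).const_mul (mu:ℂ))).fun_mul (hasDeriv_ex mu r)).congr_deriv ?_
  simp only [Lam2]; ring

theorem Lam_ode (mu : ℝ) (k : ℕ) (r : ℝ) :
    4 * Lam1 mu k r + 4 * r * Lam2 mu k r - 4 * mu^2 * r * Lam mu k r = -(4 * mu * (2 * k + 1)) * Lam mu k r := by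
  have := congrArg (Polynomial.eval (2 * mu * r : ℂ)) (lag_ode k)
  simp only [Polynomial.eval_add, Polynomial.eval_mul, Polynomial.eval_sub, Polynomial.eval_X, Polynomial.eval_one,
    Polynomial.eval_C, Polynomial.eval_zero] at this
  simp only [Lam, Lam1, Lam2]
  linear_combination (8 * mu * Complex.exp (-(mu * r : ℂ))) * this

def gk (mu : ℝ) (k : ℕ) (z : ℂ) : ℂ := Lam mu k (z.re^2 + z.im^2)

def DXg (a : ℝ) (g : ℂ → ℂ) (z : ℂ) : ℂ := fderiv ℝ g z 1 + 2 * Complex.I * a * z.im * g z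
def DYg (a : ℝ) (g : ℂ → ℂ) (z : ℂ) : ℂ := fderiv ℝ g z Complex.I - 2 * Complex.I * a * z.re * g z

theorem re_smooth : ContDiff ℝ ∞ (fun z : ℂ => z.re) := Complex.reCLM.contDiff
theorem im_smooth : ContDiff ℝ ∞ (fun z : ℂ => z.im) := Complex.imCLM.contDiff
theorem ofReal_smooth : ContDiff ℝ ∞ (fun z : ℝ => (z:ℂ)) := Complex.ofRealCLM.contDiff

theorem poly_smooth {E : Type} [NormedAddCommGroup E] [NormedSpace ℝ E] (P : Polynomial ℂ) {u : E → ℂ} (hu : ContDiff ℝ ∞ u) :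
    ContDiff ℝ ∞ (fun x => P.eval (u x)) := by
  simp only [Polynomial.eval_eq_sum_range]
  exact ContDiff.sum fun i _ => contDiff_const.mul (hu.pow i)

theorem gk_joint (k : ℕ) : ContDiff ℝ ∞ (fun q : ℝ × ℂ => gk q.1 k q.2) := by
  have h1 : ContDiff ℝ ∞ (fun q : ℝ × ℂ => ((q.1:ℝ):ℂ)) := ofReal_smooth.comp contDiff_fst
  have h2 : ContDiff ℝ ∞ (fun q : ℝ × ℂ => (((q.2.re^2 + q.2.im^2 : ℝ)):ℂ)) :=
    ofReal_smooth.comp (((re_smooth.comp contDiff_snd).pow 2).add ((im_smooth.comp contDiff_snd).pow 2))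
  exact (poly_smooth (lag k) ((contDiff_const.mul h1).mul h2)).mul (h1.mul h2).neg.cexp

theorem gk_smooth (mu : ℝ) (k : ℕ) : ContDiff ℝ ∞ (gk mu k) := by
  have h2 : ContDiff ℝ ∞ (fun q : ℂ => (((q.re^2 + q.im^2 : ℝ)):ℂ)) :=
    ofReal_smooth.comp ((re_smooth.pow 2).add (im_smooth.pow 2))
  exact (poly_smooth (lag k) (contDiff_const.mul h2)).mul (contDiff_const.mul h2).neg.cexp

theorem fderiv_eq_line {E : Type} [NormedAddCommGroup E] [NormedSpace ℝ E] {g : E → ℂ} {z v : E} {d : ℂ}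
    (hg : DifferentiableAt ℝ g z)
    (h : HasDerivAt (fun s : ℝ => g (z + s • v)) d 0) : fderiv ℝ g z v = d := by
  have h1 : HasDerivAt (fun s : ℝ => z + s • v) ((1:ℝ) • v) 0 := by
    simpa using ((hasDerivAt_id (0:ℝ)).smul_const v).const_add z
  have h2 : HasFDerivAt g (fderiv ℝ g z) (z + (0:ℝ) • v) := by simpa using hg.hasFDerivAt
  have h3 := h2.comp_hasDerivAt (0:ℝ) h1
  rw [one_smul] at h3
  exact h3.unique h

theorem DXg_gk (a mu : ℝ) (k : ℕ) : DXg a (gk mu k) = fun z => 2 * z.re * Lam1 mu k (z.re^2 + z.im^2) +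
    2 * Complex.I * a * z.im * Lam mu k (z.re^2 + z.im^2) := by
  funext z
  rw [DXg, fderiv_eq_line (d := 2 * z.re * Lam1 mu k (z.re^2 + z.im^2)) ((gk_smooth mu k).differentiable (by simp) z)]
  · rfl
  · have h1 : HasDerivAt (fun s : ℝ => (z.re + s)^2 + z.im^2) (2 * z.re) 0 := by
      have := (((hasDerivAt_id (0:ℝ)).const_add z.re).pow 2).add_const (z.im^2)
      simpa using this
    have h2 := (Lam_deriv mu k ((z.re + 0)^2 + z.im^2)).scomp (0:ℝ) h1
    simp only [add_zero] at h2
    refine (h2.congr_of_eventuallyEq (Eventually.of_forall fun s => ?_)).congr_deriv ?_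
    · simp [gk]
    · simp

theorem DYg_gk (a mu : ℝ) (k : ℕ) : DYg a (gk mu k) = fun z => 2 * z.im * Lam1 mu k (z.re^2 + z.im^2) -
    2 * Complex.I * a * z.re * Lam mu k (z.re^2 + z.im^2) := by
  funext z
  rw [DYg, fderiv_eq_line (d := 2 * z.im * Lam1 mu k (z.re^2 + z.im^2)) ((gk_smooth mu k).differentiable (by simp) z)]
  · rfl
  · have h1 : HasDerivAt (fun s : ℝ => z.re^2 + (z.im + s)^2) (2 * z.im) 0 := by
      have := (((hasDerivAt_id (0:ℝ)).const_add z.im).pow 2).const_add (z.re^2)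
      simpa using this
    have h2 := (Lam_deriv mu k (z.re^2 + (z.im+0)^2)).scomp (0:ℝ) h1
    simp only [add_zero] at h2
    refine (h2.congr_of_eventuallyEq (Eventually.of_forall fun s => ?_)).congr_deriv ?_
    · simp [gk]
    · simp

theorem DXg_smooth (a : ℝ) {g : ℂ → ℂ} (hg : ContDiff ℝ ∞ g) : ContDiff ℝ ∞ (DXg a g) :=
  ((hg.fderiv_right (m := ∞) (by simp)).clm_apply contDiff_const).add
    ((contDiff_const.mul (ofReal_smooth.comp im_smooth)).mul hg)

theorem DYg_smooth (a : ℝ) {g : ℂ → ℂ} (hg : ContDiff ℝ ∞ g) : ContDiff ℝ ∞ (DYg a g) :=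
  ((hg.fderiv_right (m := ∞) (by simp)).clm_apply contDiff_const).sub
    ((contDiff_const.mul (ofReal_smooth.comp re_smooth)).mul hg)

theorem DXX (a mu : ℝ) (k : ℕ) (z : ℂ) : DXg a (DXg a (gk mu k)) z =
    2 * Lam1 mu k (z.re^2+z.im^2) + 4 * z.re^2 * Lam2 mu k (z.re^2+z.im^2)
    + 8 * Complex.I * a * z.re * z.im * Lam1 mu k (z.re^2+z.im^2) - 4 * a^2 * z.im^2 * Lam mu k (z.re^2+z.im^2) := by
  rw [DXg, fderiv_eq_line (d := 2 * Lam1 mu k (z.re^2+z.im^2) + 4 * z.re^2 * Lam2 mu k (z.re^2+z.im^2)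
    + 4 * Complex.I * a * z.re * z.im * Lam1 mu k (z.re^2+z.im^2)) ((DXg_smooth a (gk_smooth mu k)).differentiable (by simp) z)]
  · rw [DXg_gk]
    simp only
    linear_combination (4 * a^2 * (z.im:ℂ)^2 * Lam mu k (z.re^2+z.im^2)) * Complex.I_sq
  · have h1 : HasDerivAt (fun s : ℝ => (z.re + s)^2 + z.im^2) (2 * z.re) 0 := by
      have := (((hasDerivAt_id (0:ℝ)).const_add z.re).pow 2).add_const (z.im^2)
      simpa using this
    have h2 := (Lam_deriv mu k ((z.re + 0)^2 + z.im^2)).scomp (0:ℝ) h1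
    have h3 := (Lam1_deriv mu k ((z.re + 0)^2 + z.im^2)).scomp (0:ℝ) h1
    have h4 : HasDerivAt (fun s : ℝ => 2 * (((z.re + s : ℝ)) : ℂ)) (2 * ((1:ℝ):ℂ)) 0 :=
      (((hasDerivAt_id (0:ℝ)).const_add z.re).ofReal_comp).const_mul 2
    have h5 := (h4.fun_mul h3).fun_add (h2.const_mul (2 * Complex.I * a * z.im))
    refine (h5.congr_of_eventuallyEq (Eventually.of_forall fun s => ?_)).congr_deriv ?_
    · rw [DXg_gk]; simp
    · simp; ring

theorem DYY (a mu : ℝ) (k : ℕ) (z : ℂ) : DYg a (DYg a (gk mu k)) z =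
    2 * Lam1 mu k (z.re^2+z.im^2) + 4 * z.im^2 * Lam2 mu k (z.re^2+z.im^2)
    - 8 * Complex.I * a * z.re * z.im * Lam1 mu k (z.re^2+z.im^2) - 4 * a^2 * z.re^2 * Lam mu k (z.re^2+z.im^2) := by
  rw [DYg, fderiv_eq_line (d := 2 * Lam1 mu k (z.re^2+z.im^2) + 4 * z.im^2 * Lam2 mu k (z.re^2+z.im^2)
    - 4 * Complex.I * a * z.re * z.im * Lam1 mu k (z.re^2+z.im^2)) ((DYg_smooth a (gk_smooth mu k)).differentiable (by simp) z)]
  · rw [DYg_gk]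
    simp only
    linear_combination (4 * a^2 * (z.re:ℂ)^2 * Lam mu k (z.re^2+z.im^2)) * Complex.I_sq
  · have h1 : HasDerivAt (fun s : ℝ => z.re^2 + (z.im+s)^2) (2 * z.im) 0 := by
      have := (((hasDerivAt_id (0:ℝ)).const_add z.im).pow 2).const_add (z.re^2)
      simpa using this
    have h2 := (Lam_deriv mu k (z.re^2 + (z.im+0)^2)).scomp (0:ℝ) h1
    have h3 := (Lam1_deriv mu k (z.re^2 + (z.im+0)^2)).scomp (0:ℝ) h1
    have h4 : HasDerivAt (fun s : ℝ => 2 * (((z.im + s : ℝ)) : ℂ)) (2 * ((1:ℝ):ℂ)) 0 :=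
      (((hasDerivAt_id (0:ℝ)).const_add z.im).ofReal_comp).const_mul 2
    have h5 := (h4.fun_mul h3).fun_sub (h2.const_mul (2 * Complex.I * a * z.re))
    refine (h5.congr_of_eventuallyEq (Eventually.of_forall fun s => ?_)).congr_deriv ?_
    · rw [DYg_gk]; simp
    · simp; ring

theorem DXXYY (a mu : ℝ) (ha : a^2 = mu^2) (k : ℕ) (z : ℂ) :
    DXg a (DXg a (gk mu k)) z + DYg a (DYg a (gk mu k)) z = -(4 * mu * (2 * k + 1)) * gk mu k z := by
  rw [DXX, DYY, gk]
  have := Lam_ode mu k (z.re^2+z.im^2)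
  have ha' : (a:ℂ)^2 = (mu:ℂ)^2 := by exact_mod_cast ha
  push_cast at this
  linear_combination this - 4 * ((z.re:ℂ)^2 + (z.im:ℂ)^2) * Lam mu k (z.re^2+z.im^2) * ha'

end

section

open scoped ContDiff

def prodF (n : ℕ) (a : ℝ) (g : Fin n → ℂ → ℂ) (p : Hn n) : ℂ :=
  Complex.exp (Complex.I * a * p.2) * ∏ i, g i (p.1 i)

theorem coord_smooth (n : ℕ) (i : Fin n) : ContDiff ℝ ∞ (fun p : Hn n => p.1 i) :=
  ((ContinuousLinearMap.proj (R := ℝ) (φ := fun _ : Fin n => ℂ) i).comp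
    (ContinuousLinearMap.fst ℝ (Fin n → ℂ) ℝ)).contDiff

theorem tcoord_smooth (n : ℕ) : ContDiff ℝ ∞ (fun p : Hn n => ((p.2 : ℝ) : ℂ)) :=
  (Complex.ofRealCLM.comp (ContinuousLinearMap.snd ℝ (Fin n → ℂ) ℝ)).contDiff

theorem prodF_smooth (n : ℕ) (a : ℝ) (g : Fin n → ℂ → ℂ) (hg : ∀ i, ContDiff ℝ ∞ (g i)) : ContDiff ℝ ∞ (prodF n a g) := by
  refine ContDiff.mul ?_ ?_
  · exact (contDiff_const.mul (tcoord_smooth n)).cexp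
  · exact contDiff_prod fun i _ => (hg i).comp (coord_smooth n i)

def vecC (n : ℕ) (j : Fin n) (c : ℂ) : Hn n := (fun i => if i = j then c else 0, 0)

theorem prodF_split (n : ℕ) (a : ℝ) (g : Fin n → ℂ → ℂ) (j : Fin n) (p : Hn n) :
    prodF n a g p = Complex.exp (Complex.I * a * p.2) * (g j (p.1 j) * ∏ i ∈ Finset.univ.erase j, g i (p.1 i)) := by
  rw [Finset.mul_prod_erase _ (fun i => g i (p.1 i)) (Finset.mem_univ j)]; rfl

theorem prodF_update (n : ℕ) (a : ℝ) (g : Fin n → ℂ → ℂ) (j : Fin n) (h : ℂ → ℂ) (p : Hn n) :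
    prodF n a (Function.update g j h) p =
      Complex.exp (Complex.I * a * p.2) * (h (p.1 j) * ∏ i ∈ Finset.univ.erase j, g i (p.1 i)) := by
  rw [prodF_split n a _ j, Function.update_self]
  congr 2
  refine Finset.prod_congr rfl fun i hi => ?_
  rw [Function.update_of_ne (Finset.ne_of_mem_erase hi)]

theorem dirD_vec (n : ℕ) (a : ℝ) (g : Fin n → ℂ → ℂ) (hg : ∀ i, ContDiff ℝ ∞ (g i)) (j : Fin n) (c : ℂ) (p : Hn n) :
    dirD (vecC n j c) (prodF n a g) p =
      Complex.exp (Complex.I * a * p.2) * (fderiv ℝ (g j) (p.1 j) c * ∏ i ∈ Finset.univ.erase j, g i (p.1 i)) := by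
  refine fderiv_eq_line ((prodF_smooth n a g hg).differentiable (by simp) p) ?_
  have h1 : HasDerivAt (fun s : ℝ => p.1 j + s • c) ((1:ℝ) • c) 0 :=
    ((hasDerivAt_id (0:ℝ)).smul_const c).const_add (p.1 j)
  have h2 : HasFDerivAt (g j) (fderiv ℝ (g j) (p.1 j)) (p.1 j + (0:ℝ) • c) := by
    simpa using ((hg j).differentiable (by simp) (p.1 j)).hasFDerivAt
  have h3 := h2.comp_hasDerivAt (0:ℝ) h1
  rw [one_smul] at h3
  have h4 := (h3.mul_const (∏ i ∈ Finset.univ.erase j, g i (p.1 i))).const_mul (Complex.exp (Complex.I * a * p.2))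
  refine h4.congr_of_eventuallyEq (Eventually.of_forall fun s => ?_)
  simp only
  rw [prodF_split n a g j]
  have e1 : (p + s • vecC n j c).2 = p.2 := by simp [vecC]
  have e2 : (p + s • vecC n j c).1 j = p.1 j + s • c := by simp [vecC]
  have e3 : ∀ i ∈ Finset.univ.erase j, g i ((p + s • vecC n j c).1 i) = g i (p.1 i) := by
    intro i hi
    simp [vecC, Finset.ne_of_mem_erase hi]
  rw [e1, e2, Finset.prod_congr rfl e3]
  rfl

theorem dirD_T (n : ℕ) (a : ℝ) (g : Fin n → ℂ → ℂ) (hg : ∀ i, ContDiff ℝ ∞ (g i)) (p : Hn n) :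
    dirD (eT n) (prodF n a g) p = Complex.I * a * prodF n a g p := by
  refine fderiv_eq_line ((prodF_smooth n a g hg).differentiable (by simp) p) ?_
  have h1 : HasDerivAt (fun s : ℝ => Complex.I * a * ((p.2 + s : ℝ) : ℂ)) (Complex.I * a * ((1:ℝ):ℂ)) 0 :=
    (((hasDerivAt_id (0:ℝ)).const_add p.2).ofReal_comp).const_mul _
  have h2 := h1.cexp.mul_const (∏ i, g i (p.1 i))
  refine (h2.congr_of_eventuallyEq (Eventually.of_forall fun s => ?_)).congr_deriv ?_
  · simp [prodF, eT]
  · simp [prodF]; ring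

theorem XH_prodF (n : ℕ) (a : ℝ) (g : Fin n → ℂ → ℂ) (hg : ∀ i, ContDiff ℝ ∞ (g i)) (j : Fin n) :
    XH n j (prodF n a g) = prodF n a (Function.update g j (DXg a (g j))) := by
  funext p
  have := dirD_vec n a g hg j 1 p
  rw [XH, show eX n j = vecC n j 1 from rfl, this, dirD_T n a g hg, prodF_update, prodF_split n a g j, DXg]
  ring

theorem YH_prodF (n : ℕ) (a : ℝ) (g : Fin n → ℂ → ℂ) (hg : ∀ i, ContDiff ℝ ∞ (g i)) (j : Fin n) :
    YH n j (prodF n a g) = prodF n a (Function.update g j (DYg a (g j))) := by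
  funext p
  have := dirD_vec n a g hg j Complex.I p
  rw [YH, show eY n j = vecC n j Complex.I from rfl, this, dirD_T n a g hg, prodF_update, prodF_split n a g j, DYg]
  ring

theorem update_smooth {n : ℕ} {g : Fin n → ℂ → ℂ} (hg : ∀ i, ContDiff ℝ ∞ (g i)) (j : Fin n) {h : ℂ → ℂ} (hh : ContDiff ℝ ∞ h)
    (i : Fin n) : ContDiff ℝ ∞ (Function.update g j h i) := by
  by_cases hi : i = j
  · subst hi; rw [Function.update_self]; exact hh
  · rw [Function.update_of_ne hi]; exact hg i

theorem eig_prodF (n : ℕ) (a mu : ℝ) (ha : a^2 = mu^2) (k : Fin n → ℕ) (p : Hn n) :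
    -(1/4) * ∑ j, (XH n j (XH n j (prodF n a fun i => gk mu (k i))) p + YH n j (YH n j (prodF n a fun i => gk mu (k i))) p) =
      (2 * (∑ j, k j : ℕ) + n : ℂ) * mu * prodF n a (fun i => gk mu (k i)) p := by
  have hg : ∀ i, ContDiff ℝ ∞ (gk mu (k i)) := fun i => gk_smooth mu (k i)
  have e : ∀ j, XH n j (XH n j (prodF n a fun i => gk mu (k i))) p + YH n j (YH n j (prodF n a fun i => gk mu (k i))) p
      = -(4 * mu * (2 * k j + 1)) * prodF n a (fun i => gk mu (k i)) p := by
    intro j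
    rw [XH_prodF n a _ hg, YH_prodF n a _ hg, XH_prodF n a _ (update_smooth hg j (DXg_smooth a (hg j))),
      YH_prodF n a _ (update_smooth hg j (DYg_smooth a (hg j))), Function.update_self, Function.update_self,
      Function.update_idem, Function.update_idem, prodF_update, prodF_update, prodF_split n a _ j]
    have := DXXYY a mu ha (k j) (p.1 j)
    linear_combination (Complex.exp (Complex.I * a * p.2) * ∏ i ∈ Finset.univ.erase j, gk mu (k i) (p.1 i)) * this
  rw [Finset.sum_congr rfl fun j _ => e j, ← Finset.sum_mul]
  have : ∑ j, -(4 * (mu:ℂ) * (2 * (k j:ℂ) + 1)) = -(4 * mu) * (2 * (∑ j, k j : ℕ) + n) := by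
    rw [Finset.sum_neg_distrib, ← Finset.mul_sum, Finset.sum_add_distrib, ← Finset.mul_sum]
    push_cast
    simp
  rw [this]; ring

theorem T_prodF (n : ℕ) (a mu : ℝ) (ha : a^2 = mu^2) (g : Fin n → ℂ → ℂ) (hg : ∀ i, ContDiff ℝ ∞ (g i)) (p : Hn n) :
    TH n (TH n (prodF n a g)) p = -(mu * mu * prodF n a g p) := by
  have e : TH n (prodF n a g) = fun p => (Complex.I * a) * prodF n a g p := funext fun p => dirD_T n a g hg p
  rw [e, TH, dirD, fderiv_const_mul ((prodF_smooth n a g hg).differentiable (by simp) p)]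
  have := dirD_T n a g hg p
  rw [dirD] at this
  rw [smul_apply, this, smul_eq_mul]
  have ha' : (a:ℂ)^2 = (mu:ℂ)^2 := by exact_mod_cast ha
  linear_combination (Complex.I^2 * prodF n a g p) * ha' + (mu^2 * prodF n a g p) * Complex.I_sq

/-- linear part of left translation -/
def AL (n : ℕ) (om : Hn n) : Hn n →L[ℝ] Hn n :=
  (ContinuousLinearMap.fst ℝ (Fin n → ℂ) ℝ).prod
    ((ContinuousLinearMap.snd ℝ (Fin n → ℂ) ℝ) + ∑ j, ((2 * (om.1 j).im) • reL n j - (2 * (om.1 j).re) • imL n j))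

theorem AL_apply (n : ℕ) (om w : Hn n) : AL n om w + om = HeisMul n om w := by
  refine Prod.ext ?_ ?_
  · simp [AL, HeisMul, add_comm]
  · simp only [AL, HeisMul, Prod.snd_add, ContinuousLinearMap.prod_apply, add_apply, sum_apply, sub_apply, smul_apply]
    rw [Complex.im_sum, Finset.mul_sum]
    have : ∀ j, 2 * (om.1 j * (starRingEnd ℂ) (w.1 j)).im = (2 * (om.1 j).im) • reL n j w - (2 * (om.1 j).re) • imL n j w := by
      intro j
      simp [reL, imL, Complex.mul_im]
      ring
    simp only [this]
    simp; ring

theorem HeisMul_smooth (n : ℕ) (om : Hn n) : ContDiff ℝ ∞ (HeisMul n om) := by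
  have : HeisMul n om = fun w => AL n om w + om := funext fun w => (AL_apply n om w).symm
  rw [this]; exact (AL n om).contDiff.add contDiff_const

theorem dirD_trans (n : ℕ) (om : Hn n) {f : Hn n → ℂ} (hf : Differentiable ℝ f) (v p : Hn n) :
    dirD v (fun w => f (HeisMul n om w)) p = fderiv ℝ f (HeisMul n om p) (AL n om v) := by
  have : HeisMul n om = fun w => AL n om w + om := funext fun w => (AL_apply n om w).symm
  have h1 : HasFDerivAt (HeisMul n om) (AL n om) p := by
    rw [this]; exact (AL n om).hasFDerivAt.add_const om
  have h2 := (hf (HeisMul n om p)).hasFDerivAt.comp p h1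
  have h3 : HasFDerivAt (fun w => f (HeisMul n om w)) _ p := h2
  rw [dirD, h3.fderiv]; rfl

theorem AL_vec (n : ℕ) (om : Hn n) (j : Fin n) (c : ℂ) :
    AL n om (vecC n j c) = vecC n j c + (2 * (om.1 j).im * c.re - 2 * (om.1 j).re * c.im) • eT n := by
  refine Prod.ext ?_ ?_
  · simp [AL, eT]
  · simp only [AL, vecC, eT, ContinuousLinearMap.prod_apply, add_apply, sum_apply, sub_apply, smul_apply]
    simp [reL, imL, apply_ite Complex.re, apply_ite Complex.im]

theorem AL_T (n : ℕ) (om : Hn n) : AL n om (eT n) = eT n := by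
  refine Prod.ext ?_ ?_
  · simp [AL, eT]
  · simp [AL, eT, reL, imL]

theorem XH_trans (n : ℕ) (om : Hn n) {f : Hn n → ℂ} (hf : Differentiable ℝ f) (j : Fin n) :
    XH n j (fun w => f (HeisMul n om w)) = fun w => XH n j f (HeisMul n om w) := by
  funext p
  rw [XH, dirD_trans n om hf, dirD_trans n om hf, show eX n j = vecC n j 1 from rfl, AL_vec, AL_T, map_add, map_smul, XH,
    show eX n j = vecC n j 1 from rfl, dirD, dirD, Complex.real_smul]
  simp [HeisMul]; ring

theorem YH_trans (n : ℕ) (om : Hn n) {f : Hn n → ℂ} (hf : Differentiable ℝ f) (j : Fin n) :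
    YH n j (fun w => f (HeisMul n om w)) = fun w => YH n j f (HeisMul n om w) := by
  funext p
  rw [YH, dirD_trans n om hf, dirD_trans n om hf, show eY n j = vecC n j Complex.I from rfl, AL_vec, AL_T, map_add, map_smul, YH,
    show eY n j = vecC n j Complex.I from rfl, dirD, dirD, Complex.real_smul]
  simp [HeisMul]; ring

theorem TH_trans (n : ℕ) (om : Hn n) {f : Hn n → ℂ} (hf : Differentiable ℝ f) :
    TH n (fun w => f (HeisMul n om w)) = fun w => TH n f (HeisMul n om w) := by
  funext p
  rw [TH, dirD_trans n om hf, AL_T]; rfl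

end

section

open scoped ContDiff SchwartzMap

def QK (n : ℕ) (sg : ℝ) (k : Fin n → ℕ) (om : Hn n) (mu : ℝ) (w : Hn n) : ℂ :=
  prodF n (sg * mu) (fun i => gk mu (k i)) (HeisMul n om w)

theorem QK_JS (n : ℕ) (sg : ℝ) (k : Fin n → ℕ) (om : Hn n) : JS n (QK n sg k om) := by
  have hw : ContDiff ℝ ∞ (fun q : ℝ × Hn n => HeisMul n om q.2) := (HeisMul_smooth n om).comp contDiff_snd
  have hmu : ContDiff ℝ ∞ (fun q : ℝ × Hn n => q.1) := contDiff_fst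
  have hcoord : ∀ i, ContDiff ℝ ∞ (fun q : ℝ × Hn n => (HeisMul n om q.2).1 i) := fun i => (coord_smooth n i).comp hw
  have ht : ContDiff ℝ ∞ (fun q : ℝ × Hn n => (((HeisMul n om q.2).2 : ℝ) : ℂ)) := (tcoord_smooth n).comp hw
  have hc : ContDiff ℝ ∞ (fun q : ℝ × Hn n => ((sg * q.1 : ℝ) : ℂ)) := ofReal_smooth.comp (contDiff_const.mul hmu)
  have hg : ∀ i, ContDiff ℝ ∞ (fun q : ℝ × Hn n => gk q.1 (k i) ((HeisMul n om q.2).1 i)) := fun i => by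
    have h2 : ContDiff ℝ ∞ (fun q : ℝ × Hn n => (q.1, (HeisMul n om q.2).1 i)) := hmu.prodMk (hcoord i)
    have h3 := ContDiff.comp (g := fun q : ℝ × ℂ => gk q.1 (k i) q.2)
      (f := fun q : ℝ × Hn n => (q.1, (HeisMul n om q.2).1 i)) (gk_joint (k i)) h2
    simpa only [Function.comp_def] using h3
  have he : ContDiff ℝ ∞ (fun q : ℝ × Hn n => Complex.exp (Complex.I * ((sg * q.1 : ℝ) : ℂ) * (((HeisMul n om q.2).2 : ℝ) : ℂ))) :=
    ((contDiff_const.mul hc).mul ht).cexp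
  have hp : ContDiff ℝ ∞ (fun q : ℝ × Hn n => ∏ i, gk q.1 (k i) ((HeisMul n om q.2).1 i)) := contDiff_prod fun i _ => hg i
  have hh := he.mul hp
  unfold JS QK prodF
  exact hh

theorem QK_eig (n : ℕ) (sg : ℝ) (hsg : sg^2 = 1) (k : Fin n → ℕ) (om : Hn n) (mu : ℝ) (w : Hn n) :
    -(1/4) * ∑ j, (XH n j (XH n j (QK n sg k om mu)) w + YH n j (YH n j (QK n sg k om mu)) w) =
      ((2 * (∑ j, k j : ℕ) + n : ℝ) : ℂ) * (mu:ℂ) * QK n sg k om mu w := by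
  have hg : ∀ i, ContDiff ℝ ∞ (gk mu (k i)) := fun i => gk_smooth mu (k i)
  have hs := prodF_smooth n (sg * mu) _ hg
  have hX : ∀ j, ContDiff ℝ ∞ (XH n j (prodF n (sg * mu) fun i => gk mu (k i))) := fun j => by
    rw [XH_eq]; exact POp_smooth _ (goodC_X n j) hs
  have hY : ∀ j, ContDiff ℝ ∞ (YH n j (prodF n (sg * mu) fun i => gk mu (k i))) := fun j => by
    rw [YH_eq]; exact POp_smooth _ (goodC_Y n j) hs
  have e : QK n sg k om mu = fun w => prodF n (sg * mu) (fun i => gk mu (k i)) (HeisMul n om w) := rfl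
  have := eig_prodF n (sg * mu) mu (by rw [mul_pow, hsg, one_mul]) k (HeisMul n om w)
  rw [e]
  simp only [XH_trans n om (hs.differentiable (by simp)), YH_trans n om (hs.differentiable (by simp)),
    XH_trans n om ((hX _).differentiable (by simp)), YH_trans n om ((hY _).differentiable (by simp))]
  rw [this]; push_cast; ring

theorem QK_T (n : ℕ) (sg : ℝ) (hsg : sg^2 = 1) (k : Fin n → ℕ) (om : Hn n) (mu : ℝ) (w : Hn n) :
    TH n (TH n (QK n sg k om mu)) w = - ((mu:ℂ) * (mu:ℂ) * QK n sg k om mu w) := by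
  have hg : ∀ i, ContDiff ℝ ∞ (gk mu (k i)) := fun i => gk_smooth mu (k i)
  have hs := prodF_smooth n (sg * mu) _ hg
  have hT : ContDiff ℝ ∞ (TH n (prodF n (sg * mu) fun i => gk mu (k i))) := by
    rw [POp_zero_coeff]; exact POp_smooth _ (goodC_zero n) hs
  have e : QK n sg k om mu = fun w => prodF n (sg * mu) (fun i => gk mu (k i)) (HeisMul n om w) := rfl
  rw [e, TH_trans n om (hs.differentiable (by simp)), TH_trans n om (hT.differentiable (by simp))]
  exact T_prodF n (sg * mu) mu (by rw [mul_pow, hsg, one_mul]) _ hg _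

theorem Mult.prod {E : Type} [NormedAddCommGroup E] [NormedSpace ℝ E] {ι : Type} (s : Finset ι) (f : ι → E → ℂ)
    (h : ∀ i ∈ s, Mult (f i)) : Mult (fun x => ∏ i ∈ s, f i x) := by
  classical
  induction s using Finset.induction_on with
  | empty => simpa using Mult.const (E := E) 1
  | insert a s ha ih =>
    simp only [Finset.prod_insert ha]
    exact (h a (Finset.mem_insert_self _ _)).mul (ih fun i hi => h i (Finset.mem_insert_of_mem hi))

def rj (n : ℕ) (j : Fin n) (w : Hn n) : ℝ := (w.1 j).re^2 + (w.1 j).im^2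

theorem rj_mult (n : ℕ) (j : Fin n) : Mult (fun w : Hn n => ((rj n j w : ℝ) : ℂ)) := by
  have h1 : Mult (fun w : Hn n => (((w.1 j).re : ℝ) : ℂ)) := Mult.lin (Complex.ofRealCLM.comp (reL n j))
  have h2 : Mult (fun w : Hn n => (((w.1 j).im : ℝ) : ℂ)) := Mult.lin (Complex.ofRealCLM.comp (imL n j))
  have := (h1.pow 2).add (h2.pow 2)
  simpa [rj] using this

def z0 (n : ℕ) (sg : ℝ) (w : Hn n) : ℂ := (sg:ℂ) * ((w.2:ℝ):ℂ) + Complex.I * ∑ j, ((rj n j w : ℝ) : ℂ)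

theorem z0_mult (n : ℕ) (sg : ℝ) : Mult (z0 n sg) := by
  have h1 : Mult (fun w : Hn n => ((w.2:ℝ):ℂ)) :=
    Mult.lin (Complex.ofRealCLM.comp (ContinuousLinearMap.snd ℝ (Fin n → ℂ) ℝ))
  exact ((Mult.const _).mul h1).add ((Mult.const _).mul (Mult.sum _ _ fun j _ => rj_mult n j))

theorem z0_re (n : ℕ) (sg : ℝ) (w : Hn n) : (z0 n sg w).re = sg * w.2 := by
  rw [z0, ← Complex.ofReal_sum]; simp

theorem z0_im (n : ℕ) (sg : ℝ) (w : Hn n) : (z0 n sg w).im = ∑ j, rj n j w := by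
  rw [z0, ← Complex.ofReal_sum]; simp

theorem rj_nonneg (n : ℕ) (j : Fin n) (w : Hn n) : 0 ≤ rj n j w := by unfold rj; positivity

theorem z0_grow (n : ℕ) (sg : ℝ) (hsg : sg^2 = 1) (w : Hn n) : 1 + ‖w‖ ≤ 2 * (1 + ‖z0 n sg w‖) := by
  have hn := norm_nonneg (z0 n sg w)
  have h1 : ‖w‖ ≤ 1 + 2 * ‖z0 n sg w‖ := by
    refine max_le ?_ ?_
    · refine (pi_norm_le_iff_of_nonneg (by positivity)).2 fun j => ?_
      have a : ‖w.1 j‖^2 ≤ ‖z0 n sg w‖ := by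
        refine le_trans ?_ (Complex.abs_im_le_norm _)
        rw [z0_im, ← Complex.normSq_eq_norm_sq, Complex.normSq_apply]
        refine le_trans ?_ (le_abs_self _)
        refine le_trans (le_of_eq ?_) (Finset.single_le_sum (fun i _ => rj_nonneg n i w) (Finset.mem_univ j))
        unfold rj; ring
      nlinarith [sq_nonneg (‖w.1 j‖ - 1)]
    · have a : |sg * w.2| ≤ ‖z0 n sg w‖ := by rw [← z0_re]; exact Complex.abs_re_le_norm _
      have b : |sg| = 1 := by
        rw [← sq_abs] at hsg; exact (pow_eq_one_iff_of_nonneg (abs_nonneg _) (by norm_num)).1 hsg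
      rw [abs_mul, b, one_mul] at a
      rw [Real.norm_eq_abs]; linarith
  linarith

theorem HeisMul_inv (n : ℕ) (om w : Hn n) : HeisMul n (-om) (HeisMul n om w) = w := by
  refine Prod.ext ?_ ?_
  · simp [HeisMul]
  · simp [HeisMul, Finset.sum_add_distrib, mul_add, Complex.mul_im]
    simp only [mul_comm (Complex.re _)]
    ring

theorem z_ZDat (n : ℕ) (sg : ℝ) (hsg : sg^2 = 1) (om : Hn n) : ZDat (fun w => z0 n sg (HeisMul n om w)) := by
  refine ⟨?_, fun x => ?_, ?_⟩
  · have := (z0_mult n sg).comp_affine (AL n om) om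
    simpa only [AL_apply] using this
  · rw [z0_im]; exact Finset.sum_nonneg fun j _ => rj_nonneg n j _
  · refine ⟨(1 + ‖AL n (-om)‖ + ‖om‖) * 2, by positivity, fun x => ?_⟩
    have h1 := z0_grow n sg hsg (HeisMul n om x)
    have h2 : ‖x‖ ≤ ‖AL n (-om)‖ * ‖HeisMul n om x‖ + ‖om‖ := by
      conv_lhs => rw [← HeisMul_inv n om x, ← AL_apply]
      refine (norm_add_le _ _).trans ?_
      rw [norm_neg]; gcongr; exact ContinuousLinearMap.le_opNorm _ _
    have h3 := norm_nonneg (HeisMul n om x)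
    have h4 := norm_nonneg om
    have h5 := norm_nonneg (AL n (-om))
    calc 1 + ‖x‖ ≤ (1 + ‖AL n (-om)‖ + ‖om‖) * (1 + ‖HeisMul n om x‖) := by nlinarith [mul_nonneg h4 h3]
      _ ≤ (1 + ‖AL n (-om)‖ + ‖om‖) * (2 * (1 + ‖z0 n sg (HeisMul n om x)‖)) := by gcongr
      _ = _ := by ring

theorem prodF_expand (n : ℕ) (sg : ℝ) (k : Fin n → ℕ) (mu : ℝ) (w : Hn n) :
    prodF n (sg * mu) (fun i => gk mu (k i)) w =
      (∑ i ∈ Fintype.piFinset (fun j => Finset.range (k j + 1)), (mu:ℂ)^(∑ j, i j) *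
        ∏ j, ((lagA (k j) (i j) * 2^(i j)) * ((rj n j w : ℝ):ℂ)^(i j))) * Complex.exp (Complex.I * mu * z0 n sg w) := by
  have h1 : ∀ j, gk mu (k j) (w.1 j) = (∑ i ∈ Finset.range (k j + 1), (mu:ℂ)^i * ((lagA (k j) i * 2^i) * ((rj n j w : ℝ):ℂ)^i)) *
      Complex.exp (-(mu * (rj n j w : ℝ) : ℂ)) := by
    intro j
    rw [gk, Lam, lag, Polynomial.eval_finset_sum]
    congr 1
    refine Finset.sum_congr rfl fun i _ => ?_
    simp only [Polynomial.eval_mul, Polynomial.eval_C, Polynomial.eval_pow, Polynomial.eval_X, rj]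
    rw [mul_pow, mul_pow]; ring
  rw [prodF, Finset.prod_congr rfl fun j _ => h1 j, Finset.prod_mul_distrib, Finset.prod_univ_sum, ← Complex.exp_sum]
  simp only [Finset.prod_mul_distrib, Finset.prod_pow_eq_pow_sum]
  have h2 : Complex.exp (Complex.I * mu * z0 n sg w) = Complex.exp (Complex.I * (sg * mu : ℝ) * w.2) *
      Complex.exp (∑ j, -(mu * (rj n j w : ℝ) : ℂ)) := by
    rw [← Complex.exp_add, z0]
    congr 1
    rw [Finset.sum_neg_distrib, ← Finset.mul_sum]
    push_cast
    linear_combination (mu * ∑ j, ((rj n j w : ℝ):ℂ)) * Complex.I_sq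
  rw [h2]; ring

theorem QK_KDat (n : ℕ) (sg : ℝ) (hsg : sg^2 = 1) (k : Fin n → ℕ) (om : Hn n) :
    KDat (fun w => z0 n sg (HeisMul n om w)) (QK n sg k om) := by
  refine ⟨z_ZDat n sg hsg om, Fin n → ℕ, Fintype.piFinset (fun j => Finset.range (k j + 1)), fun i => ∑ j, i j,
    fun i w => ∏ j, ((lagA (k j) (i j) * 2^(i j)) * ((rj n j (HeisMul n om w) : ℝ):ℂ)^(i j)), fun i _ => ?_, fun mu x => ?_⟩
  · have h0 : Mult (fun w : Hn n => ∏ j, ((lagA (k j) (i j) * 2^(i j)) * ((rj n j w : ℝ):ℂ)^(i j))) :=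
      Mult.prod _ _ fun j _ => (Mult.const _).mul ((rj_mult n j).pow _)
    have := h0.comp_affine (AL n om) om
    simpa only [AL_apply] using this
  · exact prodF_expand n sg k mu _

theorem kernel_zero (n : ℕ) (hn : 1 ≤ n) (α : ℝ) (hα : 0 < α)
    (k₀ : ℕ) (hk₀ : k₀ = Nat.floor ((n : ℝ) * α) + 1)
    (f : Hn n → ℂ) (hfmeas : Measurable f) (hfbdd : BddFun f)
    (F : Sg n → ℂ) (hFbdd : ∃ C, ∀ p : Sg n, 0 < p.2 → ‖F p‖ ≤ C)
    (hFsmooth : ContDiffOn ℝ (⊤ : ℕ∞) F {p : Sg n | 0 < p.2})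
    (hFharm : ∀ p : Sg n, 0 < p.2 → Lalpha n α F p = 0)
    (hbv : IsBoundaryValue n F f)
    (hreg : ∀ φ : SchwartzMap (Hn n) ℂ, ∀ p : ℕ, p ≤ k₀ + 1 → ∃ C : ℝ,
      ∀ a : ℝ, 0 < a → a ≤ 1 →
        ‖∫ w : Hn n, ((DA n)^[p] F) (w, a) * φ w‖ ≤ C)
    (κ : ℕ) (hκ : 1 ≤ κ) (k : Fin n → ℕ) (hk : ∑ j, k j = κ) (sg : ℝ) (hsg : sg^2 = 1) (om : Hn n)
    {c d : ℝ} (hc : 0 < c) (hd : 0 ≤ d) {chi : ℝ → ℂ} (h : Chi c d chi) :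
    Integrable (KI (QK n sg k om) chi) ∧ ∫ w, f w * KI (QK n sg k om) chi w = 0 := by
  have hQ := QK_KDat n sg hsg k om
  have hcs : ∀ psi, Chi c d psi → HasCompactSupport psi := fun psi hp => HasCompactSupport.intro isCompact_Icc hp.supp
  have hsch : ∀ psi, Chi c d psi → IsSch (KI (QK n sg k om) psi) := fun psi hp => KI_isSch hQ (hp.adm hc hd) ()
  have hmul : ∀ psi, Chi c d psi → Chi c d (fun mu => (mu:ℂ) * psi mu) := fun psi hp =>
    ⟨ofReal_smooth.mul hp.smooth, fun mu hmu => by simp [hp.supp mu hmu]⟩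
  have E : FamHyp (LV n : 𝓢(Hn n, ℂ) →ₗ[ℂ] 𝓢(Hn n, ℂ)) (TV n : 𝓢(Hn n, ℂ) →ₗ[ℂ] 𝓢(Hn n, ℂ)) (eFam (QK n sg k om) chi) (2 * κ + n) := by
    refine famHyp_of_kernel hc hd hQ h _ _ _ (fun psi hp => ?_) (fun psi hp => ?_)
    · ext w
      have e1 := KI_LV (QK_JS n sg k om) hp.smooth.continuous (hcs _ hp) (2 * κ + n) (fun mu w => by
        rw [QK_eig n sg hsg k om mu w, hk]) w
      refine (LV_apply _ w).trans ?_
      rw [toS_coe (hsch _ hp), e1]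
      show _ = (_ : ℂ) * toS _ w
      rw [toS_coe (hsch _ (hmul _ hp))]
    · ext w
      have e1 := KI_TV (QK_JS n sg k om) hp.smooth.continuous (hcs _ hp) (fun mu w => QK_T n sg hsg k om mu w) w
      refine (TV_apply _ w).trans ?_
      rw [toS_coe (hsch _ hp), e1]
      show _ = - toS _ w
      rw [toS_coe (hsch _ (hmul _ (hmul _ hp)))]
  have r := concrete_core n hn α hα k₀ hk₀ f hfmeas hfbdd F hFbdd hFsmooth hFharm hbv hreg κ hκ _ E
  have e0 : (fun w => eFam (QK n sg k om) chi 0 0 w) = KI (QK n sg k om) chi := by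
    have : EG (fun mu => (mu:ℂ)^0 * chi mu) 0 = chi := by funext mu; simp [EG]
    funext w
    rw [eFam, this, toS_coe (hsch _ h)]
  refine ⟨?_, ?_⟩
  · rw [← e0]; exact (eFam (QK n sg k om) chi 0 0).integrable
  · rw [← r, ← e0]

end

section

section
open Polynomial

def Hp : ℕ → Polynomial ℂ
  | 0 => 1
  | k+1 => 2 * X * Hp k - (Hp k).derivative

theorem C2 : (C (2:ℂ) : Polynomial ℂ) = 2 := rfl

theorem Hp_deriv (k : ℕ) : (Hp (k+1)).derivative = C (2 * ((k:ℂ)+1)) * Hp k := by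
  induction k with
  | zero => simp [Hp, C2]
  | succ k ih =>
    have e : Hp (k+1+1) = 2 * X * Hp (k+1) - (Hp (k+1)).derivative := rfl
    rw [e, derivative_sub, derivative_mul, ih]
    have e2 : Hp (k+1) = 2 * X * Hp k - (Hp k).derivative := rfl
    have e3 : (derivative (C (2 * ((k:ℂ)+1)) * Hp k)) = C (2 * ((k:ℂ)+1)) * (Hp k).derivative := by simp
    have e4 : derivative (2 * X : Polynomial ℂ) = 2 := by simp
    rw [e3, e4]
    have e5 : C (2 * (((k+1:ℕ):ℂ)+1)) = (C (2 * ((k:ℂ)+1)) + 2 : Polynomial ℂ) := by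
      simp [C2]; ring
    rw [e5]
    linear_combination (C (2 * ((k:ℂ)+1))) * (-e2)

def GW (u : ℝ) (y : ℝ) : ℂ := Complex.exp (Complex.I * u * y) * Complex.exp (-1 * (y:ℂ)^2)

theorem GW_norm (u y : ℝ) : ‖GW u y‖ = Real.exp (-1 * y^2) := by
  rw [GW, norm_mul]
  have h1 : Complex.I * u * y = ((u * y : ℝ) : ℂ) * Complex.I := by push_cast; ring
  rw [h1, Complex.norm_exp_ofReal_mul_I, one_mul]
  rw [show (-1 * (y:ℂ)^2) = ((-1 * y^2 : ℝ) : ℂ) by push_cast; ring, Complex.norm_exp_ofReal]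

theorem GW_cont (u : ℝ) : Continuous (GW u) := by unfold GW; fun_prop

theorem GW_int (u : ℝ) (P : Polynomial ℂ) : Integrable (fun y : ℝ => P.eval (y:ℂ) * GW u y) := by
  induction P using Polynomial.induction_on' with
  | add p q hp hq => simp only [eval_add, add_mul]; exact hp.add hq
  | monomial m a =>
    have h := (integrable_rpow_mul_exp_neg_mul_sq (b := 1) one_pos (s := m) (by have := Nat.cast_nonneg (α := ℝ) m; linarith)).norm.const_mul ‖a‖
    refine h.mono' (by have := GW_cont u; exact Continuous.aestronglyMeasurable (by fun_prop)) (ae_of_all _ fun y => ?_)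
    rw [eval_monomial, norm_mul, norm_mul, GW_norm, norm_pow, Complex.norm_real, Real.rpow_natCast, norm_mul, norm_pow, mul_assoc,
      Real.norm_of_nonneg (Real.exp_pos _).le]

def GI (u : ℝ) (P : Polynomial ℂ) : ℂ := ∫ y : ℝ, P.eval (y:ℂ) * GW u y

theorem GI_add (u : ℝ) (P Q : Polynomial ℂ) : GI u (P + Q) = GI u P + GI u Q := by
  unfold GI; rw [← integral_add (GW_int u P) (GW_int u Q)]; simp only [eval_add, add_mul]

theorem GI_C_mul (u : ℝ) (c : ℂ) (P : Polynomial ℂ) : GI u (C c * P) = c * GI u P := by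
  unfold GI; rw [← integral_const_mul]; simp only [eval_mul, eval_C, mul_assoc]

theorem GW_deriv (u y : ℝ) : HasDerivAt (GW u) ((Complex.I * u - 2 * y) * GW u y) y := by
  have h0 : HasDerivAt (fun y : ℝ => (y:ℂ)) 1 y := Complex.ofRealCLM.hasDerivAt
  have h1 := ((h0.const_mul (Complex.I * u)).cexp).fun_mul (((h0.fun_pow 2).const_mul (-1)).cexp)
  refine h1.congr_deriv ?_
  simp only [GW]; push_cast; ring

theorem GI_ibp (u : ℝ) (P : Polynomial ℂ) : GI u (P.derivative + (C (Complex.I * u) - 2 * X) * P) = 0 := by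
  unfold GI
  refine integral_eq_zero_of_hasDerivAt_of_integrable (f := fun y : ℝ => P.eval (y:ℂ) * GW u y) (fun y => ?_) (GW_int u _) (GW_int u P)
  have h0 : HasDerivAt (fun y : ℝ => P.eval (y:ℂ)) (P.derivative.eval (y:ℂ)) y := (P.hasDerivAt (y:ℂ)).comp_ofReal
  refine (h0.fun_mul (GW_deriv u y)).congr_deriv ?_
  simp; ring

theorem GI_one (u : ℝ) : GI u 1 = (Real.sqrt Real.pi : ℝ) * Complex.exp (-(u:ℂ)^2/4) := by
  have := fourierIntegral_gaussian (b := 1) (by simp) (u:ℂ)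
  unfold GI GW
  simp only [eval_one, one_mul]
  rw [this]
  congr 1
  · rw [div_one, Real.sqrt_eq_rpow, Complex.ofReal_cpow Real.pi_pos.le]; norm_num
  · norm_num

def JJ (u : ℝ) (a b : ℂ) (j k : ℕ) : ℂ := GI u ((Hp j).comp (X + C a) * (Hp k).comp (X + C b))

theorem JJ_comm (u : ℝ) (a b : ℂ) (j k : ℕ) : JJ u a b j k = JJ u b a k j := by unfold JJ; rw [mul_comm]

theorem GI_sub (u : ℝ) (P Q : Polynomial ℂ) : GI u (P - Q) = GI u P - GI u Q := by
  have := GI_add u (P - Q) Q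
  rw [sub_add_cancel] at this; rw [this]; ring

theorem JJ_rec0 (u : ℝ) (a b : ℂ) (k : ℕ) : JJ u a b 0 (k+1) = (Complex.I * u + 2 * b) * JJ u a b 0 k := by
  have e : (Hp 0).comp (X + C a) * (Hp (k+1)).comp (X + C b) =
      C (Complex.I * u + 2 * b) * ((Hp 0).comp (X + C a) * (Hp k).comp (X + C b)) -
      (((Hp k).comp (X + C b)).derivative + (C (Complex.I * u) - 2 * X) * (Hp k).comp (X + C b)) := by
    rw [derivative_comp]
    simp [Hp, C2]
    ring
  rw [JJ, e, GI_sub, GI_ibp, GI_C_mul, sub_zero]; rfl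

theorem JJ_rec (u : ℝ) (a b : ℂ) (j k : ℕ) : JJ u a b (j+1) (k+1) = (Complex.I * u + 2 * b) * JJ u a b (j+1) k +
    2 * ((j:ℂ)+1) * JJ u a b j k := by
  have hd : ((Hp (j+1)).comp (X + C a)).derivative = C (2 * ((j:ℂ)+1)) * (Hp j).comp (X + C a) := by
    rw [derivative_comp, Hp_deriv]; simp
  have hd2 : ((Hp k).comp (X + C b)).derivative = (Hp k).derivative.comp (X + C b) := by
    rw [derivative_comp]; simp
  have hk : (Hp (k+1)).comp (X + C b) = 2 * (X + C b) * (Hp k).comp (X + C b) - ((Hp k).comp (X + C b)).derivative := by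
    rw [hd2]; simp [Hp]
  have e : (Hp (j+1)).comp (X + C a) * (Hp (k+1)).comp (X + C b) =
      (C (Complex.I * u + 2 * b) * ((Hp (j+1)).comp (X + C a) * (Hp k).comp (X + C b)) +
        C (2 * ((j:ℂ)+1)) * ((Hp j).comp (X + C a) * (Hp k).comp (X + C b))) -
      (((Hp (j+1)).comp (X + C a) * (Hp k).comp (X + C b)).derivative + (C (Complex.I * u) - 2 * X) *
        ((Hp (j+1)).comp (X + C a) * (Hp k).comp (X + C b))) := by
    rw [derivative_mul, hd, hk]
    simp only [C_add, C_mul, C_ofNat]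
    ring
  rw [JJ, e, GI_sub, GI_ibp, GI_add, GI_C_mul, GI_C_mul, sub_zero]; rfl

theorem JJ_zero (u : ℝ) (a b : ℂ) (j : ℕ) : JJ u a b j 0 = (Complex.I * u + 2 * a)^j * GI u 1 := by
  induction j with
  | zero => simp [JJ, Hp]
  | succ j ih => rw [JJ_comm, JJ_rec0, ← JJ_comm, ih]; ring

def SS (A B : ℂ) (j k : ℕ) : ℂ := ∑ i ∈ Finset.range (k+1), (i.factorial * j.choose i * k.choose i : ℂ) * 2^i * A^(j-i) * B^(k-i)

theorem SS_zero (A B : ℂ) (j : ℕ) : SS A B j 0 = A^j := by simp [SS]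

theorem SS_rec (A B : ℂ) (j k : ℕ) : SS A B j (k+1) = B * SS A B j k + 2 * j * SS A B (j-1) k := by
  have h1 : B * SS A B j k = ∑ i ∈ Finset.range (k+1+1), (i.factorial * j.choose i * k.choose i : ℂ) * 2^i * A^(j-i) * B^(k+1-i) := by
    rw [Finset.sum_range_succ, Nat.choose_succ_self, SS, Finset.mul_sum]
    simp only [Nat.cast_zero, mul_zero, zero_mul, add_zero]
    refine Finset.sum_congr rfl fun i hi => ?_
    rw [Nat.succ_sub (by simp at hi; omega), pow_succ]; ring
  have h2 : 2 * j * SS A B (j-1) k = ∑ i ∈ Finset.range (k+1), ((i+1).factorial * j.choose (i+1) * k.choose i : ℂ) * 2^(i+1) * A^(j-(i+1)) * B^(k+1-(i+1)) := by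
    rw [SS, Finset.mul_sum]
    refine Finset.sum_congr rfl fun i hi => ?_
    rcases j with _ | j
    · simp
    · have := Nat.add_one_mul_choose_eq j i
      have t : ((j:ℂ)+1) * j.choose i = (j+1).choose (i+1) * (i+1) := by exact_mod_cast this
      rw [Nat.factorial_succ]
      simp only [Nat.add_sub_cancel, Nat.add_sub_add_right]
      push_cast
      linear_combination (2 * i.factorial * k.choose i * 2^i * A^(j-i) * B^(k-i) : ℂ) * t
  rw [h1, h2, SS, Finset.sum_range_succ', Finset.sum_range_succ' (n := k+1) (f := fun i => (i.factorial * j.choose i * k.choose i : ℂ) * 2^i * A^(j-i) * B^(k+1-i))]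
  rw [add_right_comm, ← Finset.sum_add_distrib]
  congr 1
  · refine Finset.sum_congr rfl fun i hi => ?_
    rw [Nat.choose_succ_succ k i]; push_cast; ring
  · simp

theorem JJ_eq (u : ℝ) (a b : ℂ) (j k : ℕ) : JJ u a b j k = SS (Complex.I * u + 2 * a) (Complex.I * u + 2 * b) j k * GI u 1 := by
  induction k generalizing j with
  | zero => rw [JJ_zero, SS_zero]
  | succ k ih =>
    rw [SS_rec]
    rcases j with _ | j
    · rw [JJ_rec0, ih]; simp; ring
    · rw [JJ_rec, ih, ih]; push_cast; ring_nf

theorem SS_lag (A B : ℂ) (k : ℕ) : SS A B k k = 2^k * k.factorial * (lag k).eval (-(A*B)/2) := by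
  rw [lag, eval_finsetSum, SS, Finset.mul_sum, ← Finset.sum_range_reflect]
  refine Finset.sum_congr rfl fun i hi => ?_
  have hi : i ≤ k := by simp at hi; omega
  have e1 : k + 1 - 1 - i = k - i := by omega
  rw [e1, Nat.sub_sub_self hi, Nat.choose_symm hi]
  simp only [eval_mul, eval_C, eval_pow, eval_X, lagA]
  have h := Nat.choose_mul_factorial_mul_factorial hi
  have h' : (k.choose i : ℂ) * i.factorial * (k-i).factorial = k.factorial := by exact_mod_cast h
  have hf : (i.factorial : ℂ) ≠ 0 := by exact_mod_cast i.factorial_ne_zero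
  have h2 : (2:ℂ)^k = 2^(k-i) * 2^i := by rw [← pow_add]; congr 1; omega
  rw [← h', h2, div_pow, neg_pow (A*B), mul_pow]
  field_simp
  have : ((-1:ℂ)^i)^2 = 1 := by rw [← pow_mul, mul_comm, pow_mul]; simp
  rw [this, mul_one]
end

end

section

section
open Polynomial

def HpR : ℕ → Polynomial ℝ
  | 0 => 1
  | k+1 => 2 * X * HpR k - (HpR k).derivative

theorem HpR_map (k : ℕ) : (HpR k).map Complex.ofRealHom = Hp k := by
  induction k with
  | zero => simp [HpR, Hp]
  | succ k ih => simp [HpR, Hp, ih, ← derivative_map]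

theorem HpR_eval (k : ℕ) (x : ℝ) : (((HpR k).eval x : ℝ) : ℂ) = (Hp k).eval (x:ℂ) := by
  rw [← HpR_map, eval_map]
  exact Polynomial.hom_eval₂ _ (RingHom.id ℝ) Complex.ofRealHom x

theorem iter_gauss (k : ℕ) : deriv^[k] (fun y : ℝ => Real.exp (-y ^ 2)) = fun y => (-1)^k * (HpR k).eval y * Real.exp (-y^2) := by
  induction k with
  | zero => simp [HpR]
  | succ k ih =>
    rw [Function.iterate_succ_apply', ih]
    funext y
    have h1 : HasDerivAt (fun y : ℝ => Real.exp (-y^2)) (Real.exp (-y^2) * (-(2 * y))) y := by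
      have := ((hasDerivAt_id y).fun_pow 2).fun_neg.exp
      refine this.congr_deriv ?_
      simp
    have h2 := (((HpR k).hasDerivAt y).const_mul ((-1:ℝ)^k)).fun_mul h1
    rw [h2.deriv]
    simp [HpR]; ring

def NN (k : ℕ) : ℝ := (Real.sqrt Real.pi * 2 ^ k * (Nat.factorial k : ℝ)) ^ (-(1/2 : ℝ))

theorem NN_sq (k : ℕ) : NN k * NN k * (Real.sqrt Real.pi * 2 ^ k * (Nat.factorial k : ℝ)) = 1 := by
  have hp : 0 < Real.sqrt Real.pi * 2 ^ k * (Nat.factorial k : ℝ) := by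
    have := Real.sqrt_pos.2 Real.pi_pos
    have := Nat.factorial_pos k
    positivity
  rw [NN, ← Real.rpow_add hp]
  norm_num
  rw [Real.rpow_neg_one]
  have := hp.ne'
  field_simp

theorem hermiteFun_eq (k : ℕ) (x : ℝ) : hermiteFun k x = NN k * (HpR k).eval x * Real.exp (-x^2/2) := by
  rw [hermiteFun, iter_gauss, NN]
  have h1 : Real.exp (-x^2/2) = Real.exp (x^2/2) * Real.exp (-x^2) := by rw [← Real.exp_add]; congr 1; ring
  have h2 : ((-1:ℝ)^k)^2 = 1 := by rw [← pow_mul, mul_comm, pow_mul]; simp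
  rw [h1]
  linear_combination ((Real.sqrt Real.pi * 2 ^ k * (Nat.factorial k : ℝ)) ^ (-(1/2 : ℝ)) * (HpR k).eval x * Real.exp (x^2/2) * Real.exp (-x^2)) * h2

theorem MM_eq (k : ℕ) (u v : ℝ) : ∫ x : ℝ, Complex.exp (Complex.I * (u * x + u * v / 2)) * (hermiteFun k (x+v) : ℂ) * (hermiteFun k x : ℂ)
    = (lag k).eval (((u:ℂ)^2 + (v:ℂ)^2)/2) * Complex.exp (-((u:ℂ)^2+(v:ℂ)^2)/4) := by
  obtain ⟨G, hG⟩ : ∃ G : ℝ → ℂ, G = (fun y : ℝ => ((NN k : ℂ) * NN k * Complex.exp (-(v:ℂ)^2/4)) *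
        (((Hp k).comp (X + C ((v:ℂ)/2)) * (Hp k).comp (X + C (-(v:ℂ)/2))).eval (y:ℂ) * GW u y)) := ⟨_, rfl⟩
  have e : ∀ x : ℝ, Complex.exp (Complex.I * (u * x + u * v / 2)) * (hermiteFun k (x+v) : ℂ) * (hermiteFun k x : ℂ) =
      G (x + v/2) := by
    intro x
    rw [hG]
    simp only [eval_mul, eval_comp, eval_add, eval_X, eval_C]
    rw [hermiteFun_eq, hermiteFun_eq]
    push_cast
    rw [HpR_eval, HpR_eval]
    have a1 : (x:ℂ) + v/2 + v/2 = ((x+v:ℝ):ℂ) := by push_cast; ring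
    have a2 : (x:ℂ) + v/2 + -v/2 = (x:ℂ) := by ring
    rw [a1, a2]
    have a3 : Complex.exp (Complex.I * (u * x + u * v / 2)) * Complex.exp (-((x:ℂ)+v)^2/2) * Complex.exp (-(x:ℂ)^2/2) =
        Complex.exp (-(v:ℂ)^2/4) * GW u (x + v/2) := by
      rw [GW, ← Complex.exp_add, ← Complex.exp_add, ← Complex.exp_add, ← Complex.exp_add]
      congr 1
      push_cast; ring
    linear_combination (NN k * NN k * (Hp k).eval ((x+v:ℝ):ℂ) * (Hp k).eval (x:ℂ) : ℂ) * a3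
  rw [integral_congr_ae (ae_of_all _ e), integral_add_right_eq_self, hG, integral_const_mul]
  have h := JJ_eq u ((v:ℂ)/2) (-(v:ℂ)/2) k k
  rw [JJ, GI] at h
  rw [h, SS_lag, GI_one]
  have hN : (NN k : ℂ) * NN k * ((Real.sqrt Real.pi:ℝ) * 2 ^ k * (Nat.factorial k : ℂ)) = 1 := by exact_mod_cast NN_sq k
  have h3 : -((Complex.I * u + 2 * ((v:ℂ)/2)) * (Complex.I * u + 2 * (-(v:ℂ)/2)))/2 = ((u:ℂ)^2 + (v:ℂ)^2)/2 := by
    linear_combination (-(u:ℂ)^2/2) * Complex.I_sq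
  have h4 : Complex.exp (-((u:ℂ)^2+(v:ℂ)^2)/4) = Complex.exp (-(v:ℂ)^2/4) * Complex.exp (-(u:ℂ)^2/4) := by
    rw [← Complex.exp_add]; congr 1; ring
  rw [h3, h4]
  linear_combination ((lag k).eval (((u:ℂ)^2 + (v:ℂ)^2)/2) * Complex.exp (-(v:ℂ)^2/4) * Complex.exp (-(u:ℂ)^2/4)) * hN
end

/-- one dimensional factor -/
theorem factor_eq (k : ℕ) (lam : ℝ) (hl : lam ≠ 0) (u v : ℝ) :
    ∫ x : ℝ, ((2 * Real.pi * |lam|) ^ ((1:ℝ)/2) : ℝ) * (Complex.exp (2 * Real.pi * Complex.I * lam * (u * x + u * v / 2)) *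
      (hermiteFun k ((2 * Real.pi * |lam|) ^ ((1:ℝ)/2) * (x + v)) : ℂ) * (hermiteFun k ((2 * Real.pi * |lam|) ^ ((1:ℝ)/2) * x) : ℂ))
     = gk (Real.pi * |lam| / 2) k ⟨u, v⟩ := by
  have hs : 0 < 2 * Real.pi * |lam| := by have := Real.pi_pos; have := abs_pos.2 hl; positivity
  set r : ℝ := (2 * Real.pi * |lam|) ^ ((1:ℝ)/2) with hr
  have hr0 : 0 < r := Real.rpow_pos_of_pos hs _
  have hr2 : r * r = 2 * Real.pi * |lam| := by rw [hr, ← Real.rpow_add hs]; norm_num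
  set b : ℝ := 2 * Real.pi * lam / r with hb
  have hbr : b * r = 2 * Real.pi * lam := by rw [hb]; field_simp
  have hb2 : b^2 = r^2 := by
    have h1 : b^2 * r^2 = r^2 * r^2 := by
      have : (b*r)^2 = (r*r)^2 := by rw [hbr, hr2]; rw [mul_pow, mul_pow (2 * Real.pi), sq_abs]
      nlinarith
    exact mul_right_cancel₀ (by positivity) h1
  obtain ⟨G, hG⟩ : ∃ G : ℝ → ℂ, G = (fun y : ℝ => (r:ℂ) * (Complex.exp (Complex.I * ((b * u : ℝ) * y + (b * u : ℝ) * (r * v : ℝ) / 2)) * (hermiteFun k (y+ r * v) : ℂ) * (hermiteFun k y : ℂ))) := ⟨_, rfl⟩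
  have e : ∀ x : ℝ, (r:ℂ) * (Complex.exp (2 * Real.pi * Complex.I * lam * (u * x + u * v / 2)) *
      (hermiteFun k (r * (x + v)) : ℂ) * (hermiteFun k (r * x) : ℂ)) =
      G (r * x) := by
    intro x
    rw [hG]
    have hbr' : (b:ℂ) * r = 2 * Real.pi * lam := by exact_mod_cast hbr
    have : Complex.I * ((b * u : ℝ) * (r * x : ℝ) + (b * u : ℝ) * (r * v : ℝ) / 2) = 2 * Real.pi * Complex.I * lam * (u * x + u * v / 2) := by
      push_cast
      linear_combination (Complex.I * (u * x + u * v / 2)) * hbr'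
    simp only
    rw [this, mul_add r x v]
  rw [integral_congr_ae (ae_of_all _ e), MeasureTheory.Measure.integral_comp_mul_left, hG, integral_const_mul, MM_eq, gk, Lam, Complex.real_smul, abs_of_pos (inv_pos.2 hr0)]
  have hrc : (r:ℂ) ≠ 0 := by exact_mod_cast hr0.ne'
  have hb2' : (b:ℂ)^2 = (r:ℂ)^2 := by exact_mod_cast hb2
  have hr2' : (r:ℂ)^2 = 2 * Real.pi * (|lam|:ℝ) := by rw [← Complex.ofReal_pow, sq, hr2]; push_cast; ring
  have e1 : ((((b * u : ℝ) : ℂ))^2 + ((r * v : ℝ):ℂ)^2) = 2 * Real.pi * (|lam|:ℝ) * (u^2+v^2) := by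
    push_cast; rw [mul_pow, mul_pow, hb2', hr2']; ring
  rw [e1]
  push_cast
  rw [← mul_assoc, inv_mul_cancel₀ hrc, one_mul]
  congr 2 <;> ring

theorem eKappa_term (n : ℕ) (lam : ℝ) (hl : lam ≠ 0) (k : Fin n → ℕ) (w : Hn n) :
    ∫ x : Fin n → ℝ, Rrep n lam w (fun x' => ((hermiteLam n lam k x' : ℝ) : ℂ)) x *
        (starRingEnd ℂ) ((hermiteLam n lam k x : ℝ) : ℂ) =
    Complex.exp (Complex.I * (Real.pi * lam / 2 : ℝ) * w.2) * ∏ j, gk (Real.pi * |lam| / 2) (k j) (w.1 j) := by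
  have hs : 0 < 2 * Real.pi * |lam| := by have := Real.pi_pos; have := abs_pos.2 hl; positivity
  have h := integral_fintype_prod_eq_prod (𝕜 := ℂ) (ι := Fin n) (E := fun _ => ℝ) (μ := fun _ => volume) (fun j (x : ℝ) =>
    (((2 * Real.pi * |lam|) ^ ((1:ℝ)/2) : ℝ) : ℂ) * (Complex.exp (2 * Real.pi * Complex.I * lam * ((w.1 j).re * x + (w.1 j).re * (w.1 j).im / 2)) *
      (hermiteFun (k j) ((2 * Real.pi * |lam|) ^ ((1:ℝ)/2) * (x + (w.1 j).im)) : ℂ) * (hermiteFun (k j) ((2 * Real.pi * |lam|) ^ ((1:ℝ)/2) * x) : ℂ)))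
  have h2 : ∀ j, gk (Real.pi * |lam| / 2) (k j) (w.1 j) = _ := fun j => (factor_eq (k j) lam hl (w.1 j).re (w.1 j).im).symm
  rw [Finset.prod_congr rfl fun j _ => h2 j, ← h, ← integral_const_mul]
  refine integral_congr_ae (ae_of_all _ fun x => ?_)
  simp only [Rrep, hermiteLam, hermiteMulti, Complex.conj_ofReal, Finset.prod_mul_distrib, Finset.prod_const, Finset.card_univ, Fintype.card_fin]
  rw [← Complex.exp_sum]
  have a1 : ((2 * Real.pi * |lam|) ^ ((n:ℝ)/4)) * ((2 * Real.pi * |lam|) ^ ((n:ℝ)/4)) = ((2 * Real.pi * |lam|) ^ ((1:ℝ)/2))^n := by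
    rw [← Real.rpow_add hs, ← Real.rpow_natCast, ← Real.rpow_mul hs.le]; congr 1; ring
  have a1' : (((2 * Real.pi * |lam|) ^ ((n:ℝ)/4) : ℝ) : ℂ) * (((2 * Real.pi * |lam|) ^ ((n:ℝ)/4) : ℝ) : ℂ) = (((2 * Real.pi * |lam|) ^ ((1:ℝ)/2) : ℝ) : ℂ)^n := by
    exact_mod_cast a1
  have a2 : Complex.exp (2 * Real.pi * Complex.I * (lam : ℂ) *
      (((∑ j, (w.1 j).re * x j) + (∑ j, (w.1 j).re * (w.1 j).im) / 2 + w.2 / 4 : ℝ) : ℂ)) =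
      Complex.exp (Complex.I * (Real.pi * lam / 2 : ℝ) * w.2) *
      Complex.exp (∑ j, 2 * Real.pi * Complex.I * lam * ((w.1 j).re * (x j : ℂ) + (w.1 j).re * (w.1 j).im / 2)) := by
    rw [← Complex.exp_add, ← Finset.mul_sum, Finset.sum_add_distrib, ← Finset.sum_div]
    congr 1
    push_cast; ring
  rw [a2, ← a1']
  push_cast
  ring

theorem eKappaLam_eq (n κ : ℕ) (lam : ℝ) (hl : lam ≠ 0) (w : Hn n) :
    eKappaLam n κ lam w = ∑ k ∈ Finset.Nat.antidiagonalTuple n κ,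
      Complex.exp (Complex.I * (Real.pi * lam / 2 : ℝ) * w.2) * ∏ j, gk (Real.pi * |lam| / 2) (k j) (w.1 j) :=
  Finset.sum_congr rfl fun k _ => eKappa_term n lam hl k w

end

section

section
open scoped ContDiff

def chiS (psi : ℝ → ℝ) (sg : ℝ) (mu : ℝ) : ℂ := if 0 < mu then ((2 / Real.pi * psi (2 * sg / Real.pi * mu) : ℝ) : ℂ) else 0

theorem chiS_Chi (psi : ℝ → ℝ) (h1 : ContDiff ℝ ∞ psi) (h2 : HasCompactSupport psi) (h3 : (0:ℝ) ∉ tsupport psi) (sg : ℝ)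
    (hsg : sg^2 = 1) : ∃ c d : ℝ, 0 < c ∧ 0 ≤ d ∧ Chi c d (chiS psi sg) := by
  have hpi := Real.pi_pos
  have hab : |sg| = 1 := by
    rw [← sq_abs] at hsg; exact (pow_eq_one_iff_of_nonneg (abs_nonneg _) (by norm_num)).1 hsg
  obtain ⟨ε, hε, hball⟩ := Metric.isOpen_iff.1 (isClosed_tsupport psi).isOpen_compl 0 h3
  obtain ⟨R, hR⟩ := h2.isBounded.subset_closedBall 0
  have hz1 : ∀ x, |x| < ε → psi x = 0 := fun x hx =>
    image_eq_zero_of_notMem_tsupport (hball (by simpa [Metric.mem_ball, Real.dist_eq] using hx))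
  have hz2 : ∀ x, R < |x| → psi x = 0 := fun x hx =>
    image_eq_zero_of_notMem_tsupport fun hm => by
      have := hR hm
      rw [Metric.mem_closedBall, Real.dist_eq, sub_zero] at this
      linarith
  have habs : ∀ mu : ℝ, 0 < mu → |2 * sg / Real.pi * mu| = 2 / Real.pi * mu := fun mu hmu => by
    rw [abs_mul, abs_div, abs_mul, hab, abs_of_pos hpi, abs_of_pos hmu, abs_two, mul_one]
  have key : ∀ mu, mu < Real.pi * ε / 2 → chiS psi sg mu = 0 := fun mu hmu => by
    unfold chiS
    split_ifs with h
    · rw [hz1, mul_zero, Complex.ofReal_zero]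
      rw [habs mu h, div_mul_eq_mul_div, div_lt_iff₀ hpi]; linarith
    · rfl
  refine ⟨Real.pi * ε / 2, Real.pi * |R| / 2, by positivity, by positivity, ?_, fun mu hmu => ?_⟩
  · rw [contDiff_iff_contDiffAt]
    intro mu
    by_cases h : mu < Real.pi * ε / 2
    · have : chiS psi sg =ᶠ[𝓝 mu] fun _ => 0 := by
        filter_upwards [Iio_mem_nhds h] with x hx using key x hx
      exact contDiffAt_const.congr_of_eventuallyEq this
    · have hmu : 0 < mu := lt_of_lt_of_le (by positivity) (not_lt.1 h)
      have : chiS psi sg =ᶠ[𝓝 mu] fun x => ((2 / Real.pi * psi (2 * sg / Real.pi * x) : ℝ) : ℂ) := by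
        filter_upwards [Ioi_mem_nhds hmu] with x hx
        exact if_pos hx
      refine ContDiffAt.congr_of_eventuallyEq ?_ this
      have a : ContDiff ℝ ∞ (fun x : ℝ => 2 / Real.pi * psi (2 * sg / Real.pi * x)) :=
        contDiff_const.mul (h1.comp (contDiff_const.mul contDiff_id))
      exact (ofReal_smooth.comp a).contDiffAt
  · by_cases h : mu < Real.pi * ε / 2
    · exact key mu h
    · have hmu0 : 0 < mu := lt_of_lt_of_le (by positivity) (not_lt.1 h)
      have hd : Real.pi * |R| / 2 < mu := by
        by_contra hc
        exact hmu ⟨not_lt.1 h, not_lt.1 hc⟩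
      unfold chiS
      rw [if_pos hmu0, hz2, mul_zero, Complex.ofReal_zero]
      rw [habs mu hmu0, div_mul_eq_mul_div, lt_div_iff₀ hpi]
      have := le_abs_self R
      nlinarith

def Tk (n : ℕ) (k : Fin n → ℕ) (w : Hn n) (lam : ℝ) : ℂ :=
  Complex.exp (Complex.I * (Real.pi * lam / 2 : ℝ) * w.2) * ∏ j, gk (Real.pi * |lam| / 2) (k j) (w.1 j)

def GS (n : ℕ) (psi : ℝ → ℝ) (sg : ℝ) (k : Fin n → ℕ) (w : Hn n) (lam : ℝ) : ℂ :=
  if 0 < sg * lam then (psi lam : ℂ) * Tk n k w lam else 0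

theorem GS_comp (n : ℕ) (psi : ℝ → ℝ) (sg : ℝ) (hsg : sg^2 = 1) (k : Fin n → ℕ) (om w : Hn n) (mu : ℝ) :
    chiS psi sg mu * QK n sg k om mu w = (2 / Real.pi : ℝ) * GS n psi sg k (HeisMul n om w) (2 * sg / Real.pi * mu) := by
  have hpi := Real.pi_pos
  have e1 : sg * (2 * sg / Real.pi * mu) = 2 / Real.pi * mu := by
    linear_combination (2 / Real.pi * mu) * hsg
  unfold chiS GS
  rw [e1]
  by_cases h : 0 < mu
  · have h' : 0 < 2 / Real.pi * mu := by positivity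
    have hab : |sg| = 1 := by
      rw [← sq_abs] at hsg; exact (pow_eq_one_iff_of_nonneg (abs_nonneg _) (by norm_num)).1 hsg
    rw [if_pos h, if_pos h', QK, prodF, Tk]
    have e2 : Real.pi * |2 * sg / Real.pi * mu| / 2 = mu := by
      rw [abs_mul, abs_div, abs_mul, hab, abs_of_pos hpi, abs_of_pos h, abs_two]; field_simp
    have e3 : Real.pi * (2 * sg / Real.pi * mu) / 2 = sg * mu := by field_simp
    rw [e2, e3]; push_cast; ring
  · have h' : ¬ 0 < 2 / Real.pi * mu := fun hc => h (by
      by_contra hcc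
      have : 2 / Real.pi * mu ≤ 0 := mul_nonpos_of_nonneg_of_nonpos (by positivity) (not_lt.1 hcc)
      linarith)
    rw [if_neg h, if_neg h']; simp

theorem GS_int (n : ℕ) (psi : ℝ → ℝ) (h1 : ContDiff ℝ ∞ psi) (h2 : HasCompactSupport psi) (h3 : (0:ℝ) ∉ tsupport psi) (sg : ℝ)
    (hsg : sg^2 = 1) (k : Fin n → ℕ) (om w : Hn n) :
    Integrable (GS n psi sg k (HeisMul n om w)) ∧ KI (QK n sg k om) (chiS psi sg) w = ∫ lam, GS n psi sg k (HeisMul n om w) lam := by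
  have hpi := Real.pi_pos
  obtain ⟨c, d, hc, hd, hchi⟩ := chiS_Chi psi h1 h2 h3 sg hsg
  have hab : |sg| = 1 := by
    rw [← sq_abs] at hsg; exact (pow_eq_one_iff_of_nonneg (abs_nonneg _) (by norm_num)).1 hsg
  have hsg0 : sg ≠ 0 := fun h => by rw [h] at hab; simp at hab
  have hR : 2 * sg / Real.pi ≠ 0 := by positivity
  have hi := (QK_JS n sg k om).integrable hchi.smooth.continuous (HasCompactSupport.intro isCompact_Icc hchi.supp) w
  simp only [GS_comp n psi sg hsg k om w] at hi
  have hne : ((2 / Real.pi : ℝ) : ℂ) ≠ 0 := by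
    have : (2 / Real.pi : ℝ) ≠ 0 := by positivity
    exact_mod_cast this
  have hi2 := hi.const_mul (((2 / Real.pi : ℝ) : ℂ))⁻¹
  simp only [← mul_assoc, inv_mul_cancel₀ hne, one_mul] at hi2
  refine ⟨(integrable_comp_mul_left_iff _ hR).1 hi2, ?_⟩
  rw [KI]
  simp only [GS_comp n psi sg hsg k om w]
  rw [integral_const_mul, Measure.integral_comp_mul_left, Complex.real_smul, ← mul_assoc, ← Complex.ofReal_mul, abs_inv, abs_div,
    abs_mul, hab, abs_two, abs_of_pos hpi, mul_one, mul_inv_cancel₀ (by positivity), Complex.ofReal_one, one_mul]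

theorem eKappaPsi_eq (n κ : ℕ) (psi : ℝ → ℝ) (h1 : ContDiff ℝ ∞ psi) (h2 : HasCompactSupport psi) (h3 : (0:ℝ) ∉ tsupport psi)
    (om w : Hn n) : eKappaPsi n κ psi (HeisMul n om w) = ∑ k ∈ Finset.Nat.antidiagonalTuple n κ,
      (KI (QK n 1 k om) (chiS psi 1) w + KI (QK n (-1) k om) (chiS psi (-1)) w) := by
  have hp := fun k => GS_int n psi h1 h2 h3 1 (by norm_num) k om w
  have hm := fun k => GS_int n psi h1 h2 h3 (-1) (by norm_num) k om w
  have e : ∀ lam : ℝ, eKappaLam n κ lam (HeisMul n om w) * ((psi lam : ℝ) : ℂ) = ∑ k ∈ Finset.Nat.antidiagonalTuple n κ,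
      (GS n psi 1 k (HeisMul n om w) lam + GS n psi (-1) k (HeisMul n om w) lam) := by
    intro lam
    by_cases hl : lam = 0
    · have : psi lam = 0 := by rw [hl]; exact image_eq_zero_of_notMem_tsupport h3
      simp [GS, this]
    · rw [eKappaLam_eq n κ lam hl, Finset.sum_mul]
      refine Finset.sum_congr rfl fun k _ => ?_
      unfold GS Tk
      rcases lt_or_gt_of_ne hl with h | h
      · rw [if_neg (by linarith), if_pos (by linarith)]; ring
      · rw [if_pos (by linarith), if_neg (by linarith)]; ring
  rw [eKappaPsi, integral_congr_ae (ae_of_all _ e), integral_finsetSum _ (fun k _ => by exact (hp k).1.add (hm k).1)]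
  refine Finset.sum_congr rfl fun k _ => ?_
  rw [integral_add (hp k).1 (hm k).1, (hp k).2, (hm k).2]

theorem HeisMul_mp (n : ℕ) (om : Hn n) : MeasurePreserving (HeisMul n om) volume volume := by
  have hg : Measurable (Function.uncurry (fun (z : Fin n → ℂ) (t : ℝ) => om.2 + t + 2 * (∑ j, om.1 j * (starRingEnd ℂ) (z j)).im)) := by
    have : Continuous (Function.uncurry (fun (z : Fin n → ℂ) (t : ℝ) => om.2 + t + 2 * (∑ j, om.1 j * (starRingEnd ℂ) (z j)).im)) := by
      unfold Function.uncurry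
      fun_prop
    exact this.measurable
  have h := MeasurePreserving.skew_product (μa := (volume : Measure (Fin n → ℂ))) (μb := volume) (μc := (volume : Measure ℝ)) (μd := volume)
    (measurePreserving_add_left volume om.1) hg (ae_of_all _ fun z => by
      have : (fun t : ℝ => om.2 + t + 2 * (∑ j, om.1 j * (starRingEnd ℂ) (z j)).im) =
          fun t => (om.2 + 2 * (∑ j, om.1 j * (starRingEnd ℂ) (z j)).im) + t := by funext t; ring
      rw [this]
      exact (measurePreserving_add_left volume _).map_eq)
  exact h

theorem HeisMul_inv' (n : ℕ) (om w : Hn n) : HeisMul n om (HeisMul n (-om) w) = w := by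
  have := HeisMul_inv n (-om) w
  rwa [neg_neg] at this

def HeisHomeo (n : ℕ) (om : Hn n) : Hn n ≃ₜ Hn n where
  toFun := HeisMul n om
  invFun := HeisMul n (-om)
  left_inv := HeisMul_inv n om
  right_inv := HeisMul_inv' n om
  continuous_toFun := (HeisMul_smooth n om).continuous
  continuous_invFun := (HeisMul_smooth n (-om)).continuous

theorem final_zero (n : ℕ) (hn : 1 ≤ n) (α : ℝ) (hα : 0 < α)
    (k₀ : ℕ) (hk₀ : k₀ = Nat.floor ((n : ℝ) * α) + 1)
    (f : Hn n → ℂ) (hfmeas : Measurable f) (hfbdd : BddFun f)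
    (F : Sg n → ℂ) (hFbdd : ∃ C, ∀ p : Sg n, 0 < p.2 → ‖F p‖ ≤ C)
    (hFsmooth : ContDiffOn ℝ (⊤ : ℕ∞) F {p : Sg n | 0 < p.2})
    (hFharm : ∀ p : Sg n, 0 < p.2 → Lalpha n α F p = 0)
    (hbv : IsBoundaryValue n F f)
    (hreg : ∀ φ : SchwartzMap (Hn n) ℂ, ∀ p : ℕ, p ≤ k₀ + 1 → ∃ C : ℝ,
      ∀ a : ℝ, 0 < a → a ≤ 1 →
        ‖∫ w : Hn n, ((DA n)^[p] F) (w, a) * φ w‖ ≤ C)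
    (κ : ℕ) (hκ : 1 ≤ κ) (om : Hn n) (psi : ℝ → ℝ) (h1 : ContDiff ℝ ∞ psi) (h2 : HasCompactSupport psi) (h3 : (0:ℝ) ∉ tsupport psi) :
    ∫ w : Hn n, f (HeisMul n om w) * eKappaPsi n κ psi w = 0 := by
  obtain ⟨G, hG⟩ : ∃ G : Hn n → ℂ, G = fun w => f w * eKappaPsi n κ psi (HeisMul n (-om) w) := ⟨_, rfl⟩
  have e : ∀ w, f (HeisMul n om w) * eKappaPsi n κ psi w = G (HeisMul n om w) := by
    intro w
    rw [hG]
    simp only [HeisMul_inv]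
  rw [integral_congr_ae (ae_of_all _ e), (HeisMul_mp n om).integral_comp (HeisHomeo n om).measurableEmbedding]
  rw [hG]
  simp only [eKappaPsi_eq n κ psi h1 h2 h3, Finset.mul_sum, mul_add]
  have key : ∀ sg : ℝ, sg^2 = 1 → ∀ k ∈ Finset.Nat.antidiagonalTuple n κ,
      Integrable (fun w => f w * KI (QK n sg k (-om)) (chiS psi sg) w) ∧
      ∫ w, f w * KI (QK n sg k (-om)) (chiS psi sg) w = 0 := by
    intro sg hsg k hk
    obtain ⟨c, d, hc, hd, hchi⟩ := chiS_Chi psi h1 h2 h3 sg hsg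
    have := kernel_zero n hn α hα k₀ hk₀ f hfmeas hfbdd F hFbdd hFsmooth hFharm hbv hreg κ hκ k
      (Finset.Nat.mem_antidiagonalTuple.1 hk) sg hsg (-om) hc hd hchi
    obtain ⟨C, hC⟩ := hfbdd
    exact ⟨this.1.bdd_mul hfmeas.aestronglyMeasurable (ae_of_all _ hC), this.2⟩
  have kp := key 1 (by norm_num)
  have km := key (-1) (by norm_num)
  rw [integral_finsetSum _ (fun k hk => by exact (kp k hk).1.add (km k hk).1)]
  refine Finset.sum_eq_zero fun k hk => ?_
  rw [integral_add (kp k hk).1 (km k hk).1, (kp k hk).2, (km k hk).2, add_zero]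
end

end

/-- If `f ∈ L^∞(H^n)` is the boundary value of a bounded smooth `L_α`-harmonic
function `F` on `S` whose derivatives `∂_a^p F`, `0 ≤ p ≤ k₀+1`, are bounded against Schwartz
functions (`k₀` the smallest integer bigger than `nα`), then for every `κ ≥ 1`, `ω ∈ H^n` and
`ψ ∈ C_c^∞(ℝ \ {0})`, one has `∫_{H^n} f(ω·w) e_κ^ψ(w) dw = 0`. -/
theorem stmt8 (n : ℕ) (hn : 1 ≤ n) (α : ℝ) (hα : 0 < α)
    (k₀ : ℕ) (hk₀ : k₀ = Nat.floor ((n : ℝ) * α) + 1)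
    (f : Hn n → ℂ) (hfmeas : Measurable f) (hfbdd : BddFun f)
    (F : Sg n → ℂ) (hFbdd : ∃ C, ∀ p : Sg n, 0 < p.2 → ‖F p‖ ≤ C)
    (hFsmooth : ContDiffOn ℝ (⊤ : ℕ∞) F {p : Sg n | 0 < p.2})
    (hFharm : ∀ p : Sg n, 0 < p.2 → Lalpha n α F p = 0)
    (hbv : IsBoundaryValue n F f)
    (hreg : ∀ φ : SchwartzMap (Hn n) ℂ, ∀ p : ℕ, p ≤ k₀ + 1 → ∃ C : ℝ,
      ∀ a : ℝ, 0 < a → a ≤ 1 →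
        ‖∫ w : Hn n, ((DA n)^[p] F) (w, a) * φ w‖ ≤ C) :
    ∀ κ : ℕ, 1 ≤ κ → ∀ ω : Hn n, ∀ ψ : ℝ → ℝ,
      ContDiff ℝ (⊤ : ℕ∞) ψ → HasCompactSupport ψ → (0 : ℝ) ∉ tsupport ψ →
      ∫ w : Hn n, f (HeisMul n ω w) * eKappaPsi n κ ψ w = 0 := by
  intro κ hκ ω ψ h1 h2 h3
  exact final_zero n hn α hα k₀ hk₀ f hfmeas hfbdd F hFbdd hFsmooth hFharm hbv hreg κ hκ ω ψ h1 h2 h3
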